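/- arXiv:1009.0833 — 2 statements merged into one kernel-verified Lean document; each statement's English description precedes it below -/
import Mathlib

section
/- Let Δ be a simplicial complex on [n] with dim Δ ≥ 2. The following conditions are equivalent: (i) I_Δ^{(m)} is generalized Cohen–Macaulay for every m ≥ 1; (ii) I_Δ^{(m)} is generalized Cohen–Macaulay for some m ≥ 3; (iii) Δ is a union of disjoint matroids of the same dimension. -/
open CategoryTheory Opposite

/-! ### Abstract simplicial complexes -/

/-- An abstract simplicial complex on the vertex set `Fin n`: a collection of finite
subsets (faces) closed under taking subsets. -/
structure SimComplex (n : ℕ) where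
  faces : Set (Finset (Fin n))
  down_closed : ∀ ⦃F G : Finset (Fin n)⦄, F ∈ faces → G ⊆ F → G ∈ faces

namespace SimComplex

variable {n : ℕ}

/-- The vertex set of a simplicial complex. -/
def vertexSet (Δ : SimComplex n) : Set (Fin n) := {v | ({v} : Finset (Fin n)) ∈ Δ.faces}

/-- The dimension of a simplicial complex: the maximal cardinality of a face, minus one. -/
noncomputable def dim (Δ : SimComplex n) : ℤ :=
  (Int.ofNat (sSup (Finset.card '' Δ.faces))) - 1

/-- A facet is a maximal face. -/
def IsFacet (Δ : SimComplex n) (F : Finset (Fin n)) : Prop :=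
  F ∈ Δ.faces ∧ ∀ G ∈ Δ.faces, F ⊆ G → F = G

/-- A complex is pure if all facets have the same cardinality. -/
def Pure (Δ : SimComplex n) : Prop :=
  ∀ F G, Δ.IsFacet F → Δ.IsFacet G → F.card = G.card

/-- A matroid: for any two faces `F`, `G` with `|F| > |G|` there is `i ∈ F ∖ G`
with `G ∪ {i}` a face. -/
def IsMatroid (Δ : SimComplex n) : Prop :=
  ∀ F G, F ∈ Δ.faces → G ∈ Δ.faces → G.card < F.card →
    ∃ i ∈ F, i ∉ G ∧ insert i G ∈ Δ.faces

/-- The link of a face `G`: `{F ∖ G : G ⊆ F ∈ Δ}`. -/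
def link (Δ : SimComplex n) (G : Finset (Fin n)) : SimComplex n where
  faces := {F | Disjoint F G ∧ F ∪ G ∈ Δ.faces}
  down_closed := by
    intro F F' hF hsub
    exact ⟨hF.1.mono_left hsub, Δ.down_closed hF.2 (Finset.union_subset_union hsub subset_rfl)⟩

/-- The star of a face `G`: `{F ∈ Δ : F ∪ G ∈ Δ}`. -/
def star (Δ : SimComplex n) (G : Finset (Fin n)) : SimComplex n where
  faces := {F | F ∈ Δ.faces ∧ F ∪ G ∈ Δ.faces}
  down_closed := by
    intro F F' hF hsub
    exact ⟨Δ.down_closed hF.1 hsub, Δ.down_closed hF.2 (Finset.union_subset_union hsub subset_rfl)⟩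

/-- `Δ` is locally a matroid if the link of every vertex is a matroid. -/
def LocallyMatroid (Δ : SimComplex n) : Prop :=
  ∀ v ∈ Δ.vertexSet, (Δ.link {v}).IsMatroid

/-- Two vertices are adjacent if they span a 1-dimensional face (an edge). -/
def Adj (Δ : SimComplex n) (u v : Fin n) : Prop :=
  u ≠ v ∧ ({u, v} : Finset (Fin n)) ∈ Δ.faces

/-- Two vertices are joined by a path of edges. -/
def Reach (Δ : SimComplex n) : Fin n → Fin n → Prop := Relation.ReflTransGen Δ.Adj

/-- A complex is connected if any two vertices are joined by a path of edges. -/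
def Connected (Δ : SimComplex n) : Prop :=
  ∀ u ∈ Δ.vertexSet, ∀ v ∈ Δ.vertexSet, Δ.Reach u v

/-- The induced subcomplex on a set `W` of vertices. -/
def induced (Δ : SimComplex n) (W : Set (Fin n)) : SimComplex n where
  faces := {F | F ∈ Δ.faces ∧ ↑F ⊆ W}
  down_closed := by
    intro F F' hF hsub
    exact ⟨Δ.down_closed hF.1 hsub, subset_trans (Finset.coe_subset.2 hsub) hF.2⟩

/-- The connected component of a vertex `v`, as an induced subcomplex. -/
def component (Δ : SimComplex n) (v : Fin n) : SimComplex n :=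
  Δ.induced {u | Δ.Reach v u}

/-- A minimal nonface: a subset of the vertex set which is not a face, all of whose
proper subsets are faces. -/
def IsMinNonface (Δ : SimComplex n) (F : Finset (Fin n)) : Prop :=
  ↑F ⊆ Δ.vertexSet ∧ F ∉ Δ.faces ∧ ∀ G ⊂ F, G ∈ Δ.faces

/-- A complete intersection complex: the minimal nonfaces are pairwise disjoint. -/
def IsCompleteIntersection (Δ : SimComplex n) : Prop :=
  ∀ F G, Δ.IsMinNonface F → Δ.IsMinNonface G → F ≠ G → Disjoint F G

/-- `Δ` is locally a complete intersection if the link of every vertex is one. -/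
def LocallyCompleteIntersection (Δ : SimComplex n) : Prop :=
  ∀ v ∈ Δ.vertexSet, (Δ.link {v}).IsCompleteIntersection

/-- A path graph: vertices `f 0, …, f (k+1)` and edges exactly the consecutive pairs. -/
def IsPathGraph (Δ : SimComplex n) : Prop :=
  ∃ (k : ℕ) (f : Fin (k + 2) → Fin n), Function.Injective f ∧
    Δ.vertexSet = Set.range f ∧
    ∀ e : Finset (Fin n), (e ∈ Δ.faces ∧ e.card = 2) ↔
      ∃ i : Fin (k + 1), e = {f i.castSucc, f i.succ}

/-- A cycle graph: vertices `f 0, …, f (k+2)` and edges exactly the cyclically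
consecutive pairs. -/
def IsCycleGraph (Δ : SimComplex n) : Prop :=
  ∃ (k : ℕ) (f : Fin (k + 3) → Fin n), Function.Injective f ∧
    Δ.vertexSet = Set.range f ∧
    ∀ e : Finset (Fin n), (e ∈ Δ.faces ∧ e.card = 2) ↔
      ∃ i : Fin (k + 3), e = {f i, f (i + 1)}

end SimComplex

/-! ### Commutative-algebra notions -/

noncomputable section

/-- The `i`-th Ext group of two modules over a commutative ring. -/
def ExtGroup (A : Type) [CommRing A] (i : ℕ) (M N : Type) [AddCommGroup M] [Module A M]
    [AddCommGroup N] [Module A N] : Type :=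
  ((Ext A (ModuleCat A) i).obj (op (ModuleCat.of A M))).obj (ModuleCat.of A N)

/-- A local ring is Cohen–Macaulay if its depth equals its Krull dimension, i.e. if
`Ext^i(residue field, B)` vanishes for all `i < dim B`. -/
def IsCohenMacaulayLocalRing (B : Type) [CommRing B] [IsLocalRing B] : Prop :=
  ∀ i : ℕ, (i : WithBot ℕ∞) < ringKrullDim B →
    Subsingleton (ExtGroup B i (B ⧸ IsLocalRing.maximalIdeal B) B)

/-- A commutative ring is Cohen–Macaulay if all its localizations at primes are
Cohen–Macaulay local rings. -/
def IsCohenMacaulayRing (A : Type) [CommRing A] : Prop :=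
  ∀ (P : Ideal A) (hP : P.IsPrime),
    letI : P.IsPrime := hP
    IsCohenMacaulayLocalRing (Localization.AtPrime P)

/-- An ideal `I` of `A` is Cohen–Macaulay if `A ⧸ I` is a Cohen–Macaulay ring. -/
def IsCohenMacaulayIdeal {A : Type} [CommRing A] (I : Ideal A) : Prop :=
  IsCohenMacaulayRing (A ⧸ I)

/-- The ideal `I` satisfies Serre's condition `(S₂)`: for every prime `P` of `A`, the
depth of the localized module `(A⧸I)_P` over `A_P` is at least `min {2, height P}`,
where the height of `P` is the Krull dimension of `A_P` and depth is detected by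
vanishing of `Ext^i` from the residue field. -/
def SatisfiesS2 {A : Type} [CommRing A] (I : Ideal A) : Prop :=
  ∀ (P : Ideal A) (hP : P.IsPrime),
    letI : P.IsPrime := hP
    ∀ i : ℕ, (i : WithBot ℕ∞) < min 2 (ringKrullDim (Localization.AtPrime P)) →
      Subsingleton (ExtGroup (Localization.AtPrime P) i
        (Localization.AtPrime P ⧸ IsLocalRing.maximalIdeal (Localization.AtPrime P))
        (LocalizedModule P.primeCompl (A ⧸ I)))

/-- The `m`-th symbolic power of an ideal: the intersection of the `m`-th powers of
its minimal primes. -/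
def symbPowIdeal {A : Type} [CommRing A] (I : Ideal A) (m : ℕ) : Ideal A :=
  ⨅ P ∈ I.minimalPrimes, P ^ m

end

/-! ### Stanley–Reisner theory -/

noncomputable section

open MvPolynomial

/-- The squarefree monomial attached to a finite set of variables. -/
def faceMonomial (K : Type) [Field K] {n : ℕ} (F : Finset (Fin n)) : MvPolynomial (Fin n) K :=
  ∏ i ∈ F, X i

/-- The Stanley–Reisner ideal of a complex on `[n]`: generated by the squarefree
monomials corresponding to nonfaces. -/
def SRIdeal (K : Type) [Field K] {n : ℕ} (Δ : SimComplex n) : Ideal (MvPolynomial (Fin n) K) :=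
  Ideal.span {p | ∃ F : Finset (Fin n), F ∉ Δ.faces ∧ p = faceMonomial K F}

/-- The Stanley–Reisner ideal of a complex whose vertex set may be a proper subset of
`[n]`: generated by the squarefree monomials of nonfaces contained in the vertex set. -/
def SRIdealOn (K : Type) [Field K] {n : ℕ} (Δ : SimComplex n) : Ideal (MvPolynomial (Fin n) K) :=
  Ideal.span {p | ∃ F : Finset (Fin n), ↑F ⊆ Δ.vertexSet ∧ F ∉ Δ.faces ∧ p = faceMonomial K F}

/-- The prime ideal generated by the variables indexed by `F`. -/
def PF (K : Type) [Field K] {n : ℕ} (F : Finset (Fin n)) : Ideal (MvPolynomial (Fin n) K) :=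
  Ideal.span ((fun i => (X i : MvPolynomial (Fin n) K)) '' ↑F)

/-- The `m`-th symbolic power of the Stanley–Reisner ideal:
`I_Δ^{(m)} = ⋂_{F facet} P_{complement of F}^m`. -/
def SRSymbPow (K : Type) [Field K] {n : ℕ} (Δ : SimComplex n) (m : ℕ) :
    Ideal (MvPolynomial (Fin n) K) :=
  ⨅ (F : Finset (Fin n)) (_ : Δ.IsFacet F), (PF K Fᶜ) ^ m

/-- The cover ideal `J(Δ) = ⋂_{F facet} P_F` and its symbolic powers. -/
def coverSymbPow (K : Type) [Field K] {n : ℕ} (Δ : SimComplex n) (m : ℕ) :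
    Ideal (MvPolynomial (Fin n) K) :=
  ⨅ (F : Finset (Fin n)) (_ : Δ.IsFacet F), (PF K F) ^ m

/-- The graded maximal ideal `(x_1, …, x_n)`. -/
def maxIdeal (K : Type) [Field K] (n : ℕ) : Ideal (MvPolynomial (Fin n) K) :=
  Ideal.span (Set.range X)

/-- The `i`-th local cohomology module of `S ⧸ I` with support in the maximal
graded ideal. -/
def locCoh (K : Type) [Field K] {n : ℕ} (i : ℕ) (I : Ideal (MvPolynomial (Fin n) K)) :
    ModuleCat (MvPolynomial (Fin n) K) :=
  (localCohomology (maxIdeal K n) i).obj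
    (ModuleCat.of (MvPolynomial (Fin n) K) (MvPolynomial (Fin n) K ⧸ I))

/-- `I` is quasi-Buchsbaum: the maximal ideal annihilates all local cohomology modules
`H^i_m(S⧸I)` for `i < dim S⧸I`. -/
def IsQuasiBuchsbaum (K : Type) [Field K] {n : ℕ} (I : Ideal (MvPolynomial (Fin n) K)) : Prop :=
  ∀ i : ℕ, (i : WithBot ℕ∞) < ringKrullDim (MvPolynomial (Fin n) K ⧸ I) →
    ∀ x ∈ maxIdeal K n, ∀ y : (locCoh K i I), x • y = 0

/-- `I` is Buchsbaum: for `i < dim S⧸I` the natural map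
`Ext^i_S(S⧸m, S⧸I) → H^i_m(S⧸I)` (the structure map into the direct limit defining local
cohomology) is surjective. -/
def IsBuchsbaum (K : Type) [Field K] {n : ℕ} (I : Ideal (MvPolynomial (Fin n) K)) : Prop :=
  ∀ i : ℕ, (i : WithBot ℕ∞) < ringKrullDim (MvPolynomial (Fin n) K ⧸ I) →
    letI := localCohomology.hasColimitDiagram
      (localCohomology.idealPowersDiagram (maxIdeal K n)) i
    Function.Surjective
      ((CategoryTheory.Limits.colimit.ι
          (localCohomology.diagram (localCohomology.idealPowersDiagram (maxIdeal K n)) i)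
          (Opposite.op (Opposite.op (1 : ℕ)))).app
        (ModuleCat.of (MvPolynomial (Fin n) K) (MvPolynomial (Fin n) K ⧸ I)))

/-- `I` is generalized Cohen–Macaulay: the local cohomology modules `H^i_m(S⧸I)` are
finite-dimensional over `K` for `i < dim S⧸I`. -/
def IsGeneralizedCM (K : Type) [Field K] {n : ℕ} (I : Ideal (MvPolynomial (Fin n) K)) : Prop :=
  ∀ i : ℕ, (i : WithBot ℕ∞) < ringKrullDim (MvPolynomial (Fin n) K ⧸ I) →
    Module.Finite K (RestrictScalars K (MvPolynomial (Fin n) K) (locCoh K i I))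

end

/-! ### Monomial ideals -/

/-- A monomial ideal of `K[x_1,…,x_n]`. -/
def IsMonomialIdeal {K : Type} [Field K] {n : ℕ} (I : Ideal (MvPolynomial (Fin n) K)) : Prop :=
  ∃ S : Set (Fin n →₀ ℕ),
    I = Ideal.span {p | ∃ d ∈ S, p = MvPolynomial.monomial d (1 : K)}

/-- A squarefree monomial ideal of `K[x_1,…,x_n]`. -/
def IsSquarefreeMonomialIdeal {K : Type} [Field K] {n : ℕ}
    (I : Ideal (MvPolynomial (Fin n) K)) : Prop :=
  ∃ S : Set (Finset (Fin n)),
    I = Ideal.span {p | ∃ F ∈ S, p = ∏ i ∈ F, (MvPolynomial.X i : MvPolynomial (Fin n) K)}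




noncomputable section ExtCompare
open CategoryTheory.Limits

variable {R : Type} [CommRing R]

/-- Hom functor (opposite valued). -/
abbrev XF (Y : ModuleCat.{0} R) : ModuleCat.{0} R ⥤ (ModuleCat.{0} R)ᵒᵖ :=
  ((linearYoneda R (ModuleCat.{0} R)).obj Y).rightOp

abbrev XC {X : ModuleCat.{0} R} (P : ProjectiveResolution X) (Y : ModuleCat.{0} R) :
    HomologicalComplex (ModuleCat.{0} R)ᵒᵖ (ComplexShape.down ℕ) :=
  ((XF Y).mapHomologicalComplex _).obj P.complex

/-- cocycles -/
def XZ {X : ModuleCat.{0} R} (P : ProjectiveResolution X) (Y : ModuleCat.{0} R) (n : ℕ) :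
    Submodule R (P.complex.X n ⟶ Y) where
  carrier := {f | P.complex.d (n+1) n ≫ f = 0}
  add_mem' := by
    intro a b ha hb
    simp only [Set.mem_ofPred_eq] at *
    simp [ha, hb]
  zero_mem' := by simp
  smul_mem' := by
    intro c a ha
    simp only [Set.mem_ofPred_eq] at *
    simp [ha]

def XE (n : ℕ) (X Y : ModuleCat.{0} R) : ModuleCat.{0} R :=
  ((Ext R (ModuleCat.{0} R) n).obj (op X)).obj Y

def xiso {X : ModuleCat.{0} R} (P : ProjectiveResolution X) (Y : ModuleCat.{0} R) (n : ℕ) :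
    ((XF Y).leftDerived n).obj X ≅ (XC P Y).homology n :=
  P.isoLeftDerivedObj (XF Y) n

def xtheta {X : ModuleCat.{0} R} (P : ProjectiveResolution X) (Y : ModuleCat.{0} R) (n : ℕ) :
    ((XF Y).leftDerived n).obj X ⟶ (XC P Y).opcycles n :=
  (xiso P Y n).hom ≫ (XC P Y).homologyι n

def xz {X : ModuleCat.{0} R} (P : ProjectiveResolution X) (Y : ModuleCat.{0} R) (n : ℕ) :
    (XC P Y).X n ⟶ op (ModuleCat.of R (XZ P Y n)) :=
  (ModuleCat.ofHom (XZ P Y n).subtype).op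

lemma d_xz {X : ModuleCat.{0} R} (P : ProjectiveResolution X) (Y : ModuleCat.{0} R) (n : ℕ) :
    (XC P Y).d (n+1) n ≫ xz P Y n = 0 := by
  apply Quiver.Hom.unop_inj
  ext ⟨f, hf⟩
  exact hf

def xcls {X : ModuleCat.{0} R} (P : ProjectiveResolution X) (Y : ModuleCat.{0} R) (n : ℕ) :
    ModuleCat.of R (XZ P Y n) ⟶ XE n X Y :=
  (xtheta P Y n ≫ (XC P Y).descOpcycles (xz P Y n) (n+1) (by simp) (d_xz P Y n)).unop

lemma xp_inj {X : ModuleCat.{0} R} (P : ProjectiveResolution X) (Y : ModuleCat.{0} R) (n : ℕ) :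
    Function.Injective ((XC P Y).pOpcycles n).unop := by
  rw [← ModuleCat.mono_iff_injective]
  infer_instance

lemma xcls_of {X : ModuleCat.{0} R} (P : ProjectiveResolution X) (Y : ModuleCat.{0} R) (n : ℕ)
    (f : XZ P Y n) (w : ((XC P Y).opcycles n).unop)
    (h : ((XC P Y).pOpcycles n).unop w = f.1) : xcls P Y n f = (xtheta P Y n).unop w := by
  have : ((XC P Y).descOpcycles (xz P Y n) (n+1) (by simp) (d_xz P Y n)).unop f = w := by
    apply xp_inj P Y n
    rw [h, ← ConcreteCategory.comp_apply, ← unop_comp, HomologicalComplex.p_descOpcycles]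
    rfl
  rw [← this]; rfl

lemma xcls_exists {X : ModuleCat.{0} R} (P : ProjectiveResolution X) (Y : ModuleCat.{0} R) (n : ℕ)
    (f : XZ P Y n) : ∃ w : ((XC P Y).opcycles n).unop, ((XC P Y).pOpcycles n).unop w = f.1 := by
  refine ⟨((XC P Y).descOpcycles (xz P Y n) (n+1) (by simp) (d_xz P Y n)).unop f, ?_⟩
  rw [← ConcreteCategory.comp_apply, ← unop_comp, HomologicalComplex.p_descOpcycles]
  rfl

lemma xw_mem {X : ModuleCat.{0} R} (P : ProjectiveResolution X) (Y : ModuleCat.{0} R) (n : ℕ)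
    (w : ((XC P Y).opcycles n).unop) : ((XC P Y).pOpcycles n).unop w ∈ XZ P Y n := by
  have : ((XC P Y).d (n+1) n ≫ (XC P Y).pOpcycles n).unop w = 0 := by
    rw [(XC P Y).d_pOpcycles]; rfl
  exact this

lemma xcls_surj {X : ModuleCat.{0} R} (P : ProjectiveResolution X) (Y : ModuleCat.{0} R) (n : ℕ) :
    Function.Surjective (xcls P Y n) := by
  intro e
  have h : Function.Surjective (xtheta P Y n).unop := by
    rw [← ModuleCat.epi_iff_surjective]
    have : Mono (xtheta P Y n) := by
      unfold xtheta
      exact mono_comp _ _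
    infer_instance
  obtain ⟨w, rfl⟩ := h e
  exact ⟨⟨_, xw_mem P Y n w⟩, xcls_of _ _ _ _ w rfl⟩

lemma xcls_zero {X : ModuleCat.{0} R} (P : ProjectiveResolution X) (Y : ModuleCat.{0} R) (n : ℕ)
    (f : XZ P Y n) : xcls P Y n f = 0 ↔
      ∃ g : P.complex.X ((ComplexShape.down ℕ).next n) ⟶ Y,
        P.complex.d n ((ComplexShape.down ℕ).next n) ≫ g = f.1 := by
  obtain ⟨w, hw⟩ := xcls_exists P Y n f
  rw [xcls_of P Y n f w hw]
  set j := (ComplexShape.down ℕ).next n with hj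
  have ex := ShortComplex.exact_of_f_is_kernel
    (ShortComplex.mk _ _ ((XC P Y).homologyι_comp_fromOpcycles n j))
      ((XC P Y).homologyIsKernel n j rfl)
  have ex' := ex.unop
  rw [ShortComplex.moduleCat_exact_iff] at ex'
  constructor
  · intro h
    have h2 : ((XC P Y).homologyι n).unop w = 0 := by
      have hi : Function.Injective ((xiso P Y n).hom).unop := by
        rw [← ModuleCat.mono_iff_injective]; infer_instance
      apply hi
      rw [map_zero]
      exact h
    obtain ⟨g, hg⟩ := ex' w h2
    refine ⟨g, ?_⟩
    rw [← hw, ← hg]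
    have := congrArg (fun t => t.unop g) ((XC P Y).p_fromOpcycles n j)
    exact this.symm
  · rintro ⟨g, hg⟩
    have : w = ((XC P Y).fromOpcycles n j).unop g := by
      apply xp_inj P Y n
      rw [hw, ← hg]
      have := congrArg (fun t => t.unop g) ((XC P Y).p_fromOpcycles n j)
      exact this.symm
    rw [this]
    have h0 : xtheta P Y n ≫ (XC P Y).fromOpcycles n j = 0 := by
      unfold xtheta
      rw [Category.assoc, (XC P Y).homologyι_comp_fromOpcycles, comp_zero]
    exact congrArg (fun t => t.unop g) h0

lemma xcls_mapY {X : ModuleCat.{0} R} (P : ProjectiveResolution X) {Y Y' : ModuleCat.{0} R}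
    (g : Y ⟶ Y') (n : ℕ)
    (f : XZ P Y n) (hf : f.1 ≫ g ∈ XZ P Y' n) :
    (((Ext R (ModuleCat.{0} R) n).obj (op X)).map g) (xcls P Y n f) = xcls P Y' n ⟨f.1 ≫ g, hf⟩ := by
  let α := ((linearYoneda R (ModuleCat.{0} R)).map g).rightOp
  let φ := (NatTrans.mapHomologicalComplex α (ComplexShape.down ℕ)).app P.complex
  obtain ⟨w, hw⟩ := xcls_exists P Y n f
  have key : (NatTrans.leftDerived α n).app X ≫ xtheta P Y n = xtheta P Y' n ≫
      HomologicalComplex.opcyclesMap φ n := by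
    unfold xtheta
    rw [Category.assoc, ← HomologicalComplex.homologyι_naturality, ProjectiveResolution.leftDerived_app_eq α P n]
    simp only [Category.assoc]
    erw [Iso.inv_hom_id_assoc]
    rfl
  rw [xcls_of P Y n f w hw, xcls_of P Y' n _ ((HomologicalComplex.opcyclesMap φ n).unop w)]
  · exact congrArg (fun t => t.unop w) key
  · have := congrArg (fun t => t.unop w) (HomologicalComplex.p_opcyclesMap φ n)
    refine this.trans ?_
    change (φ.f n).unop (((XC P Y).pOpcycles n).unop w) = _
    rw [hw]
    rfl

lemma xcls_mapX {X X' : ModuleCat.{0} R} (P : ProjectiveResolution X) (P' : ProjectiveResolution X')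
    (Y : ModuleCat.{0} R)
    (g : X' ⟶ X) (φ : ProjectiveResolution.Hom P' P g) (n : ℕ)
    (f : XZ P Y n) (hf : φ.hom.f n ≫ f.1 ∈ XZ P' Y n) :
    (((Ext R (ModuleCat.{0} R) n).map g.op).app Y) (xcls P Y n f) = xcls P' Y n ⟨φ.hom.f n ≫ f.1, hf⟩ := by
  let ψ := ((XF Y).mapHomologicalComplex (ComplexShape.down ℕ)).map φ.hom
  obtain ⟨w, hw⟩ := xcls_exists P Y n f
  have key : ((XF Y).leftDerived n).map g ≫ xtheta P Y n = xtheta P' Y n ≫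
      HomologicalComplex.opcyclesMap ψ n := by
    unfold xtheta
    rw [Category.assoc, ← HomologicalComplex.homologyι_naturality]
    have := ProjectiveResolution.isoLeftDerivedObj_hom_naturality g P' P φ.hom
      (by rw [φ.hom_f_zero_comp_π_f_zero, ChainComplex.single₀_map_f_zero]; rfl) (XF Y) n
    rw [← Category.assoc, ← Category.assoc]
    congr 1
  rw [xcls_of P Y n f w hw, xcls_of P' Y n _ ((HomologicalComplex.opcyclesMap ψ n).unop w)]
  · exact congrArg (fun t => t.unop w) key
  · have := congrArg (fun t => t.unop w) (HomologicalComplex.p_opcyclesMap ψ n)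
    refine this.trans ?_
    change (ψ.f n).unop (((XC P Y).pOpcycles n).unop w) = _
    rw [hw]
    rfl

lemma extMk_zero_deg {X : ModuleCat.{0} R} (P : ProjectiveResolution X) (Y : ModuleCat.{0} R)
    (f : P.complex.X 0 ⟶ Y) (hf : P.complex.d 1 0 ≫ f = 0) (h : P.extMk f 1 rfl hf = 0) : f = 0 := by
  simp only [← P.extEquivCohomologyClass.apply_eq_iff_eq,
    ProjectiveResolution.extEquivCohomologyClass_extMk, ProjectiveResolution.extEquivCohomologyClass_zero,
    CochainComplex.HomComplex.CohomologyClass.mk_eq_zero_iff] at h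
  rw [CochainComplex.HomComplex.Cocycle.toSingleMk_mem_coboundaries_iff _ _ _ _ _ 1 (by simp)] at h
  obtain ⟨g, hg⟩ := h
  have hz : IsZero (P.cochainComplex.X 1) :=
    CochainComplex.isZero_of_isStrictlyLE _ 0 _
  rw [hz.eq_of_src g 0, comp_zero] at hg
  rw [← cancel_epi (P.cochainComplexXIso (-(0:ℕ)) 0 rfl).hom, ← hg, comp_zero]

lemma extMk_zero_iff {X : ModuleCat.{0} R} (P : ProjectiveResolution X) (Y : ModuleCat.{0} R) (n : ℕ)
    (f : XZ P Y n) : P.extMk f.1 (n+1) rfl f.2 = 0 ↔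
      ∃ g : P.complex.X ((ComplexShape.down ℕ).next n) ⟶ Y,
        P.complex.d n ((ComplexShape.down ℕ).next n) ≫ g = f.1 := by
  cases n with
  | zero =>
    have h1 : P.complex.d 0 ((ComplexShape.down ℕ).next 0) = 0 := by
      apply P.complex.shape; simp
    rw [h1]
    simp only [zero_comp, exists_const]
    constructor
    · intro h
      exact (extMk_zero_deg P Y f.1 f.2 h).symm
    · intro h
      obtain ⟨f, hf⟩ := f
      simp only at h
      subst h
      exact P.extMk_zero _ _
  | succ p =>
    have : (ComplexShape.down ℕ).next (p+1) = p := by simp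
    rw [this]
    exact P.extMk_eq_zero_iff _ _ _ _ p rfl

lemma xcls_add {X : ModuleCat.{0} R} (P : ProjectiveResolution X) (Y : ModuleCat.{0} R) (n : ℕ)
    (f g : XZ P Y n) : P.extMk (f + g).1 (n+1) rfl (f+g).2 =
      P.extMk f.1 (n+1) rfl f.2 + P.extMk g.1 (n+1) rfl g.2 :=
  (P.add_extMk f.1 g.1 (n+1) rfl f.2 g.2).symm

/-- extMk as an additive map -/
def xmk {X : ModuleCat.{0} R} (P : ProjectiveResolution X) (Y : ModuleCat.{0} R) (n : ℕ) :
    XZ P Y n →+ Abelian.Ext X Y n where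
  toFun f := P.extMk f.1 (n+1) rfl f.2
  map_zero' := P.extMk_zero _ _
  map_add' := xcls_add P Y n

lemma xmk_surj {X : ModuleCat.{0} R} (P : ProjectiveResolution X) (Y : ModuleCat.{0} R) (n : ℕ) :
    Function.Surjective (xmk P Y n) := by
  intro a
  obtain ⟨f, hf, h⟩ := P.extMk_surjective a (n+1) rfl
  exact ⟨⟨f, hf⟩, h⟩

lemma xmk_smul {X : ModuleCat.{0} R} (P : ProjectiveResolution X) (Y : ModuleCat.{0} R) (n : ℕ)
    (r : R) (f : XZ P Y n) : xmk P Y n (r • f) = r • xmk P Y n f := by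
  rw [Abelian.Ext.smul_eq_comp_mk₀]
  refine Eq.trans ?_ (P.extMk_comp_mk₀ f.1 (n+1) rfl f.2 (r • 𝟙 Y)).symm
  have : f.1 ≫ (r • 𝟙 Y) = r • f.1 := by simp
  change P.extMk (r • f.1) (n+1) rfl (r • f).2 = _
  congr 1

lemma xmk_zero_iff {X : ModuleCat.{0} R} (P : ProjectiveResolution X) (Y : ModuleCat.{0} R) (n : ℕ)
    (f : XZ P Y n) : xmk P Y n f = 0 ↔ xcls P Y n f = 0 := by
  rw [xcls_zero]; exact extMk_zero_iff P Y n f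

/-- the comparison map -/
def xcmp {X : ModuleCat.{0} R} (P : ProjectiveResolution X) (Y : ModuleCat.{0} R) (n : ℕ) 
    (a : Abelian.Ext X Y n) : XE n X Y :=
  xcls P Y n (xmk_surj P Y n a).choose

lemma xcmp_mk {X : ModuleCat.{0} R} (P : ProjectiveResolution X) (Y : ModuleCat.{0} R) (n : ℕ) 
    (f : XZ P Y n) : xcmp P Y n (xmk P Y n f) = xcls P Y n f := by
  have h := (xmk_surj P Y n (xmk P Y n f)).choose_spec
  rw [← sub_eq_zero, ← map_sub, xmk_zero_iff, map_sub, sub_eq_zero] at h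
  exact h

def xlin {X : ModuleCat.{0} R} (P : ProjectiveResolution X) (Y : ModuleCat.{0} R) (n : ℕ) :
    Abelian.Ext X Y n →ₗ[R] XE n X Y where
  toFun := xcmp P Y n
  map_add' a b := by
    obtain ⟨f, rfl⟩ := xmk_surj P Y n a
    obtain ⟨g, rfl⟩ := xmk_surj P Y n b
    rw [← map_add, xcmp_mk, xcmp_mk, xcmp_mk, map_add]
  map_smul' r a := by
    obtain ⟨f, rfl⟩ := xmk_surj P Y n a
    rw [← xmk_smul, xcmp_mk, xcmp_mk, map_smul, RingHom.id_apply]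

/-- the comparison map, canonical. -/
def xtE (n : ℕ) (X Y : ModuleCat.{0} R) : Abelian.Ext X Y n →ₗ[R] XE n X Y :=
  xlin (projectiveResolution X) Y n

lemma xtE_inj (n : ℕ) (X Y : ModuleCat.{0} R) (a : Abelian.Ext X Y n) : xtE n X Y a = 0 ↔ a = 0 := by
  obtain ⟨f, rfl⟩ := xmk_surj (projectiveResolution X) Y n a
  rw [xmk_zero_iff, ← xcmp_mk]
  rfl

lemma xtE_surj (n : ℕ) (X Y : ModuleCat.{0} R) : Function.Surjective (xtE n X Y) := by
  intro e
  obtain ⟨f, rfl⟩ := xcls_surj (projectiveResolution X) Y n e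
  exact ⟨xmk _ _ _ f, xcmp_mk _ _ _ _⟩

lemma xtE_Y (n : ℕ) (X : ModuleCat.{0} R) {Y Y' : ModuleCat.{0} R} (g : Y ⟶ Y')
    (a : Abelian.Ext X Y n) :
    (((Ext R (ModuleCat.{0} R) n).obj (op X)).map g) (xtE n X Y a) =
      xtE n X Y' (a.comp (Abelian.Ext.mk₀ g) (add_zero _)) := by
  obtain ⟨f, rfl⟩ := xmk_surj (projectiveResolution X) Y n a
  have hf : f.1 ≫ g ∈ XZ (projectiveResolution X) Y' n := by
    have := f.2
    simp only [XZ, Submodule.mem_mk] at *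
    change _ ≫ _ = 0
    rw [← Category.assoc]
    erw [this]
    rw [zero_comp]
  have h1 : (xmk (projectiveResolution X) Y n f).comp (Abelian.Ext.mk₀ g) (add_zero _) =
    xmk (projectiveResolution X) Y' n ⟨f.1 ≫ g, hf⟩ :=
    (projectiveResolution X).extMk_comp_mk₀ f.1 (n+1) rfl f.2 g
  rw [h1]
  refine Eq.trans ?_ (xcmp_mk (projectiveResolution X) _ _ _).symm
  refine Eq.trans ?_ (xcls_mapY (projectiveResolution X) g n f hf)
  congr 1
  exact xcmp_mk (projectiveResolution X) _ _ _

lemma xtE_X (n : ℕ) {X X' : ModuleCat.{0} R} (Y : ModuleCat.{0} R) (g : X' ⟶ X)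
    (a : Abelian.Ext X Y n) :
    (((Ext R (ModuleCat.{0} R) n).map g.op).app Y) (xtE n X Y a) =
      xtE n X' Y ((Abelian.Ext.mk₀ g).comp a (zero_add _)) := by
  obtain ⟨f, rfl⟩ := xmk_surj (projectiveResolution X) Y n a
  let φ : ProjectiveResolution.Hom (projectiveResolution X') (projectiveResolution X) g :=
    { hom := ProjectiveResolution.lift g _ _
      hom_f_zero_comp_π_f_zero := by
        have := ProjectiveResolution.lift_commutes g (projectiveResolution X') (projectiveResolution X)
        exact congrArg (fun t => t.f 0) this }
  have hf : φ.hom.f n ≫ f.1 ∈ XZ (projectiveResolution X') Y n := by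
    have := f.2
    change _ ≫ _ = 0
    rw [← φ.hom.comm_assoc]
    erw [this]
    rw [comp_zero]
  have h1 : (Abelian.Ext.mk₀ g).comp (xmk (projectiveResolution X) Y n f) (zero_add _) =
    xmk (projectiveResolution X') Y n ⟨_, hf⟩ :=
    ProjectiveResolution.mk₀_comp_extMk f.1 (n+1) rfl f.2 φ
  rw [h1]
  refine Eq.trans ?_ (xcmp_mk (projectiveResolution X') _ _ _).symm
  refine Eq.trans ?_ (xcls_mapX (projectiveResolution X) (projectiveResolution X') Y g φ n f hf)
  congr 1
  exact xcmp_mk (projectiveResolution X) _ _ _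

end ExtCompare


noncomputable section LCLayer
open CategoryTheory.Limits

variable {R : Type} [CommRing R]

/-- local cohomology -/
def LH (J : Ideal R) (i : ℕ) (N : ModuleCat.{0} R) : ModuleCat.{0} R := (localCohomology J i).obj N

def lhMap (J : Ideal R) (i : ℕ) {N N' : ModuleCat.{0} R} (g : N ⟶ N') : LH J i N →ₗ[R] LH J i N' :=
  ((localCohomology J i).map g).hom

/-- `R/J^k`. -/
abbrev QP (J : Ideal R) (k : ℕ) : ModuleCat.{0} R := ModuleCat.of R (R ⧸ J ^ k)

/-- transition maps -/
def qtr (J : Ideal R) {k l : ℕ} (h : k ≤ l) : QP J l ⟶ QP J k :=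
  ModuleCat.ofHom (Submodule.mapQ _ _ LinearMap.id (Ideal.pow_le_pow_right h))

def lcocone (J : Ideal R) (i : ℕ) : Cocone (localCohomology.diagram (localCohomology.idealPowersDiagram J) i) :=
  have := localCohomology.hasColimitDiagram (localCohomology.idealPowersDiagram J) i
  colimit.cocone (localCohomology.diagram (localCohomology.idealPowersDiagram J) i)

def lcoconeIs (J : Ideal R) (i : ℕ) : IsColimit (lcocone J i) :=
  have := localCohomology.hasColimitDiagram (localCohomology.idealPowersDiagram J) i
  colimit.isColimit (localCohomology.diagram (localCohomology.idealPowersDiagram J) i)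

def lcE (J : Ideal R) (i : ℕ) (N : ModuleCat.{0} R) :=
  ((evaluation (ModuleCat.{0} R) (ModuleCat.{0} R)).obj N).mapCocone (lcocone J i)

def lcEIs (J : Ideal R) (i : ℕ) (N : ModuleCat.{0} R) : IsColimit (lcE J i N) :=
  isColimitOfPreserves ((evaluation (ModuleCat.{0} R) (ModuleCat.{0} R)).obj N) (lcoconeIs J i)

lemma lcE_pt (J : Ideal R) (i : ℕ) (N : ModuleCat.{0} R) : (lcE J i N).pt = LH J i N := rfl

def lio0 (J : Ideal R) (i : ℕ) (N : ModuleCat.{0} R) (k : ℕ) : XE i (QP J k) N ⟶ LH J i N :=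
  (lcE J i N).ι.app (op (op k))

/-- structure map -/
def lio (J : Ideal R) (i : ℕ) (N : ModuleCat.{0} R) (k : ℕ) :
    Abelian.Ext (QP J k) N i →ₗ[R] LH J i N :=
  (lio0 J i N k).hom ∘ₗ xtE i (QP J k) N

lemma lio_surj (J : Ideal R) (i : ℕ) (N : ModuleCat.{0} R) (y : LH J i N) :
    ∃ k a, lio J i N k a = y := by
  obtain ⟨j, x, hx⟩ := Concrete.isColimit_exists_rep _ (lcEIs J i N) y
  obtain ⟨a, ha⟩ := xtE_surj i (QP J j.unop.unop) N x
  refine ⟨j.unop.unop, a, ?_⟩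
  rw [← hx, ← ha]; rfl

lemma lio_zero (J : Ideal R) (i : ℕ) (N : ModuleCat.{0} R) (k : ℕ) (a : Abelian.Ext (QP J k) N i) :
    lio J i N k a = 0 ↔ ∃ (l : ℕ) (h : k ≤ l), (Abelian.Ext.mk₀ (qtr J h)).comp a (zero_add _) = 0 := by
  have : IsFiltered (ℕᵒᵖ)ᵒᵖ := inferInstance
  have h := Concrete.isColimit_rep_eq_iff_exists _ (lcEIs J i N) (i := op (op k)) (j := op (op k))
    (xtE i (QP J k) N a) (xtE i (QP J k) N 0)
  have h1 : lio J i N k a = 0 ↔ lio J i N k a = lio J i N k 0 := by rw [map_zero]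
  rw [h1]
  refine h.trans ⟨?_, ?_⟩
  · rintro ⟨l, f, g, hfg⟩
    refine ⟨l.unop.unop, f.unop.unop.down.down, ?_⟩
    rw [← xtE_inj, ← xtE_X]
    refine hfg.trans ?_
    rw [map_zero]
    exact map_zero _
  · rintro ⟨l, h, h0⟩
    let f : op (op k) ⟶ op (op l) := (homOfLE h).op.op
    refine ⟨op (op l), f, f, ?_⟩
    rw [← xtE_inj, ← xtE_X] at h0
    refine h0.trans ?_
    rw [map_zero]
    exact (map_zero _).symm

lemma lio_tr (J : Ideal R) (i : ℕ) (N : ModuleCat.{0} R) {k l : ℕ} (h : k ≤ l)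
    (a : Abelian.Ext (QP J k) N i) :
    lio J i N l ((Abelian.Ext.mk₀ (qtr J h)).comp a (zero_add _)) = lio J i N k a := by
  let f : op (op k) ⟶ op (op l) := (homOfLE h).op.op
  have h1 := congrArg (fun t => t (xtE i (QP J k) N a)) ((lcE J i N).w f)
  refine Eq.trans ?_ h1
  have := xtE_X i N (qtr J h) a
  change (lio0 J i N l) (xtE i (QP J l) N _) = _
  rw [← this]
  rfl

lemma lio_map (J : Ideal R) (i : ℕ) {N N' : ModuleCat.{0} R} (g : N ⟶ N') (k : ℕ)
    (a : Abelian.Ext (QP J k) N i) :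
    lhMap J i g (lio J i N k a) = lio J i N' k (a.comp (Abelian.Ext.mk₀ g) (add_zero _)) := by
  change _ = (lio0 J i N' k) (xtE i (QP J k) N' _)
  rw [← xtE_Y]
  have := ((lcocone J i).ι.app (op (op k))).naturality g
  have h1 := congrArg (fun t => t (xtE i (QP J k) N a)) this
  exact h1.symm

end LCLayer


noncomputable section LESLayer
open CategoryTheory.Limits

variable {R : Type} [CommRing R] (J : Ideal R)

lemma lhMap_id (i : ℕ) (N : ModuleCat.{0} R) (y : LH J i N) : lhMap J i (𝟙 N) y = y := by
  have := (localCohomology J i).map_id N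
  exact congrArg (fun t => t y) this

lemma lhMap_comp (i : ℕ) {N N' N'' : ModuleCat.{0} R} (g : N ⟶ N') (h : N' ⟶ N'') (y : LH J i N) :
    lhMap J i (g ≫ h) y = lhMap J i h (lhMap J i g y) := by
  have := (localCohomology J i).map_comp g h
  exact congrArg (fun t => t y) this

lemma lhMap_smul (i : ℕ) (N : ModuleCat.{0} R) (r : R) (y : LH J i N) :
    lhMap J i (r • 𝟙 N) y = r • y := by
  obtain ⟨k, a, rfl⟩ := lio_surj J i N y
  rw [lio_map, ← Abelian.Ext.smul_eq_comp_mk₀, map_smul]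

lemma lhMap_add (i : ℕ) {N N' : ModuleCat.{0} R} (g h : N ⟶ N') (y : LH J i N) :
    lhMap J i (g + h) y = lhMap J i g y + lhMap J i h y := by
  obtain ⟨k, a, rfl⟩ := lio_surj J i N y
  rw [lio_map, lio_map, lio_map, Abelian.Ext.mk₀_add, Abelian.Ext.comp_add, map_add]

lemma lhMap_zero (i : ℕ) {N N' : ModuleCat.{0} R} (y : LH J i N) :
    lhMap J i (0 : N ⟶ N') y = 0 := by
  obtain ⟨k, a, rfl⟩ := lio_surj J i N y
  rw [lio_map, Abelian.Ext.mk₀_zero, Abelian.Ext.comp_zero, map_zero]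

lemma lio_eq (i : ℕ) (N : ModuleCat.{0} R) (k k' : ℕ) (a : Abelian.Ext (QP J k) N i)
    (a' : Abelian.Ext (QP J k') N i) (h : lio J i N k a = lio J i N k' a') :
    ∃ (l : ℕ) (h1 : k ≤ l) (h2 : k' ≤ l), (Abelian.Ext.mk₀ (qtr J h1)).comp a (zero_add _) =
      (Abelian.Ext.mk₀ (qtr J h2)).comp a' (zero_add _) := by
  have qq : ∀ {k l l' : ℕ} (h : k ≤ l) (h' : l ≤ l'), qtr J h' ≫ qtr J h = qtr J (h.trans h') := by
    intro k l l' h h'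
    ext
    rfl
  rw [← lio_tr J i N (le_max_left k k') a, ← lio_tr J i N (le_max_right k k') a', ← sub_eq_zero,
    ← map_sub, lio_zero] at h
  obtain ⟨l, hl, h0⟩ := h
  refine ⟨l, (le_max_left k k').trans hl, (le_max_right k k').trans hl, ?_⟩
  rw [sub_eq_add_neg, Abelian.Ext.comp_add, Abelian.Ext.comp_neg, ← sub_eq_add_neg, sub_eq_zero, Abelian.Ext.mk₀_comp_mk₀_assoc, Abelian.Ext.mk₀_comp_mk₀_assoc, qq, qq] at h0
  exact h0

/-- every element is torsion -/
lemma lh_torsion (i : ℕ) (N : ModuleCat.{0} R) (y : LH J i N) : ∃ k, ∀ r ∈ J ^ k, r • y = 0 := by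
  obtain ⟨k, a, rfl⟩ := lio_surj J i N y
  refine ⟨k, fun r hr => ?_⟩
  rw [← map_smul]
  have : r • a = (Abelian.Ext.mk₀ (r • 𝟙 (QP J k))).comp a (zero_add _) := by
    rw [Abelian.Ext.mk₀_smul, Abelian.Ext.smul_comp, Abelian.Ext.mk₀_id_comp]
  have h0 : r • 𝟙 (QP J k) = 0 := by
    ext
    change r • (Ideal.Quotient.mk (J^k) 1) = 0
    rw [← Ideal.Quotient.mk_eq_mk, ← Submodule.Quotient.mk_smul, Submodule.Quotient.mk_eq_zero]
    simpa using hr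
  rw [this, h0, Abelian.Ext.mk₀_zero, Abelian.Ext.zero_comp, map_zero]

section SES
variable {J}
variable {S : ShortComplex (ModuleCat.{0} R)} (hS : S.ShortExact)
include hS

lemma lh_exact₂ (i : ℕ) (y : LH J i S.X₂) (hy : lhMap J i S.g y = 0) :
    ∃ x, lhMap J i S.f x = y := by
  obtain ⟨k, a, rfl⟩ := lio_surj J i _ y
  rw [lio_map, lio_zero] at hy
  obtain ⟨l, h, h0⟩ := hy
  rw [← Abelian.Ext.comp_assoc _ _ _ (zero_add _) _ (by simp)] at h0
  obtain ⟨b, hb⟩ := Abelian.Ext.covariant_sequence_exact₂ _ hS _ h0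
  refine ⟨lio J i _ l b, ?_⟩
  rw [lio_map, hb, lio_tr]

lemma lh_inj₀ (y : LH J 0 S.X₁) (hy : lhMap J 0 S.f y = 0) : y = 0 := by
  obtain ⟨k, a, rfl⟩ := lio_surj J 0 _ y
  rw [lio_map, lio_zero] at hy
  obtain ⟨l, h, h0⟩ := hy
  rw [← Abelian.Ext.comp_assoc _ _ _ (zero_add _) _ (by simp)] at h0
  have : Mono S.f := hS.mono_f
  rw [lio_zero]
  refine ⟨l, h, ?_⟩
  apply Abelian.Ext.postcomp_mk₀_injective_of_mono _ S.f
  rw [map_zero]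
  exact h0

lemma lh_delta_exists (i : ℕ) (y : LH J i S.X₃) : ∃ z : LH J (i+1) S.X₁, ∀ k (a : Abelian.Ext (QP J k) S.X₃ i),
    lio J i _ k a = y → lio J (i+1) _ k (a.comp hS.extClass rfl) = z := by
  obtain ⟨k, a, rfl⟩ := lio_surj J i _ y
  refine ⟨lio J (i+1) _ k (a.comp hS.extClass rfl), fun k' a' h => ?_⟩
  obtain ⟨l, h1, h2, h3⟩ := lio_eq J _ _ _ _ _ _ h
  rw [← lio_tr J _ _ h1, ← lio_tr J _ _ h2, ← Abelian.Ext.comp_assoc _ _ _ (zero_add _) _ (by simp), h3,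
    Abelian.Ext.comp_assoc _ _ _ (zero_add _) _ (by simp)]

def lhDelta (i : ℕ) : LH J i S.X₃ →ₗ[R] LH J (i+1) S.X₁ where
  toFun y := (lh_delta_exists hS i y).choose
  map_add' x y := by
    obtain ⟨k, a, hk⟩ := lio_surj J i _ x
    obtain ⟨k', a', hk'⟩ := lio_surj J i _ y
    rw [← lio_tr J i _ (le_max_left k k')] at hk
    rw [← lio_tr J i _ (le_max_right k k')] at hk'
    have h3 := (map_add (lio J i _ (max k k')) _ _).trans (congrArg₂ (· + ·) hk hk')
    rw [← (lh_delta_exists hS i x).choose_spec _ _ hk, ← (lh_delta_exists hS i y).choose_spec _ _ hk',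
      ← (lh_delta_exists hS i (x+y)).choose_spec _ _ h3, Abelian.Ext.add_comp, map_add]
  map_smul' r x := by
    obtain ⟨k, a, hk⟩ := lio_surj J i _ x
    have h3 := (map_smul (lio J i _ k) r a).trans (congrArg (r • ·) hk)
    rw [← (lh_delta_exists hS i x).choose_spec _ _ hk, 
      ← (lh_delta_exists hS i (r • x)).choose_spec _ _ h3, Abelian.Ext.smul_comp, map_smul]
    rfl

lemma lhDelta_lio (i k : ℕ) (a : Abelian.Ext (QP J k) S.X₃ i) :
    lhDelta hS i (lio J i _ k a) = lio J (i+1) _ k (a.comp hS.extClass rfl) :=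
  ((lh_delta_exists hS i _).choose_spec _ _ rfl).symm

lemma lh_exact₃ (i : ℕ) (y : LH J i S.X₃) (hy : lhDelta hS i y = 0) :
    ∃ x, lhMap J i S.g x = y := by
  obtain ⟨k, a, rfl⟩ := lio_surj J i _ y
  rw [lhDelta_lio, lio_zero] at hy
  obtain ⟨l, h, h0⟩ := hy
  rw [← Abelian.Ext.comp_assoc _ _ _ (zero_add _) _ (by simp)] at h0
  obtain ⟨b, hb⟩ := Abelian.Ext.covariant_sequence_exact₃ _ hS _ _ h0
  refine ⟨lio J i _ l b, ?_⟩
  rw [lio_map, hb, lio_tr]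

lemma lh_exact₁ (i : ℕ) (y : LH J (i+1) S.X₁) (hy : lhMap J (i+1) S.f y = 0) :
    ∃ x, lhDelta hS i x = y := by
  obtain ⟨k, a, rfl⟩ := lio_surj J (i+1) _ y
  rw [lio_map, lio_zero] at hy
  obtain ⟨l, h, h0⟩ := hy
  rw [← Abelian.Ext.comp_assoc _ _ _ (zero_add _) _ (by simp)] at h0
  obtain ⟨b, hb⟩ := Abelian.Ext.covariant_sequence_exact₁ _ hS _ h0 rfl
  refine ⟨lio J i _ l b, ?_⟩
  rw [lhDelta_lio, hb, lio_tr]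

end SES

/-- map `R/J^k → N` sending 1 to z. -/
def ltz (N : ModuleCat.{0} R) (k : ℕ) (z : N) (h : ∀ r ∈ J ^ k, r • z = 0) : QP J k ⟶ N :=
  ModuleCat.ofHom (Submodule.liftQ (J ^ k) (LinearMap.toSpanSingleton R N z) (by
    intro r hr; exact LinearMap.mem_ker.2 (h r hr)))

lemma ltz_mk (N : ModuleCat.{0} R) (k : ℕ) (z : N) (h : ∀ r ∈ J ^ k, r • z = 0) (r : R) :
    ltz J N k z h (Ideal.Quotient.mk _ r) = r • z := by
  rfl

lemma hom_ext_one {N : ModuleCat.{0} R} {k : ℕ} (g h : QP J k ⟶ N)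
    (H : g (Ideal.Quotient.mk _ 1) = h (Ideal.Quotient.mk _ 1)) : g = h := by
  ext
  exact H

lemma hom_one_kill {N : ModuleCat.{0} R} {k : ℕ} (g : QP J k ⟶ N) (r : R) (hr : r ∈ J ^ k) :
    r • g (Ideal.Quotient.mk _ 1) = 0 := by
  rw [← map_smul]
  have : r • (Ideal.Quotient.mk (J^k) 1) = 0 := by
    rw [← Ideal.Quotient.mk_eq_mk, ← Submodule.Quotient.mk_smul, Submodule.Quotient.mk_eq_zero]
    simpa using hr
  rw [this, map_zero]

lemma lh0_rep (N : ModuleCat.{0} R) (y : LH J 0 N) : ∃ (k : ℕ) (g : QP J k ⟶ N),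
    lio J 0 N k (Abelian.Ext.mk₀ g) = y := by
  obtain ⟨k, a, rfl⟩ := lio_surj J 0 _ y
  obtain ⟨g, rfl⟩ := (Abelian.Ext.mk₀_bijective _ _).2 a
  exact ⟨k, g, rfl⟩

lemma lh0_zero_of (N : ModuleCat.{0} R) (h : ∀ z : N, (∃ k, ∀ r ∈ J ^ k, r • z = 0) → z = 0)
    (y : LH J 0 N) : y = 0 := by
  obtain ⟨k, g, rfl⟩ := lh0_rep J N y
  have : g = 0 := by
    apply hom_ext_one
    rw [h _ ⟨k, hom_one_kill J g⟩]
    rfl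
  rw [this, Abelian.Ext.mk₀_zero, map_zero]

lemma lh0_elem (N : ModuleCat.{0} R) (z : N) (k : ℕ) (h : ∀ r ∈ J ^ k, r • z = 0) :
    ∃ y : LH J 0 N, ∀ f : R, f • y = 0 → f • z = 0 := by
  refine ⟨lio J 0 N k (Abelian.Ext.mk₀ (ltz J N k z h)), fun f hf => ?_⟩
  rw [← map_smul, ← Abelian.Ext.mk₀_smul, lio_zero] at hf
  obtain ⟨l, hl, h0⟩ := hf
  rw [Abelian.Ext.mk₀_comp_mk₀, Abelian.Ext.mk₀_eq_zero_iff] at h0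
  have := congrArg (fun t => t (Ideal.Quotient.mk _ 1)) h0
  have h2 : f • ((1:R) • z) = 0 := this
  rwa [one_smul] at h2

lemma lh0_surj (N : ModuleCat.{0} R) (c : ℕ) (h : ∀ z : N, ∀ r ∈ J ^ c, r • z = 0) :
    ∃ φ : N →ₗ[R] LH J 0 N, Function.Surjective φ := by
  let φ : N →ₗ[R] LH J 0 N :=
    { toFun := fun z => lio J 0 N c (Abelian.Ext.mk₀ (ltz J N c z (h z)))
      map_add' := by
        intro x y
        rw [← map_add, ← Abelian.Ext.mk₀_add]
        congr 2
        apply hom_ext_one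
        change (1:R) • (x + y) = (1:R) • x + (1:R) • y
        simp
      map_smul' := by
        intro r x
        rw [RingHom.id_apply, ← map_smul, ← Abelian.Ext.mk₀_smul]
        congr 2
        apply hom_ext_one
        change (1:R) • (r • x) = r • ((1:R) • x)
        simp }
  refine ⟨φ, fun y => ?_⟩
  obtain ⟨k, g, rfl⟩ := lh0_rep J N y
  refine ⟨g (Ideal.Quotient.mk _ 1), ?_⟩
  change lio J 0 N c (Abelian.Ext.mk₀ (ltz J N c _ _)) = _
  rw [← lio_tr J 0 N (le_max_left c k), ← lio_tr J 0 N (le_max_right c k), Abelian.Ext.mk₀_comp_mk₀,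
    Abelian.Ext.mk₀_comp_mk₀]
  congr 2
  apply hom_ext_one
  change (1:R) • g (Ideal.Quotient.mk _ 1) = _
  rw [one_smul]
  rfl

end LESLayer


noncomputable section T4Layer
open CategoryTheory.Limits

variable {R : Type} [CommRing R]

abbrev RQ (I : Ideal R) : ModuleCat.{0} R := ModuleCat.of R (R ⧸ I)

/-- multiplication by `y` as a map `R/I₁ → R/I`. -/
def qmul (y : R) (I₁ I : Ideal R) (h : ∀ f ∈ I₁, y * f ∈ I) : RQ I₁ ⟶ RQ I :=
  ModuleCat.ofHom (Submodule.mapQ I₁ I (LinearMap.mulLeft R y) (fun f hf => h f hf))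

lemma qmul_mk (y : R) (I₁ I : Ideal R) (h : ∀ f ∈ I₁, y * f ∈ I) (f : R) :
    qmul y I₁ I h (Ideal.Quotient.mk I₁ f) = Ideal.Quotient.mk I (y * f) := rfl

lemma rq_ext {I : Ideal R} {N : ModuleCat.{0} R} (g h : RQ I ⟶ N)
    (H : g (Ideal.Quotient.mk _ 1) = h (Ideal.Quotient.mk _ 1)) : g = h := by
  ext
  exact H

lemma qmul_comp (y y' : R) (I I' I'' : Ideal R) (h h') :
    qmul y I I' h ≫ qmul y' I' I'' h' = qmul (y' * y) I I'' (fun f hf => by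
      rw [mul_assoc]; exact h' _ (h f hf)) := by
  apply rq_ext
  change Ideal.Quotient.mk I'' (y' * (y * 1)) = Ideal.Quotient.mk I'' (y' * y * 1)
  rw [mul_assoc]

lemma qmul_congr (y y' : R) (I I' : Ideal R) (h h') (e : y = y') : qmul y I I' h = qmul y' I I' h' := by
  subst e; rfl

lemma qmul_smul' (y : R) (I I' : Ideal R) (h h') : qmul y I I' h = y • qmul 1 I I' h' := by
  apply rq_ext
  change Ideal.Quotient.mk I' (y * 1) = Ideal.Quotient.mk I' (y * (1 * 1))
  rw [one_mul]

lemma qtr_eq (J : Ideal R) {k l : ℕ} (h : k ≤ l) : qtr J h = qmul 1 (J^l) (J^k) (fun f hf => by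
    rw [one_mul]; exact Ideal.pow_le_pow_right h hf) := by
  apply rq_ext
  change Ideal.Quotient.mk (J^k) 1 = Ideal.Quotient.mk (J^k) (1 * 1)
  rw [one_mul]

lemma qmul_self (y : R) (I : Ideal R) (h) : qmul y I I h = y • 𝟙 (RQ I) := by
  apply rq_ext
  rfl

lemma qmul_one (I : Ideal R) (h) : qmul 1 I I h = 𝟙 (RQ I) := by
  rw [qmul_self, one_smul]

/-- the colon short complex -/
abbrev csc (y : R) (I₁ I I₂ : Ideal R) (h1 : ∀ f, f ∈ I₁ ↔ y * f ∈ I) (h2 : I₂ = I ⊔ Ideal.span {y}) :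
    ShortComplex (ModuleCat.{0} R) :=
  ShortComplex.mk (qmul y I₁ I (fun f hf => (h1 f).1 hf))
    (qmul 1 I I₂ (fun f hf => by rw [one_mul, h2]; exact Ideal.mem_sup_left hf)) (by
      rw [qmul_comp]
      apply rq_ext
      change Ideal.Quotient.mk I₂ _ = 0
      rw [Ideal.Quotient.eq_zero_iff_mem, h2]
      change 1 * y * 1 ∈ _
      rw [mul_one, one_mul]
      exact Ideal.mem_sup_right (Ideal.mem_span_singleton_self y))

lemma cses (y : R) (I₁ I I₂ : Ideal R) (h1 : ∀ f, f ∈ I₁ ↔ y * f ∈ I)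
    (h2 : I₂ = I ⊔ Ideal.span {y}) : (csc y I₁ I I₂ h1 h2).ShortExact := by
  refine ShortComplex.ShortExact.mk' ?_ ?_ ?_
  · rw [ShortComplex.moduleCat_exact_iff]
    intro x hx
    obtain ⟨f, rfl⟩ := Ideal.Quotient.mk_surjective (I := I) x
    replace hx : Ideal.Quotient.mk I₂ (1 * f) = 0 := hx
    rw [Ideal.Quotient.eq_zero_iff_mem, h2, one_mul, Submodule.mem_sup] at hx
    obtain ⟨a, ha, b, hb, rfl⟩ := hx
    obtain ⟨c, rfl⟩ := Ideal.mem_span_singleton'.1 hb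
    refine ⟨Ideal.Quotient.mk I₁ c, ?_⟩
    change Ideal.Quotient.mk I (y * c) = _
    rw [map_add, Ideal.Quotient.eq_zero_iff_mem.2 ha, zero_add, mul_comm]
  · rw [ModuleCat.mono_iff_injective]
    change Function.Injective (Submodule.mapQ I₁ I (LinearMap.mulLeft R y) (fun f hf => (h1 f).1 hf))
    rw [injective_iff_map_eq_zero]
    intro x hx
    obtain ⟨f, rfl⟩ := Ideal.Quotient.mk_surjective (I := I₁) x
    replace hx : Ideal.Quotient.mk I (y * f) = 0 := hx
    rw [Ideal.Quotient.eq_zero_iff_mem, ← h1] at hx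
    exact Ideal.Quotient.eq_zero_iff_mem.2 hx
  · rw [ModuleCat.epi_iff_surjective]
    intro x
    obtain ⟨f, rfl⟩ := Ideal.Quotient.mk_surjective (I := I₂) x
    refine ⟨Ideal.Quotient.mk I f, ?_⟩
    change Ideal.Quotient.mk I₂ (1 * f) = _
    rw [one_mul]

section Van
variable {ι : Type} [DecidableEq ι] (x : ι → R)

def SI (D : Finset ι) (k : ℕ) : Ideal R := Ideal.span ((fun v => x v ^ k) '' (D : Set ι))

omit [DecidableEq ι] in
lemma SI_mono (D : Finset ι) {k l : ℕ} (h : k ≤ l) : SI x D l ≤ SI x D k := by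
  unfold SI
  rw [Ideal.span_le]
  rintro _ ⟨v, hv, rfl⟩
  exact Ideal.mem_of_dvd _ (pow_dvd_pow _ h) (Ideal.subset_span ⟨v, hv, rfl⟩)

lemma SI_insert (D : Finset ι) (v : ι) (k : ℕ) : SI x (insert v D) k = SI x D k ⊔ Ideal.span {x v ^ k} := by
  unfold SI
  rw [← Ideal.span_union, Finset.coe_insert, Set.image_insert_eq, Set.union_singleton]

def siq (D : Finset ι) {k l : ℕ} (h : k ≤ l) : RQ (SI x D l) ⟶ RQ (SI x D k) :=
  qmul 1 _ _ (fun f hf => by rw [one_mul]; exact SI_mono x D h hf)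

variable (hreg : ∀ (D : Finset ι) (v : ι) (k : ℕ) (f : R), v ∉ D → x v ^ k * f ∈ SI x D k → f ∈ SI x D k)
variable (N : ModuleCat.{0} R) (c : ℕ) (hN : ∀ v, ∀ z : N, x v ^ c • z = 0)
include hreg hN

lemma si_van (D : Finset ι) : ∀ (j k : ℕ) (α : Abelian.Ext (RQ (SI x D k)) N (j+1)),
    ∃ (l : ℕ) (h : k ≤ l), (Abelian.Ext.mk₀ (siq x D h)).comp α (zero_add _) = 0 := by
  induction D using Finset.induction_on with
  | empty =>
    intro j k α
    refine ⟨k, le_rfl, ?_⟩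
    have : Projective (RQ (SI x ∅ k)) := by
      have e : SI x (∅ : Finset ι) k = ⊥ := by simp [SI]
      rw [e]
      have : Module.Free R (R ⧸ (⊥ : Ideal R)) := Module.Free.of_equiv (Submodule.quotEquivOfEqBot ⊥ rfl).symm
      exact (IsProjective.iff_projective (R := R) (R ⧸ (⊥ : Ideal R))).1 inferInstance
    exact Abelian.Ext.eq_zero_of_projective _
  | insert v D hv ih =>
    intro j k α
    have hs : ∀ k, (csc (x v ^ k) (SI x D k) (SI x D k) (SI x (insert v D) k)
        (fun f => ⟨fun h => Ideal.mul_mem_left _ _ h, hreg D v k f hv⟩) (SI_insert x D v k)).ShortExact :=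
      fun k => cses _ _ _ _ _ _
    obtain ⟨l, hl, h0⟩ := ih j k ((Abelian.Ext.mk₀ (csc (x v ^ k) (SI x D k) (SI x D k) (SI x (insert v D) k)
        (fun f => ⟨fun h => Ideal.mul_mem_left _ _ h, hreg D v k f hv⟩) (SI_insert x D v k)).g).comp α (zero_add _))
    have e1 : (Abelian.Ext.mk₀ (csc (x v ^ l) (SI x D l) (SI x D l) (SI x (insert v D) l)
        (fun f => ⟨fun h => Ideal.mul_mem_left _ _ h, hreg D v l f hv⟩) (SI_insert x D v l)).g).comp
        ((Abelian.Ext.mk₀ (siq x (insert v D) hl)).comp α (zero_add _)) (zero_add _) = 0 := by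
      rw [Abelian.Ext.mk₀_comp_mk₀_assoc] at h0 ⊢
      rw [← h0]
      congr 2
      exact (qmul_comp _ _ _ _ _ _ _).trans (qmul_comp _ _ _ _ _ _ _).symm
    obtain ⟨β, hβ⟩ := Abelian.Ext.contravariant_sequence_exact₃ (hs l) N _ e1 (add_comm 1 j)
    refine ⟨l + c, by omega, ?_⟩
    let τ : (csc (x v ^ (l+c)) (SI x D (l+c)) (SI x D (l+c)) (SI x (insert v D) (l+c))
        (fun f => ⟨fun h => Ideal.mul_mem_left _ _ h, hreg D v (l+c) f hv⟩) (SI_insert x D v (l+c))) ⟶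
        (csc (x v ^ l) (SI x D l) (SI x D l) (SI x (insert v D) l)
        (fun f => ⟨fun h => Ideal.mul_mem_left _ _ h, hreg D v l f hv⟩) (SI_insert x D v l)) :=
      { τ₁ := qmul (x v ^ c) _ _ (fun f hf => Ideal.mul_mem_left _ _ (SI_mono x D (by omega) hf))
        τ₂ := siq x D (by omega)
        τ₃ := siq x (insert v D) (by omega)
        comm₁₂ := by
          refine (qmul_comp _ _ _ _ _ _ _).trans (Eq.trans ?_ (qmul_comp _ _ _ _ _ _ _).symm)
          apply qmul_congr
          ring
        comm₂₃ := by
          exact (qmul_comp _ _ _ _ _ _ _).trans (qmul_comp _ _ _ _ _ _ _).symm }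
    have e2 := ShortComplex.ShortExact.extClass_naturality (hs (l+c)) (hs l) τ
    have e3 : siq x (insert v D) (show k ≤ l + c by omega) = siq x (insert v D) (show l ≤ l + c by omega) ≫
      siq x (insert v D) hl := by
      refine Eq.trans ?_ (qmul_comp _ _ _ _ _ _ _).symm
      apply qmul_congr
      rw [one_mul]
    have e4 : (Abelian.Ext.mk₀ τ.τ₁).comp β (zero_add _) = 0 := by
      have : τ.τ₁ = (x v ^ c) • siq x D (show l ≤ l + c by omega) := by
        exact qmul_smul' _ _ _ _ _
      rw [this, Abelian.Ext.mk₀_smul, Abelian.Ext.smul_comp, ← Abelian.Ext.comp_smul,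
        Abelian.Ext.smul_eq_comp_mk₀]
      have h0 : x v ^ c • 𝟙 N = 0 := by
        ext z
        exact hN v z
      rw [h0, Abelian.Ext.mk₀_zero, Abelian.Ext.comp_zero, Abelian.Ext.comp_zero]
    rw [e3, ← Abelian.Ext.mk₀_comp_mk₀_assoc, ← hβ]
    change (Abelian.Ext.mk₀ τ.τ₃).comp _ _ = 0
    rw [← Abelian.Ext.comp_assoc _ _ _ (zero_add 1) _ (by omega), ← e2,
      Abelian.Ext.comp_assoc _ _ _ (add_zero 1) (zero_add _) (by omega), e4, Abelian.Ext.comp_zero]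

lemma lh_van (J : Ideal R) (D : Finset ι) (h1 : ∀ v ∈ D, x v ∈ J) (h2 : ∀ k, ∃ l, J ^ l ≤ SI x D k)
    (j : ℕ) (y : LH J (j+1) N) : y = 0 := by
  obtain ⟨k, α, rfl⟩ := lio_surj J _ _ y
  have hk : ∀ k, SI x D k ≤ J ^ k := by
    intro k
    unfold SI
    rw [Ideal.span_le]
    rintro _ ⟨v, hv, rfl⟩
    exact Ideal.pow_mem_pow (h1 v hv) k
  let p : RQ (SI x D k) ⟶ QP J k := qmul 1 _ _ (fun f hf => by rw [one_mul]; exact hk k hf)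
  obtain ⟨l, hl, h0⟩ := si_van x hreg N c hN D j k ((Abelian.Ext.mk₀ p).comp α (zero_add _))
  obtain ⟨r, hr⟩ := h2 l
  rw [lio_zero]
  refine ⟨max r k, le_max_right _ _, ?_⟩
  let q : QP J (max r k) ⟶ RQ (SI x D l) := qmul 1 _ _ (fun f hf => by
    rw [one_mul]; exact hr (Ideal.pow_le_pow_right (le_max_left _ _) hf))
  have e : qtr J (le_max_right r k) = q ≫ siq x D hl ≫ p := by
    unfold p q siq
    rw [qmul_comp, qmul_comp, qtr_eq]
    apply qmul_congr
    ring
  rw [e, ← Abelian.Ext.mk₀_comp_mk₀_assoc, ← Abelian.Ext.mk₀_comp_mk₀_assoc, h0, Abelian.Ext.comp_zero]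

end Van
end T4Layer


noncomputable section MVLayer
open CategoryTheory.Limits

variable {R : Type} [CommRing R] {J : Ideal R}

lemma lh_eq_zero_colon (y : R) (I₁ I I₂ : Ideal R) (h1 : ∀ f, f ∈ I₁ ↔ y * f ∈ I)
    (h2 : I₂ = I ⊔ Ideal.span {y}) (i : ℕ) (H1 : ∀ z : LH J i (RQ I₁), z = 0)
    (H2 : ∀ z : LH J i (RQ I₂), z = 0) (z : LH J i (RQ I)) : z = 0 := by
  obtain ⟨x, rfl⟩ := lh_exact₂ (cses y I₁ I I₂ h1 h2) i z (H2 _)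
  rw [H1 x, map_zero]

lemma lhMap_ses_f_reg (y : R) (I I₂ : Ideal R) (h1 : ∀ f, f ∈ I ↔ y * f ∈ I)
    (h2 : I₂ = I ⊔ Ideal.span {y}) (i : ℕ) (z : LH J i (RQ I)) :
    lhMap J i (csc y I I I₂ h1 h2).f z = y • z := by
  have : (csc y I I I₂ h1 h2).f = y • 𝟙 (RQ I) := qmul_self y I _
  rw [this]
  exact lhMap_smul J i _ y z

lemma lh_eq_zero_reg (y : R) (hy : y ∈ J) (I I₂ : Ideal R) (h1 : ∀ f, f ∈ I ↔ y * f ∈ I)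
    (h2 : I₂ = I ⊔ Ideal.span {y}) (i : ℕ)
    (H2 : ∀ j, j + 1 = i → ∀ z : LH J j (RQ I₂), z = 0) (z : LH J i (RQ I)) : z = 0 := by
  have key : ∀ z : LH J i (RQ I), y • z = 0 → z = 0 := by
    intro z hz
    rw [← lhMap_ses_f_reg y I I₂ h1 h2] at hz
    cases i with
    | zero => exact lh_inj₀ (cses y I I I₂ h1 h2) z hz
    | succ j =>
      obtain ⟨x, rfl⟩ := lh_exact₁ (cses y I I I₂ h1 h2) j z hz
      rw [H2 j rfl x, map_zero]
  obtain ⟨k, hk⟩ := lh_torsion J i _ z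
  have hk' := hk (y ^ k) (Ideal.pow_mem_pow hy k)
  clear hk
  induction k with
  | zero => rwa [pow_zero, one_smul] at hk'
  | succ k ih =>
    apply ih
    apply key
    rw [smul_smul, ← pow_succ']
    exact hk'

lemma lh_kill_colon (y r : R) (I I' : Ideal R) (h : ∀ f ∈ I', y * f ∈ I) (hI : I ≤ I') (i : ℕ)
    (H : ∀ z : LH J i (RQ I), r • z = 0) (z : LH J i (RQ I')) : (r * y) • z = 0 := by
  have hI2 : ∀ f ∈ I, 1 * f ∈ I' := fun f hf => by rw [one_mul]; exact hI hf
  have e : qmul y I' I h ≫ qmul 1 I I' hI2 = y • 𝟙 (RQ I') := by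
    rw [qmul_comp, ← qmul_self y I' (fun f hf => Ideal.mul_mem_left _ _ hf)]
    exact qmul_congr _ _ _ _ _ _ (one_mul y)
  rw [mul_smul, ← lhMap_smul J i _ y z, ← e, lhMap_comp, ← map_smul, H, map_zero]

lemma lh_kill_reg (y r : R) (I I₂ : Ideal R) (h1 : ∀ f, f ∈ I ↔ y * f ∈ I)
    (h2 : I₂ = I ⊔ Ideal.span {y}) (i : ℕ)
    (H1 : ∀ z : LH J i (RQ I), r • z = 0) (H2 : ∀ z : LH J (i+1) (RQ I), r • z = 0) 
    (z : LH J i (RQ I₂)) : (r * r) • z = 0 := by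
  rw [mul_smul]
  obtain ⟨x, hx⟩ := lh_exact₃ (J := J) (cses y I I I₂ h1 h2) i (r • z) (by
    rw [map_smul]; exact H2 _)
  rw [← hx, ← map_smul]
  exact (congrArg _ (H1 x)).trans (map_zero _)

/-- constructor for short exact sequences -/
lemma mk_ses {A B C : Type} [AddCommGroup A] [AddCommGroup B] [AddCommGroup C] [Module R A] [Module R B]
    [Module R C] (f : A →ₗ[R] B) (g : B →ₗ[R] C) (w : g ∘ₗ f = 0) (hf : Function.Injective f)
    (hg : Function.Surjective g) (he : ∀ b, g b = 0 → ∃ a, f a = b) :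
    (ShortComplex.mk (ModuleCat.ofHom f) (ModuleCat.ofHom g) (by
      rw [← ModuleCat.ofHom_comp, w]; rfl)).ShortExact := by
  refine ShortComplex.ShortExact.mk' ?_ ?_ ?_
  · rw [ShortComplex.moduleCat_exact_iff]
    exact he
  · rw [ModuleCat.mono_iff_injective]
    exact hf
  · rw [ModuleCat.epi_iff_surjective]
    exact hg

variable (I I' : Ideal R)

/-- connecting module for Mayer–Vietoris -/
abbrev MVM : Submodule R (R ⧸ (I ⊓ I')) := LinearMap.ker (Submodule.factor (inf_le_left : I ⊓ I' ≤ I))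

lemma mv_ses1 : ∃ w, (ShortComplex.mk (ModuleCat.ofHom (MVM I I').subtype)
    (ModuleCat.ofHom (Submodule.factor (inf_le_left : I ⊓ I' ≤ I))) w).ShortExact := by
  refine ⟨_, mk_ses (MVM I I').subtype (Submodule.factor (inf_le_left : I ⊓ I' ≤ I)) ?_ 
    (Submodule.subtype_injective _) (Submodule.factor_surjective _) ?_⟩
  · ext x
    exact x.2
  · intro b hb
    exact ⟨⟨b, hb⟩, rfl⟩

lemma mv_ses2 : ∃ w, (ShortComplex.mk (ModuleCat.ofHom 
      ((Submodule.factor (inf_le_right : I ⊓ I' ≤ I')) ∘ₗ (MVM I I').subtype))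
    (ModuleCat.ofHom (Submodule.factor (le_sup_right : I' ≤ I ⊔ I'))) w).ShortExact := by
  refine ⟨_, mk_ses ((Submodule.factor (inf_le_right : I ⊓ I' ≤ I')) ∘ₗ (MVM I I').subtype)
    (Submodule.factor (le_sup_right : I' ≤ I ⊔ I')) ?_ 
    ?_ (Submodule.factor_surjective _) ?_⟩
  · ext x
    obtain ⟨x, hx⟩ := x
    obtain ⟨f, rfl⟩ := Submodule.mkQ_surjective _ x
    rw [LinearMap.mem_ker] at hx
    replace hx : Submodule.Quotient.mk (p := I) f = 0 := hx
    rw [Submodule.Quotient.mk_eq_zero] at hx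
    change Submodule.Quotient.mk (p := I ⊔ I') f = 0
    rw [Submodule.Quotient.mk_eq_zero]
    exact Ideal.mem_sup_left hx
  · rw [injective_iff_map_eq_zero]
    rintro ⟨x, hx⟩ h0
    obtain ⟨f, rfl⟩ := Submodule.mkQ_surjective _ x
    rw [LinearMap.mem_ker] at hx
    replace hx : Submodule.Quotient.mk (p := I) f = 0 := hx
    replace h0 : Submodule.Quotient.mk (p := I') f = 0 := h0
    rw [Submodule.Quotient.mk_eq_zero] at hx h0
    ext
    change Submodule.Quotient.mk (p := I ⊓ I') f = 0
    rw [Submodule.Quotient.mk_eq_zero]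
    exact ⟨hx, h0⟩
  · intro b hb
    obtain ⟨f, rfl⟩ := Submodule.mkQ_surjective _ b
    replace hb : Submodule.Quotient.mk (p := I ⊔ I') f = 0 := hb
    rw [Submodule.Quotient.mk_eq_zero, Submodule.mem_sup] at hb
    obtain ⟨a, ha, b, hb, rfl⟩ := hb
    refine ⟨⟨Submodule.Quotient.mk a, ?_⟩, ?_⟩
    · rw [LinearMap.mem_ker]
      change Submodule.Quotient.mk (p := I) a = 0
      rwa [Submodule.Quotient.mk_eq_zero]
    · change Submodule.Quotient.mk (p := I') a = Submodule.Quotient.mk (p := I') (a + b)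
      rw [Submodule.Quotient.eq]
      simpa using hb

lemma mv_kill (r : R) (H1 : ∀ z : LH J 0 (RQ I), z = 0) (H2 : ∀ z : LH J 0 (RQ I'), z = 0)
    (H : ∀ z : LH J 1 (RQ (I ⊓ I')), r • z = 0) (z : LH J 0 (RQ (I ⊔ I'))) : r • z = 0 := by
  obtain ⟨w1, h1⟩ := mv_ses1 I I'
  obtain ⟨w2, h2⟩ := mv_ses2 I I'
  have e1 : r • lhDelta h2 0 z = 0 := by
    obtain ⟨u, hu⟩ := lh_exact₁ (J := J) h1 0 (r • lhDelta h2 0 z) (by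
      rw [map_smul]; exact H _)
    rw [← hu]
    exact (congrArg _ (H1 u)).trans (map_zero _)
  rw [← map_smul] at e1
  obtain ⟨v, hv⟩ := lh_exact₃ h2 0 _ e1
  refine hv.symm.trans ?_
  exact (congrArg _ (H2 v)).trans (map_zero _)

section FD
variable (K : Type) [Field K] [Algebra K R]

def FDK (M : Type) [AddCommGroup M] [Module R M] : Prop := Module.Finite K (RestrictScalars K R M)

lemma fin_exact {K A B C : Type} [Field K] [AddCommGroup A] [AddCommGroup B] [AddCommGroup C] [Module K A] [Module K B]
    [Module K C] (f' : A →ₗ[K] B) (g' : B →ₗ[K] C) (he : ∀ b, g' b = 0 → ∃ a, f' a = b)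
    [Module.Finite K A] [Module.Finite K C] : Module.Finite K B := by
  have h1 : Module.Finite K (LinearMap.range g') := inferInstance
  have h2 : Module.Finite K (LinearMap.ker g') := by
    have : LinearMap.ker g' ≤ LinearMap.range f' := fun b hb => he b hb
    exact Module.Finite.of_injective _ (Submodule.inclusion_injective this)
  have h3 : Module.Finite K (B ⧸ LinearMap.ker g') :=
    Module.Finite.equiv (LinearMap.quotKerEquivRange g').symm
  exact Module.Finite.of_submodule_quotient (LinearMap.ker g')

variable {K}

def resK {A B : Type} [AddCommGroup A] [AddCommGroup B] [Module R A] [Module R B] (f : A →ₗ[R] B) :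
    RestrictScalars K R A →ₗ[K] RestrictScalars K R B where
  toFun := f
  map_add' := f.map_add
  map_smul' a x := f.map_smul (algebraMap K R a) x

lemma FDK_exact {A B C : Type} [AddCommGroup A] [AddCommGroup B] [AddCommGroup C] [Module R A] [Module R B]
    [Module R C] (f : A →ₗ[R] B) (g : B →ₗ[R] C) (he : ∀ b, g b = 0 → ∃ a, f a = b)
    (hA : FDK (R := R) K A) (hC : FDK (R := R) K C) : FDK (R := R) K B := by
  letI mA : Module K A := Module.compHom A (algebraMap K R)
  letI mB : Module K B := Module.compHom B (algebraMap K R)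
  letI mC : Module K C := Module.compHom C (algebraMap K R)
  have hA' : Module.Finite K A := hA
  have hC' : Module.Finite K C := hC
  exact fin_exact (K := K) (A := A) (B := B) (C := C)
    { toFun := f, map_add' := f.map_add, map_smul' := fun a x => f.map_smul (algebraMap K R a) x }
    { toFun := g, map_add' := g.map_add, map_smul' := fun a x => g.map_smul (algebraMap K R a) x } he

lemma FDK_zero {A : Type} [AddCommGroup A] [Module R A] (h : ∀ a : A, a = 0) : FDK (R := R) K A := by
  have : Subsingleton (RestrictScalars K R A) := ⟨fun a b => (h a).trans (h b).symm⟩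
  unfold FDK
  infer_instance

lemma FDK_surj {A B : Type} [AddCommGroup A] [AddCommGroup B] [Module R A] [Module R B]
    (f : A →ₗ[R] B) (hf : Function.Surjective f)
    (hA : FDK (R := R) K A) : FDK (R := R) K B :=
  FDK_exact f (0 : B →ₗ[R] B) (fun b _ => hf b) hA (by
    let f' := resK (K := K) f
    unfold FDK at *
    exact Module.Finite.of_surjective f' hf)

lemma mv_fd (i : ℕ) (H1 : FDK (R := R) K (LH J i (RQ I))) (H2 : FDK (R := R) K (LH J i (RQ I')))
    (H3 : ∀ j, j + 1 = i → FDK (R := R) K (LH J j (RQ (I ⊔ I')))) : FDK (R := R) K (LH J i (RQ (I ⊓ I'))) := by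
  obtain ⟨w1, h1⟩ := mv_ses1 I I'
  obtain ⟨w2, h2⟩ := mv_ses2 I I'
  refine FDK_exact _ _ (lh_exact₂ (J := J) h1 i) ?_ H1
  cases i with
  | zero =>
    exact FDK_exact (A := LH J 0 (RQ I)) 0 (lhMap J 0 (ModuleCat.ofHom
      ((Submodule.factor (inf_le_right : I ⊓ I' ≤ I')) ∘ₗ (MVM I I').subtype)))
      (fun b hb => ⟨0, (lh_inj₀ h2 b hb).symm⟩) H1 H2
  | succ j =>
    exact FDK_exact _ _ (lh_exact₁ (J := J) h2 j) (H3 j rfl) H2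

lemma FDK_kill (i : ℕ) (N : ModuleCat.{0} R) (h : FDK (R := R) K (LH J i N)) :
    ∃ t, ∀ r ∈ J ^ t, ∀ z : LH J i N, r • z = 0 := by
  obtain ⟨s, hs⟩ := h.fg_top
  choose k hk using lh_torsion J i N
  refine ⟨s.sup k, fun r hr z => ?_⟩
  have hz : (RestrictScalars.addEquiv K R (LH J i N)).symm z ∈ Submodule.span K (s : Set (RestrictScalars K R (LH J i N))) := by
    rw [hs]; trivial
  refine Submodule.span_induction (p := fun x _ => r • (RestrictScalars.addEquiv K R (LH J i N)) x = 0) ?_ ?_ ?_ ?_ hz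
  · intro x hx
    exact hk x r (Ideal.pow_le_pow_right (Finset.le_sup (f := k) hx) hr)
  · rw [map_zero]; exact smul_zero r
  · intro x y _ _ hx hy
    rw [map_add, smul_add, hx, hy, add_zero]
  · intro a x _ hx
    rw [RestrictScalars.addEquiv_map_smul, smul_comm, hx, smul_zero]
end FD
end MVLayer


noncomputable section MonLayer
open MvPolynomial

variable {K : Type} [Field K] {n : ℕ}

def MI (K : Type) [Field K] {n : ℕ} (U : Set (Fin n →₀ ℕ)) : Ideal (MvPolynomial (Fin n) K) :=
  Ideal.span ((fun s => monomial s (1 : K)) '' U)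

lemma mem_MI {U : Set (Fin n →₀ ℕ)} (hU : IsUpperSet U) (p : MvPolynomial (Fin n) K) :
    p ∈ MI K U ↔ ∀ s, coeff s p ≠ 0 → s ∈ U := by
  unfold MI
  rw [mem_ideal_span_monomial_image]
  constructor
  · intro h s hs
    obtain ⟨t, ht, hts⟩ := h s (mem_support_iff.2 hs)
    exact hU hts ht
  · intro h s hs
    exact ⟨s, h s (mem_support_iff.1 hs), le_rfl⟩

lemma mon_mem_MI {U : Set (Fin n →₀ ℕ)} (hU : IsUpperSet U) (a : Fin n →₀ ℕ) :
    monomial a (1:K) ∈ MI K U ↔ a ∈ U := by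
  rw [mem_MI hU]
  constructor
  · intro h
    apply h
    simp
  · intro h s hs
    rw [coeff_monomial] at hs
    split_ifs at hs with e
    · exact e ▸ h
    · exact absurd rfl hs

lemma MI_mono {U V : Set (Fin n →₀ ℕ)} (h : U ⊆ V) : MI K U ≤ MI K V :=
  Ideal.span_mono (Set.image_mono h)

lemma MI_inf {U V : Set (Fin n →₀ ℕ)} (hU : IsUpperSet U) (hV : IsUpperSet V) :
    MI K (U ∩ V) = MI K U ⊓ MI K V := by
  ext p
  rw [Ideal.mem_inf, mem_MI hU, mem_MI hV, mem_MI (hU.inter hV)]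
  constructor
  · intro h
    exact ⟨fun s hs => (h s hs).1, fun s hs => (h s hs).2⟩
  · intro h s hs
    exact ⟨h.1 s hs, h.2 s hs⟩

lemma MI_sup (U V : Set (Fin n →₀ ℕ)) : MI K (U ∪ V) = MI K U ⊔ MI K V := by
  unfold MI
  rw [Set.image_union, Ideal.span_union]

lemma upper_colon {U : Set (Fin n →₀ ℕ)} (hU : IsUpperSet U) (a : Fin n →₀ ℕ) :
    IsUpperSet {b | a + b ∈ U} := by
  intro b c hbc hb
  exact hU (add_le_add_right hbc a) hb

lemma MI_colon {U : Set (Fin n →₀ ℕ)} (hU : IsUpperSet U) (a : Fin n →₀ ℕ) (f : MvPolynomial (Fin n) K) :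
    f ∈ MI K {b | a + b ∈ U} ↔ monomial a 1 * f ∈ MI K U := by
  rw [mem_MI hU, mem_MI (upper_colon hU a)]
  constructor
  · intro h s hs
    rw [coeff_monomial_mul'] at hs
    split_ifs at hs with e
    · have := h (s - a) (by simpa using hs)
      simpa [add_tsub_cancel_of_le e] using this
    · exact absurd rfl hs
  · intro h s hs
    apply h
    rw [coeff_monomial_mul]
    simpa using hs

lemma MI_add (U : Set (Fin n →₀ ℕ)) (a : Fin n →₀ ℕ) (V : Set (Fin n →₀ ℕ))
    (h : ∀ b, b ∈ V ↔ b ∈ U ∨ a ≤ b) :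
    MI K V = MI K U ⊔ Ideal.span {monomial a (1:K)} := by
  apply le_antisymm
  · unfold MI
    rw [Ideal.span_le]
    rintro _ ⟨b, hb, rfl⟩
    rcases (h b).1 hb with h1 | h1
    · exact Ideal.mem_sup_left (Ideal.subset_span ⟨b, h1, rfl⟩)
    · apply Ideal.mem_sup_right
      rw [Ideal.mem_span_singleton]
      refine ⟨monomial (b - a) 1, ?_⟩
      rw [monomial_mul, mul_one, add_tsub_cancel_of_le h1]
  · refine sup_le (MI_mono fun b hb => (h b).2 (Or.inl hb)) ?_
    rw [Ideal.span_le, Set.singleton_subset_iff]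
    exact Ideal.subset_span ⟨a, (h a).2 (Or.inr le_rfl), rfl⟩

lemma MI_mul_le (U V W : Set (Fin n →₀ ℕ)) (h : ∀ a ∈ U, ∀ b ∈ V, a + b ∈ W) :
    MI K U * MI K V ≤ MI K W := by
  unfold MI
  rw [Ideal.span_mul_span, Ideal.span_le]
  intro p hp
  rw [Set.mem_mul] at hp
  obtain ⟨_, ⟨a, ha, rfl⟩, _, ⟨b, hb, rfl⟩, rfl⟩ := hp
  refine Ideal.subset_span ⟨a + b, h a ha b hb, ?_⟩
  simp [monomial_mul]

lemma upper_sum (F : Finset (Fin n)) (m : ℕ) : IsUpperSet {b : Fin n →₀ ℕ | m ≤ ∑ i ∈ F, b i} := by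
  intro b c hbc hb
  exact le_trans hb (Finset.sum_le_sum fun i _ => hbc i)

lemma PF_pow (F : Finset (Fin n)) (m : ℕ) : PF K F ^ m = MI K {b | m ≤ ∑ i ∈ F, b i} := by
  apply le_antisymm
  · induction m with
    | zero =>
      rw [pow_zero]
      intro p _
      rw [mem_MI (upper_sum F 0)]
      intro s _
      exact Nat.zero_le _
    | succ m ih =>
      rw [pow_succ]
      have h1 : PF K F ≤ MI K {b | 1 ≤ ∑ i ∈ F, b i} := by
        unfold PF
        rw [Ideal.span_le]
        rintro _ ⟨i, hi, rfl⟩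
        refine Ideal.subset_span ⟨Finsupp.single i 1, ?_, rfl⟩
        change 1 ≤ ∑ j ∈ F, (Finsupp.single i 1 : Fin n →₀ ℕ) j
        refine le_trans ?_ (Finset.single_le_sum (f := fun j => (Finsupp.single i 1 : Fin n →₀ ℕ) j) (fun _ _ => Nat.zero_le _) hi)
        simp
      refine (Ideal.mul_mono ih h1).trans (MI_mul_le _ _ _ ?_)
      intro a ha b hb
      change m + 1 ≤ ∑ i ∈ F, (a + b) i
      simp only [Finsupp.add_apply, Finset.sum_add_distrib]
      exact add_le_add ha hb
  · unfold MI
    rw [Ideal.span_le]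
    rintro _ ⟨b, hb, rfl⟩
    have key : ∀ F' ⊆ F, (∏ i ∈ F', (X i : MvPolynomial (Fin n) K) ^ (b i)) ∈ PF K F ^ (∑ i ∈ F', b i) := by
      intro F' 
      induction F' using Finset.induction_on with
      | empty => simp
      | insert v F' hv ih =>
        intro hF
        rw [Finset.prod_insert hv, Finset.sum_insert hv, pow_add]
        have hX : (X v : MvPolynomial (Fin n) K) ∈ PF K F := Ideal.subset_span ⟨v, hF (Finset.mem_insert_self _ _), rfl⟩
        refine Ideal.mul_mem_mul (Ideal.pow_mem_pow hX _)
          (ih (fun x hx => hF (Finset.mem_insert_of_mem hx)))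
    have h2 := Ideal.pow_le_pow_right (I := PF K F) hb (key F subset_rfl)
    have h3 : (monomial b (1:K)) = (∏ i ∈ F, (X i : MvPolynomial (Fin n) K) ^ (b i)) * ∏ i ∈ Fᶜ, X i ^ (b i) := by
      rw [Finset.prod_mul_prod_compl, monomial_eq, Finsupp.prod_fintype]
      · simp
      · simp
    change monomial b (1:K) ∈ _
    rw [h3]
    exact Ideal.mul_mem_right _ _ h2

lemma max_pow (k : ℕ) : maxIdeal K n ^ k = MI K {b | k ≤ ∑ i, b i} := by
  rw [← PF_pow]
  congr 1
  unfold maxIdeal PF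
  simp

def SU (Δ : SimComplex n) (m : ℕ) : Set (Fin n →₀ ℕ) := {b | ∀ F, Δ.IsFacet F → m ≤ ∑ i ∈ Fᶜ, b i}

lemma upper_SU (Δ : SimComplex n) (m : ℕ) : IsUpperSet (SU Δ m) := by
  intro b c hbc hb F hF
  exact upper_sum _ _ hbc (hb F hF)

lemma SR_eq (Δ : SimComplex n) (m : ℕ) : SRSymbPow K Δ m = MI K (SU Δ m) := by
  ext p
  unfold SRSymbPow
  simp only [Submodule.mem_iInf, PF_pow]
  rw [mem_MI (upper_SU Δ m)]
  constructor
  · intro h s hs F hF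
    have := h F hF
    rw [mem_MI (upper_sum _ _)] at this
    exact this s hs
  · intro h F hF
    rw [mem_MI (upper_sum _ _)]
    intro s hs
    exact h s hs F hF

/-- abbreviation for cohomology of monomial quotients -/
abbrev MH (K : Type) [Field K] {n : ℕ} (i : ℕ) (U : Set (Fin n →₀ ℕ)) :=
  LH (maxIdeal K n) i (RQ (MI K U))

lemma mh0_zero {U : Set (Fin n →₀ ℕ)} (hU : IsUpperSet U)
    (h : ∀ b, b ∉ U → ∀ k, ∃ c : Fin n →₀ ℕ, k ≤ ∑ i, c i ∧ c + b ∉ U) (z : MH K 0 U) : z = 0 := by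
  apply lh0_zero_of
  rintro z ⟨k, hk⟩
  obtain ⟨f, rfl⟩ := Ideal.Quotient.mk_surjective (I := MI K U) z
  rw [Ideal.Quotient.eq_zero_iff_mem, mem_MI hU]
  intro s hs
  by_contra hsU
  obtain ⟨c, hc, hcs⟩ := h s hsU k
  have h1 : monomial c (1:K) ∈ maxIdeal K n ^ k := by
    rw [max_pow, mon_mem_MI (upper_sum _ _)]
    exact hc
  have h2 := hk _ h1
  rw [← Ideal.Quotient.mk_eq_mk, ← Submodule.Quotient.mk_smul, Submodule.Quotient.mk_eq_zero,
    smul_eq_mul, mem_MI hU] at h2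
  apply hcs
  apply h2
  rw [coeff_monomial_mul]
  simpa using hs

lemma mh0_mem {U : Set (Fin n →₀ ℕ)} (hU : IsUpperSet U) (a s : Fin n →₀ ℕ) (k : ℕ)
    (h : ∀ c : Fin n →₀ ℕ, k ≤ ∑ i, c i → c + a ∈ U)
    (hs : ∀ z : MH K 0 U, (monomial s (1:K)) • z = 0) : s + a ∈ U := by
  obtain ⟨y, hy⟩ := lh0_elem (maxIdeal K n) (RQ (MI K U)) (Ideal.Quotient.mk (MI K U) (monomial a (1:K))) k (by
    intro r hr
    rw [max_pow, mem_MI (upper_sum _ _)] at hr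
    rw [← Ideal.Quotient.mk_eq_mk, ← Submodule.Quotient.mk_smul, Submodule.Quotient.mk_eq_zero,
      smul_eq_mul, mem_MI hU]
    intro t ht
    rw [coeff_mul_monomial'] at ht
    split_ifs at ht with e
    · have := h _ (hr (t - a) (by simpa using ht))
      rwa [tsub_add_cancel_of_le e] at this
    · exact absurd rfl ht)
  have := hy _ (hs y)
  rw [← Ideal.Quotient.mk_eq_mk, ← Submodule.Quotient.mk_smul, Submodule.Quotient.mk_eq_zero,
      smul_eq_mul, monomial_mul, mul_one, mon_mem_MI hU] at this
  exact this

lemma SI_eq (D : Finset (Fin n)) (k : ℕ) :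
    SI (fun v => (X v : MvPolynomial (Fin n) K)) D k = MI K {b | ∃ v ∈ D, k ≤ b v} := by
  apply le_antisymm
  · unfold SI
    rw [Ideal.span_le]
    rintro _ ⟨v, hv, rfl⟩
    refine Ideal.subset_span ⟨Finsupp.single v k, ⟨v, hv, by simp⟩, ?_⟩
    simp [X_pow_eq_monomial]
  · unfold MI
    rw [Ideal.span_le]
    rintro _ ⟨b, ⟨v, hv, hb⟩, rfl⟩
    refine Ideal.mem_of_dvd _ ?_ (Ideal.subset_span ⟨v, hv, rfl⟩)
    change (X v : MvPolynomial (Fin n) K) ^ k ∣ monomial b 1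
    rw [X_pow_eq_monomial]
    refine ⟨monomial (b - Finsupp.single v k) 1, ?_⟩
    rw [monomial_mul, mul_one, add_tsub_cancel_of_le]
    simpa using hb

lemma upper_SI (D : Finset (Fin n)) (k : ℕ) : IsUpperSet {b : Fin n →₀ ℕ | ∃ v ∈ D, k ≤ b v} := by
  rintro b c hbc ⟨v, hv, hb⟩
  exact ⟨v, hv, hb.trans (hbc v)⟩

lemma mh_fin_zero {U : Set (Fin n →₀ ℕ)} (c : ℕ)
    (hc : ∀ b : Fin n →₀ ℕ, c ≤ ∑ i, b i → b ∈ U) (j : ℕ) (z : MH K (j+1) U) : z = 0 := by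
  refine lh_van (fun v => (X v : MvPolynomial (Fin n) K)) ?_ _ c ?_ _ Finset.univ ?_ ?_ j z
  · intro D v k f hv h
    rw [SI_eq] at h ⊢
    rw [X_pow_eq_monomial, ← MI_colon (upper_SI D k), mem_MI (upper_colon (upper_SI D k) _)] at h
    rw [mem_MI (upper_SI D k)]
    intro s hs
    obtain ⟨w, hw, h2⟩ := h s hs
    refine ⟨w, hw, ?_⟩
    have : v ≠ w := fun e => hv (e ▸ hw)
    simpa [Finsupp.single_apply, this] using h2
  · intro v z
    obtain ⟨f, rfl⟩ := Ideal.Quotient.mk_surjective (I := MI K U) z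
    rw [← Ideal.Quotient.mk_eq_mk, ← Submodule.Quotient.mk_smul, Submodule.Quotient.mk_eq_zero, smul_eq_mul]
    apply Ideal.mul_mem_right
    rw [X_pow_eq_monomial]
    refine Ideal.subset_span ⟨_, hc _ ?_, rfl⟩
    rw [Finset.sum_eq_single v] <;> simp +contextual
  · intro v _
    exact Ideal.subset_span ⟨v, rfl⟩
  · intro k
    refine ⟨n * k + 1, ?_⟩
    rw [max_pow, SI_eq]
    apply MI_mono
    intro b hb
    by_contra hcon
    have : ∑ i, b i ≤ ∑ i : Fin n, k := by
      apply Finset.sum_le_sum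
      intro i _
      by_contra h
      exact hcon ⟨i, Finset.mem_univ _, by omega⟩
    simp only [Finset.sum_const, Finset.card_univ, Fintype.card_fin, smul_eq_mul] at this
    have hb' : n * k + 1 ≤ ∑ i, b i := hb
    omega

lemma quot_fd {U : Set (Fin n →₀ ℕ)} (c : ℕ)
    (hc : ∀ b : Fin n →₀ ℕ, c ≤ ∑ i, b i → b ∈ U) :
    FDK (R := MvPolynomial (Fin n) K) K (MvPolynomial (Fin n) K ⧸ MI K U) := by
  let V := MvPolynomial (Fin n) K ⧸ MI K U
  have hfin : ({b : Fin n →₀ ℕ | ∑ i, b i < c}).Finite := by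
    refine (Set.finite_Iic (Finsupp.equivFunOnFinite.symm (fun _ : Fin n => c))).subset ?_
    intro b hb
    intro i
    have h1 : b i ≤ ∑ i, b i := Finset.single_le_sum (f := fun i => b i) (fun _ _ => Nat.zero_le _) (Finset.mem_univ i)
    have h2 : ∑ i, b i < c := hb
    simp
    omega
  have : Module.Finite K V := by
    refine ⟨⟨(hfin.image (fun b => Ideal.Quotient.mk (MI K U) (monomial b 1))).toFinset, ?_⟩⟩
    rw [eq_top_iff]
    rintro z -
    obtain ⟨f, rfl⟩ := Ideal.Quotient.mk_surjective (I := MI K U) z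
    induction f using MvPolynomial.induction_on' with
    | monomial b r =>
      have e : monomial b r = r • monomial b (1:K) := by rw [smul_monomial]; simp
      by_cases hb : ∑ i, b i < c
      · rw [e]
        change r • Ideal.Quotient.mk (MI K U) (monomial b 1) ∈ _
        refine Submodule.smul_mem _ _ (Submodule.subset_span ?_)
        rw [Set.Finite.coe_toFinset]
        exact ⟨b, hb, rfl⟩
      · have : Ideal.Quotient.mk (MI K U) (monomial b r) = 0 := by
          rw [Ideal.Quotient.eq_zero_iff_mem, e, MvPolynomial.smul_eq_C_mul]
          exact Ideal.mul_mem_left _ _ (Ideal.subset_span ⟨b, hc b (by omega), rfl⟩)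
        rw [this]
        exact Submodule.zero_mem _
    | add p q hp hq =>
      rw [map_add]
      exact Submodule.add_mem _ hp hq
  let ψ : V →ₗ[K] RestrictScalars K (MvPolynomial (Fin n) K) V :=
    { toFun := fun v => (RestrictScalars.addEquiv K (MvPolynomial (Fin n) K) V).symm v
      map_add' := fun _ _ => rfl
      map_smul' := fun a v => by
        have := IsScalarTower.algebraMap_smul (MvPolynomial (Fin n) K) a v
        rw [← this]
        rfl }
  unfold FDK
  exact Module.Finite.of_surjective ψ (fun v => ⟨v, rfl⟩)

lemma mh_fin_fd {U : Set (Fin n →₀ ℕ)} (c : ℕ)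
    (hc : ∀ b : Fin n →₀ ℕ, c ≤ ∑ i, b i → b ∈ U) (j : ℕ) :
    FDK (R := MvPolynomial (Fin n) K) K (MH K j U) := by
  cases j with
  | succ j => exact FDK_zero (mh_fin_zero c hc j)
  | zero =>
    obtain ⟨φ, hφ⟩ := lh0_surj (maxIdeal K n) (RQ (MI K U)) c (by
      intro z r hr
      obtain ⟨f, rfl⟩ := Ideal.Quotient.mk_surjective (I := MI K U) z
      rw [← Ideal.Quotient.mk_eq_mk, ← Submodule.Quotient.mk_smul, Submodule.Quotient.mk_eq_zero, smul_eq_mul]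
      apply Ideal.mul_mem_right
      rw [max_pow] at hr
      exact MI_mono hc hr)
    exact FDK_surj φ hφ (quot_fd c hc)

end MonLayer


noncomputable section KDim
open MvPolynomial

variable {K : Type} [Field K] {n : ℕ}

lemma kd_mv (F : Finset (Fin n)) : ringKrullDim (MvPolynomial {x // x ∈ F} K) = F.card := by
  rw [MvPolynomial.ringKrullDim_of_isNoetherianRing, ringKrullDim_eq_zero_of_field]
  simp

lemma kd_ge (Δ : SimComplex n) (m : ℕ) (hm : 1 ≤ m) (F : Finset (Fin n)) (hF : Δ.IsFacet F) :
    (F.card : WithBot ℕ∞) ≤ ringKrullDim (MvPolynomial (Fin n) K ⧸ SRSymbPow K Δ m) := by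
  rw [← kd_mv (K := K) F]
  let φ : MvPolynomial (Fin n) K →+* MvPolynomial {x // x ∈ F} K :=
    (MvPolynomial.aeval (fun i => if h : i ∈ F then (X ⟨i, h⟩ : MvPolynomial {x // x ∈ F} K) else 0)).toRingHom
  have hφ : ∀ a ∈ SRSymbPow K Δ m, φ a = 0 := by
    intro a ha
    have h1 : a ∈ PF K Fᶜ := by
      unfold SRSymbPow at ha
      simp only [Submodule.mem_iInf] at ha
      exact Ideal.pow_le_self (by omega) (ha F hF)
    have h2 : PF K Fᶜ ≤ RingHom.ker φ := by
      unfold PF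
      rw [Ideal.span_le]
      rintro _ ⟨i, hi, rfl⟩
      have hi' : i ∉ F := by simpa using hi
      simp [φ, RingHom.mem_ker, hi']
    exact h2 h1
  apply ringKrullDim_le_of_surjective (Ideal.Quotient.lift _ φ hφ)
  apply Ideal.Quotient.lift_surjective_of_surjective
  intro p
  refine ⟨rename (fun x => x.1) p, ?_⟩
  induction p using MvPolynomial.induction_on with
  | C a => simp [φ]
  | add p q hp hq => rw [map_add, map_add, hp, hq]
  | mul_X p i hp => 
    rw [map_mul, map_mul, hp]
    simp [φ, i.2]

lemma kd_PF (F : Finset (Fin n)) : ringKrullDim (MvPolynomial (Fin n) K ⧸ PF K Fᶜ) ≤ F.card := by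
  rw [← kd_mv (K := K) F]
  let φ : MvPolynomial {x // x ∈ F} K →+* MvPolynomial (Fin n) K ⧸ PF K Fᶜ :=
    (Ideal.Quotient.mk _).comp (rename (fun x => x.1)).toRingHom
  apply ringKrullDim_le_of_surjective φ
  intro z
  obtain ⟨f, rfl⟩ := Ideal.Quotient.mk_surjective z
  induction f using MvPolynomial.induction_on with
  | C a => exact ⟨C a, by simp [φ]⟩
  | add p q hp hq =>
    obtain ⟨a, ha⟩ := hp
    obtain ⟨b, hb⟩ := hq
    exact ⟨a + b, by rw [map_add, map_add, ha, hb]⟩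
  | mul_X p i hp =>
    obtain ⟨a, ha⟩ := hp
    by_cases hi : i ∈ F
    · exact ⟨a * X ⟨i, hi⟩, by rw [map_mul, map_mul, ha]; simp [φ]⟩
    · refine ⟨0, ?_⟩
      have : Ideal.Quotient.mk (PF K Fᶜ) (X i) = 0 := by
        rw [Ideal.Quotient.eq_zero_iff_mem]
        exact Ideal.subset_span ⟨i, by simpa using hi, rfl⟩
      rw [map_mul, this, mul_zero, map_zero]

lemma kd_le (Δ : SimComplex n) (m d : ℕ) (hd : ∀ F, Δ.IsFacet F → F.card ≤ d) :
    ringKrullDim (MvPolynomial (Fin n) K ⧸ SRSymbPow K Δ m) ≤ d := by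
  classical
  rw [ringKrullDim_quotient]
  unfold Order.krullDim
  apply iSup_le
  intro s
  have hp : (s.head : PrimeSpectrum (MvPolynomial (Fin n) K)).asIdeal.IsPrime := s.head.1.2
  have h0 : SRSymbPow K Δ m ≤ (s.head : PrimeSpectrum (MvPolynomial (Fin n) K)).asIdeal := by
    have := s.head.2
    rwa [PrimeSpectrum.mem_zeroLocus] at this
  let T : Finset (Finset (Fin n)) := Finset.univ.filter (fun F => Δ.IsFacet F)
  have h1 : T.inf (fun F => (PF K Fᶜ) ^ m) ≤ SRSymbPow K Δ m := by
    unfold SRSymbPow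
    refine le_iInf₂ (fun F hF => ?_)
    exact Finset.inf_le (by simp [T, hF])
  obtain ⟨F, hF, h2⟩ := (hp.inf_le').1 (h1.trans h0)
  have hF' : Δ.IsFacet F := by simpa [T] using hF
  have h3 := hp.le_of_pow_le h2
  have h4 : ((s.length : ℕ∞) : WithBot ℕ∞) ≤ Order.krullDim (PrimeSpectrum.zeroLocus (R := MvPolynomial (Fin n) K) (PF K Fᶜ : Set (MvPolynomial (Fin n) K))) := by
    let s' : LTSeries (PrimeSpectrum.zeroLocus (R := MvPolynomial (Fin n) K) (PF K Fᶜ : Set (MvPolynomial (Fin n) K))) :=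
      { length := s.length
        toFun := fun i => ⟨(s i).1, by
          rw [PrimeSpectrum.mem_zeroLocus]
          have : s.head ≤ s i := LTSeries.head_le s i
          exact h3.trans this⟩
        step := fun i => s.step i }
    exact Order.LTSeries.length_le_krullDim s'
  rw [← ringKrullDim_quotient] at h4
  refine (h4.trans (kd_PF F)).trans ?_
  exact_mod_cast hd F hF'

end KDim


noncomputable section CMLayer
open MvPolynomial

variable {K : Type} [Field K] {n : ℕ}

lemma mh_univ {U : Set (Fin n →₀ ℕ)} (hU : ∀ b, b ∈ U) (i : ℕ) (z : MH K i U) : z = 0 := by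
  have h0 : 𝟙 (RQ (MI K U)) = 0 := by
    apply rq_ext
    change Ideal.Quotient.mk (MI K U) 1 = 0
    rw [Ideal.Quotient.eq_zero_iff_mem]
    exact Ideal.subset_span ⟨0, hU 0, rfl⟩
  rw [← lhMap_id (maxIdeal K n) i _ z, h0, lhMap_zero]

lemma X_mem_max (v : Fin n) : monomial (Finsupp.single v 1) (1:K) ∈ maxIdeal K n :=
  Ideal.subset_span ⟨v, rfl⟩

lemma single_le_iff' (v : Fin n) (k : ℕ) (b : Fin n →₀ ℕ) : Finsupp.single v k ≤ b ↔ k ≤ b v := by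
  simp

lemma mh_poly (D : Finset (Fin n)) (i : ℕ) (hi : i < Dᶜ.card) (z : MH K i {b | ∃ v ∈ D, 1 ≤ b v}) : z = 0 := by
  induction hk : Dᶜ.card generalizing D i with
  | zero => omega
  | succ k ih =>
    obtain ⟨v, hv⟩ : Dᶜ.Nonempty := by
      rw [← Finset.card_pos]; omega
    have hv' : v ∉ D := by simpa using hv
    have hcard : (insert v D)ᶜ.card = k := by
      rw [Finset.compl_insert, Finset.card_erase_of_mem hv, hk]; rfl
    have e : {b : Fin n →₀ ℕ | ∃ v ∈ D, 1 ≤ b v} = {b | Finsupp.single v 1 + b ∈ {b : Fin n →₀ ℕ | ∃ v ∈ D, 1 ≤ b v}} := by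
      ext b
      simp only [Set.mem_ofPred_eq, Finsupp.add_apply]
      refine exists_congr fun w => and_congr_right fun hw => ?_
      have : v ≠ w := fun e => hv' (e ▸ hw)
      simp [Finsupp.single_apply, this]
    refine lh_eq_zero_reg (monomial (Finsupp.single v 1) (1:K)) (X_mem_max v) _
      (MI K {b | ∃ w ∈ insert v D, 1 ≤ b w}) ?_ ?_ i ?_ z
    · intro f
      rw [← MI_colon (upper_SI D 1), ← e]
    · apply MI_add
      intro b
      rw [single_le_iff']
      simp only [Set.mem_ofPred_eq, Finset.mem_insert]
      constructor
      · rintro ⟨w, rfl | h, h2⟩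
        · exact Or.inr h2
        · exact Or.inl ⟨w, h, h2⟩
      · rintro (⟨w, h, h2⟩ | h)
        · exact ⟨w, Or.inr h, h2⟩
        · exact ⟨v, Or.inl rfl, h⟩
    · intro j hj z
      exact ih _ j (by omega) z hcard

def BU (m : ℕ) (B : Set (Finset (Fin n))) (D : Finset (Fin n)) (a : Fin n →₀ ℕ) : Set (Fin n →₀ ℕ) :=
  {b | (∃ v ∈ D, 1 ≤ b v) ∨ ∀ F ∈ B, m ≤ ∑ i ∈ Fᶜ, (a + b) i}

lemma upper_BU (m : ℕ) (B : Set (Finset (Fin n))) (D : Finset (Fin n)) (a : Fin n →₀ ℕ) :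
    IsUpperSet (BU m B D a) := by
  rintro b c hbc (⟨v, hv, h⟩ | h)
  · exact Or.inl ⟨v, hv, h.trans (hbc v)⟩
  · exact Or.inr fun F hF => upper_sum _ _ (add_le_add_right hbc a) (h F hF)

lemma sum_swap (F : Finset (Fin n)) (u w : Fin n) (hu : u ∈ F) (hw : w ∉ F) (g : Fin n → ℕ) :
    ∑ i ∈ (insert w (F.erase u))ᶜ, g i + g w = ∑ i ∈ Fᶜ, g i + g u := by
  have huw : u ≠ w := fun e => hw (e ▸ hu)
  have h1 : Fᶜ = insert w (insert w F)ᶜ := by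
    ext x; simp only [Finset.mem_compl, Finset.mem_insert]; by_cases e : x = w
    · subst e; simp [hw]
    · simp [e]
  have h2 : (insert w (F.erase u))ᶜ = insert u (insert w F)ᶜ := by
    ext x; simp only [Finset.mem_compl, Finset.mem_insert, Finset.mem_erase]; by_cases e : x = u
    · subst e; simp [huw]
    · simp [e]
  rw [h1, h2, Finset.sum_insert (by simpa using fun _ => hu), Finset.sum_insert (by simp)]
  ring

lemma cm_van (m d : ℕ) (i : ℕ) (hi : i < d) (N : ℕ) : ∀ (B : Set (Finset (Fin n))) (D : Finset (Fin n)) (a : Fin n →₀ ℕ),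
    (∀ F ∈ B, F.card = d) → (∀ F ∈ B, Disjoint F D) →
    (∀ F ∈ B, ∀ F0 ∈ B, ∀ u ∈ F, u ∉ F0 → ∃ w ∈ F0, w ∉ F ∧ insert w (F.erase u) ∈ B) →
    Dᶜ.card + ∑ j, (m - a j) = N → ∀ z : MH K i (BU m B D a), z = 0 := by
  classical
  induction N using Nat.strong_induction_on with
  | _ N ih =>
  intro B D a hcard hdisj hex hN z
  by_cases hNe : ∃ v, v ∉ D ∧ ∃ F ∈ B, v ∉ F
  swap
  · push Not at hNe
    by_cases hB : ∃ F, F ∈ B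
    · obtain ⟨F, hF⟩ := hB
      have hall : ∀ F ∈ B, F = Dᶜ := by
        intro F hF
        ext x
        rw [Finset.mem_compl]
        exact ⟨fun hx hxD => Finset.disjoint_left.1 (hdisj F hF) hx hxD, fun hx => hNe x hx F hF⟩
      by_cases hs : m ≤ ∑ j ∈ D, a j
      · refine mh_univ (fun b => Or.inr fun F' hF' => ?_) i z
        rw [hall F' hF', compl_compl]
        refine hs.trans (Finset.sum_le_sum fun j _ => ?_)
        simp
      · have e : BU m B D a = {b | ∃ v ∈ D, 1 ≤ b v} := by
          ext b
          refine ⟨fun h => ?_, fun h => Or.inl h⟩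
          rcases h with h | h
          · exact h
          · by_contra hcon
            apply hs
            have := h F hF
            rw [hall F hF, compl_compl] at this
            refine this.trans (Finset.sum_le_sum fun j hj => ?_)
            have : ¬ 1 ≤ b j := fun h1 => hcon ⟨j, hj, h1⟩
            simp only [Finsupp.add_apply]
            omega
        have hc := hcard F hF
        rw [hall F hF] at hc
        revert z
        rw [e]
        intro z
        exact mh_poly D i (by omega) z
    · push Not at hB
      exact mh_univ (fun b => Or.inr fun F hF => absurd hF (hB F)) i z
  · obtain ⟨v, ⟨hvD, F1, hF1, hvF1⟩, hmin⟩ := Set.exists_min_image {v | v ∉ D ∧ ∃ F ∈ B, v ∉ F} (fun v => a v) (Set.toFinite _) hNe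
    have hrep : ∀ F ∈ B, v ∈ F → ∃ w, w ∉ F ∧ a v ≤ a w ∧ insert w (F.erase v) ∈ B := by
      intro F hF hvF
      obtain ⟨w, hw, hwF, hB⟩ := hex F hF F1 hF1 v hvF hvF1
      exact ⟨w, hwF, hmin w ⟨fun h => Finset.disjoint_left.1 (hdisj F1 hF1) hw h, F, hF, hwF⟩, hB⟩
    by_cases hav : m ≤ a v
    · refine mh_univ (fun b => Or.inr fun F hF => ?_) i z
      obtain ⟨w, hwF, hw⟩ : ∃ w, w ∉ F ∧ a v ≤ a w := by
        by_cases hvF : v ∈ F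
        · obtain ⟨w, h1, h2, _⟩ := hrep F hF hvF
          exact ⟨w, h1, h2⟩
        · exact ⟨v, hvF, le_rfl⟩
      have := Finset.single_le_sum (f := fun j => (a + b) j) (fun _ _ => Nat.zero_le _) (Finset.mem_compl.2 hwF)
      simp only [Finsupp.add_apply] at this ⊢
      omega
    · have e1 : {b | Finsupp.single v 1 + b ∈ BU m B D a} = BU m B D (a + Finsupp.single v 1) := by
        ext b
        unfold BU
        simp only [Set.mem_ofPred_eq]
        apply or_congr
        · refine exists_congr fun w => and_congr_right fun hw => ?_
          have : v ≠ w := fun e => hvD (e ▸ hw)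
          simp [Finsupp.single_apply, this]
        · rw [add_assoc]
      have hsum : ∑ j, (m - (a + Finsupp.single v 1 : Fin n →₀ ℕ) j) < ∑ j, (m - a j) := by
        apply Finset.sum_lt_sum
        · intro j _
          simp only [Finsupp.add_apply]
          omega
        · refine ⟨v, Finset.mem_univ _, ?_⟩
          simp only [Finsupp.add_apply, Finsupp.single_eq_same]
          omega
      have hcD : (insert v D)ᶜ.card < Dᶜ.card := by
        rw [Finset.compl_insert]
        exact Finset.card_erase_lt_of_mem (by simpa using hvD)
      refine lh_eq_zero_colon (monomial (Finsupp.single v 1) (1:K)) (MI K (BU m B D (a + Finsupp.single v 1)))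
        _ (MI K (BU m {F ∈ B | v ∉ F} (insert v D) a)) ?_ ?_ i ?_ ?_ z
      · intro f
        rw [← e1, MI_colon (upper_BU _ _ _ _)]
      · apply MI_add
        intro b
        rw [single_le_iff']
        constructor
        · rintro (⟨w, hw, h⟩ | h)
          · rw [Finset.mem_insert] at hw
            rcases hw with rfl | hw
            · exact Or.inr h
            · exact Or.inl (Or.inl ⟨w, hw, h⟩)
          · by_cases hb : 1 ≤ b v
            · exact Or.inr hb
            refine Or.inl (Or.inr fun F hF => ?_)
            by_cases hvF : v ∈ F
            · obtain ⟨w, hwF, haw, hB⟩ := hrep F hF hvF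
              have hvw : v ≠ w := fun e => hwF (e ▸ hvF)
              have h3 := h _ ⟨hB, by simp [hvw]⟩
              have h4 := sum_swap F v w hvF hwF (fun j => (a + b) j)
              simp only [Finsupp.add_apply] at h3 h4 ⊢
              omega
            · exact h F ⟨hF, hvF⟩
        · rintro ((⟨w, hw, h⟩ | h) | h)
          · exact Or.inl ⟨w, Finset.mem_insert_of_mem hw, h⟩
          · exact Or.inr fun F hF => h F hF.1
          · exact Or.inl ⟨v, Finset.mem_insert_self _ _, h⟩
      · exact ih _ (by omega) B D _ hcard hdisj hex rfl
      · refine ih _ (by omega) _ (insert v D) a (fun F hF => hcard F hF.1) ?_ ?_ rfl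
        · intro F hF
          rw [Finset.disjoint_insert_right]
          exact ⟨hF.2, hdisj F hF.1⟩
        · intro F hF F0 hF0 u hu huF0
          obtain ⟨w, hw, hwF, hB⟩ := hex F hF.1 F0 hF0.1 u hu huF0
          refine ⟨w, hw, hwF, hB, ?_⟩
          rw [Finset.mem_insert, Finset.mem_erase]
          rintro (rfl | ⟨_, h⟩)
          · exact hF0.2 hw
          · exact hF.2 h

end CMLayer


section CompFacts
namespace SimComplex
variable {n : ℕ}

lemma adj_symm' (Δ : SimComplex n) {u v : Fin n} (h : Δ.Adj u v) : Δ.Adj v u :=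
  ⟨h.1.symm, by rw [Finset.pair_comm]; exact h.2⟩

lemma reach_symm' (Δ : SimComplex n) {u v : Fin n} (h : Δ.Reach u v) : Δ.Reach v u := by
  induction h with
  | refl => exact Relation.ReflTransGen.refl
  | tail _ hab ih => exact Relation.ReflTransGen.head (Δ.adj_symm' hab) ih

lemma reach_trans' (Δ : SimComplex n) {u v w : Fin n} (h : Δ.Reach u v) (h' : Δ.Reach v w) : Δ.Reach u w :=
  Relation.ReflTransGen.trans h h'

lemma reach_face (Δ : SimComplex n) {F : Finset (Fin n)} (hF : F ∈ Δ.faces) {u v : Fin n} (hu : u ∈ F) (hv : v ∈ F) :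
    Δ.Reach u v := by
  by_cases h : u = v
  · subst h; exact Relation.ReflTransGen.refl
  · refine Relation.ReflTransGen.single ⟨h, Δ.down_closed hF ?_⟩
    intro x hx
    rw [Finset.mem_insert, Finset.mem_singleton] at hx
    rcases hx with rfl | rfl <;> assumption

/-- maximal cardinality -/
noncomputable def mc (Δ : SimComplex n) : ℕ := sSup (Finset.card '' Δ.faces)

lemma dim_eq (Δ : SimComplex n) : Δ.dim = (Δ.mc : ℤ) - 1 := rfl

lemma mc_bdd (Δ : SimComplex n) : BddAbove (Finset.card '' Δ.faces) := by
  refine ⟨n, ?_⟩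
  rintro _ ⟨F, _, rfl⟩
  simpa using Finset.card_le_univ F

lemma card_le_mc (Δ : SimComplex n) {F : Finset (Fin n)} (hF : F ∈ Δ.faces) : F.card ≤ Δ.mc :=
  le_csSup Δ.mc_bdd ⟨F, hF, rfl⟩

lemma exists_mc (Δ : SimComplex n) {G : Finset (Fin n)} (hG : G ∈ Δ.faces) : ∃ F ∈ Δ.faces, F.card = Δ.mc := by
  obtain ⟨F, hF, h⟩ := Nat.sSup_mem (⟨_, G, hG, rfl⟩ : (Finset.card '' Δ.faces).Nonempty) Δ.mc_bdd
  exact ⟨F, hF, h⟩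

lemma exists_facet (Δ : SimComplex n) {G : Finset (Fin n)} (hG : G ∈ Δ.faces) : ∃ F, Δ.IsFacet F ∧ G ⊆ F := by
  obtain ⟨F, hF, hmax⟩ := Set.exists_max_image {F | F ∈ Δ.faces ∧ G ⊆ F} (fun F => F.card) (Set.toFinite _) ⟨G, hG, subset_rfl⟩
  refine ⟨F, ⟨hF.1, fun F' hF' hs => ?_⟩, hF.2⟩
  exact Finset.eq_of_subset_of_card_le hs (hmax F' ⟨hF', hF.2.trans hs⟩)

lemma facet_of_card (Δ : SimComplex n) {F : Finset (Fin n)} (hF : F ∈ Δ.faces) (h : F.card = Δ.mc) : Δ.IsFacet F :=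
  ⟨hF, fun _ hG hs => Finset.eq_of_subset_of_card_le hs (h ▸ Δ.card_le_mc hG)⟩

lemma comp_card (Δ : SimComplex n) (hV : ∀ i : Fin n, ({i} : Finset (Fin n)) ∈ Δ.faces) (h0 : 1 ≤ Δ.mc)
    (he : ∀ u v, (Δ.component u).mc = (Δ.component v).mc) (v : Fin n) : (Δ.component v).mc = Δ.mc := by
  obtain ⟨F, hF, hc⟩ := Δ.exists_mc (hV v)
  obtain ⟨w, hw⟩ : F.Nonempty := by rw [← Finset.card_pos]; omega
  rw [he v w]
  have h1 : F ∈ (Δ.component w).faces := ⟨hF, fun x hx => Δ.reach_face hF hw hx⟩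
  apply le_antisymm
  · obtain ⟨F', hF', hc'⟩ := (Δ.component w).exists_mc h1
    rw [← hc']; exact Δ.card_le_mc hF'.1
  · rw [← hc]; exact (Δ.component w).card_le_mc h1

/-- facets inside a component -/
def CF (Δ : SimComplex n) (v : Fin n) : Set (Finset (Fin n)) := {F | Δ.IsFacet F ∧ ∀ u ∈ F, Δ.Reach v u}

lemma CF_card (Δ : SimComplex n) (v : Fin n) (hm : (Δ.component v).IsMatroid) {F : Finset (Fin n)} (hF : F ∈ Δ.CF v) :
    F.card = (Δ.component v).mc := by
  have hF' : F ∈ (Δ.component v).faces := ⟨hF.1.1, fun x hx => hF.2 x hx⟩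
  refine le_antisymm ((Δ.component v).card_le_mc hF') ?_
  obtain ⟨F2, hF2, hc⟩ := (Δ.component v).exists_mc hF'
  by_contra hlt
  obtain ⟨i, hi, hiF, h⟩ := hm F2 F hF2 hF' (by omega)
  have := hF.1.2 _ h.1 (Finset.subset_insert _ _)
  rw [this] at hiF
  exact hiF (Finset.mem_insert_self _ _)

lemma CF_exch (Δ : SimComplex n) (v : Fin n) (hm : (Δ.component v).IsMatroid) (hc : (Δ.component v).mc = Δ.mc)
    (F : Finset (Fin n)) (hF : F ∈ Δ.CF v) (F0 : Finset (Fin n)) (hF0 : F0 ∈ Δ.CF v) (u : Fin n) (hu : u ∈ F) (hu0 : u ∉ F0) :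
    ∃ w ∈ F0, w ∉ F ∧ insert w (F.erase u) ∈ Δ.CF v := by
  have c1 := Δ.CF_card v hm hF
  have c0 := Δ.CF_card v hm hF0
  have ce := Finset.card_erase_of_mem hu
  have cp := Finset.card_pos.2 ⟨u, hu⟩
  have hF' : F ∈ (Δ.component v).faces := ⟨hF.1.1, fun x hx => hF.2 x hx⟩
  obtain ⟨w, hw, hwe, h⟩ := hm F0 (F.erase u) ⟨hF0.1.1, fun x hx => hF0.2 x hx⟩
    ((Δ.component v).down_closed hF' (Finset.erase_subset _ _)) (by omega)
  refine ⟨w, hw, fun hwF => hwe (Finset.mem_erase.2 ⟨fun e => hu0 (e ▸ hw), hwF⟩), Δ.facet_of_card h.1 ?_, fun x hx => h.2 hx⟩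
  rw [Finset.card_insert_of_notMem hwe]
  omega

end SimComplex
end CompFacts

noncomputable section GCM
open MvPolynomial
variable {K : Type} [Field K] {n : ℕ}

lemma gcm_fd (Δ : SimComplex n) (m d i : ℕ) (hi : i < d)
    (hcard : ∀ v, ∀ F ∈ Δ.CF v, F.card = d)
    (hex : ∀ v, ∀ F ∈ Δ.CF v, ∀ F0 ∈ Δ.CF v, ∀ u ∈ F, u ∉ F0 → ∃ w ∈ F0, w ∉ F ∧ insert w (F.erase u) ∈ Δ.CF v)
    (W : Finset (Fin n)) : FDK (R := MvPolynomial (Fin n) K) K (MH K i {b | ∀ v ∈ W, b ∈ BU m (Δ.CF v) ∅ 0}) := by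
  classical
  have hup : ∀ W : Finset (Fin n), IsUpperSet {b | ∀ v ∈ W, b ∈ BU m (Δ.CF v) ∅ 0} := by
    intro W b c hbc h v hv
    exact upper_BU _ _ _ _ hbc (h v hv)
  induction W using Finset.induction_on with
  | empty => exact FDK_zero fun z => mh_univ (fun b v hv => absurd hv (Finset.notMem_empty v)) i z
  | insert v W _ ih =>
    have hins : {b | ∀ w ∈ insert v W, b ∈ BU m (Δ.CF w) ∅ 0} = {b | ∀ v ∈ W, b ∈ BU m (Δ.CF v) ∅ 0} ∩ BU m (Δ.CF v) ∅ 0 := by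
      ext b
      constructor
      · intro h
        exact ⟨fun w hw => h w (Finset.mem_insert_of_mem hw), h v (Finset.mem_insert_self _ _)⟩
      · rintro ⟨h1, h2⟩ w hw
        rw [Finset.mem_insert] at hw
        rcases hw with rfl | hw
        · exact h2
        · exact h1 w hw
    by_cases hr : ∃ w ∈ W, Δ.Reach w v
    · obtain ⟨w, hw, hr⟩ := hr
      have hCF : Δ.CF v = Δ.CF w := by
        ext F
        exact ⟨fun h => ⟨h.1, fun u hu => Δ.reach_trans' hr (h.2 u hu)⟩,
          fun h => ⟨h.1, fun u hu => Δ.reach_trans' (Δ.reach_symm' hr) (h.2 u hu)⟩⟩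
      have : {b | ∀ w ∈ insert v W, b ∈ BU m (Δ.CF w) ∅ 0} = {b | ∀ v ∈ W, b ∈ BU m (Δ.CF v) ∅ 0} := by
        rw [hins]
        apply Set.inter_eq_left.2
        intro b hb
        rw [hCF]
        exact hb w hw
      rw [this]
      exact ih
    · rw [hins]
      unfold MH
      rw [MI_inf (hup W) (upper_BU _ _ _ _)]
      refine mv_fd _ _ i ih ?_ ?_
      · exact FDK_zero fun z => cm_van m d i hi _ (Δ.CF v) ∅ 0 (hcard v) (fun F _ => Finset.disjoint_empty_right F) (hex v) rfl z
      · intro j _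
        rw [← MI_sup]
        refine mh_fin_fd (2 * m) ?_ j
        intro b hb
        by_contra hcon
        rw [Set.mem_union, not_or] at hcon
        obtain ⟨h1, h2⟩ := hcon
        have h1' : ∃ w ∈ W, ∃ F ∈ Δ.CF w, ∑ i ∈ Fᶜ, b i < m := by
          by_contra hc
          push Not at hc
          exact h1 fun w hw => Or.inr fun F hF => by rw [zero_add]; exact hc w hw F hF
        have h2' : ∃ F ∈ Δ.CF v, ∑ i ∈ Fᶜ, b i < m := by
          by_contra hc
          push Not at hc
          exact h2 (Or.inr fun F hF => by rw [zero_add]; exact hc F hF)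
        obtain ⟨w, hw, F, hF, hFm⟩ := h1'
        obtain ⟨F', hF', hFm'⟩ := h2'
        have hdj : Disjoint F F' := by
          rw [Finset.disjoint_left]
          intro x hx hx'
          exact hr ⟨w, hw, Δ.reach_trans' (hF.2 x hx) (Δ.reach_symm' (hF'.2 x hx'))⟩
        have h3 : ∑ i, b i ≤ ∑ i ∈ Fᶜ, b i + ∑ i ∈ F'ᶜ, b i := by
          rw [← Finset.sum_compl_add_sum F]
          gcongr
          intro x hx
          rw [Finset.mem_compl]
          exact Finset.disjoint_left.1 hdj hx
        omega

lemma iii_i (Δ : SimComplex n) (hV : ∀ i : Fin n, ({i} : Finset (Fin n)) ∈ Δ.faces) (h3 : 3 ≤ Δ.mc)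
    (hm : ∀ v, (Δ.component v).IsMatroid) (he : ∀ u v, (Δ.component u).mc = (Δ.component v).mc) (m : ℕ) :
    IsGeneralizedCM K (SRSymbPow K Δ m) := by
  intro i hi
  have hc := fun v => Δ.comp_card hV (by omega) he v
  have hle := kd_le (K := K) Δ m Δ.mc (fun F hF => Δ.card_le_mc hF.1)
  have hid : i < Δ.mc := by exact_mod_cast lt_of_lt_of_le hi hle
  have key := gcm_fd (K := K) Δ m Δ.mc i hid (fun v F hF => (Δ.CF_card v (hm v) hF).trans (hc v))
    (fun v => Δ.CF_exch v (hm v) (hc v)) Finset.univ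
  have hU : {b | ∀ v ∈ Finset.univ, b ∈ BU m (Δ.CF v) ∅ 0} = SU Δ m := by
    ext b
    constructor
    · intro h F hF
      have hne : F.Nonempty := by
        rw [Finset.nonempty_iff_ne_empty]
        rintro rfl
        have hn : ∃ G ∈ Δ.faces, G.card = Δ.mc := Δ.exists_mc hF.1
        obtain ⟨G, hG, hGc⟩ := hn
        have := hF.2 G hG (Finset.empty_subset _)
        subst this
        simp at hGc
        omega
      obtain ⟨v, hv⟩ := hne
      rcases h v (Finset.mem_univ _) with ⟨w, hw, _⟩ | h
      · exact absurd hw (Finset.notMem_empty _)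
      · have := h F ⟨hF, fun u hu => Δ.reach_face hF.1 hv hu⟩
        rwa [zero_add] at this
    · intro h v _
      exact Or.inr fun F hF => by rw [zero_add]; exact h F hF.1
  rw [hU] at key
  rw [SR_eq]
  exact key

end GCM


noncomputable section KillLayer
open MvPolynomial
variable {K : Type} [Field K] {n : ℕ}

def ind (G : Finset (Fin n)) (k : ℕ) : Fin n →₀ ℕ := Finsupp.equivFunOnFinite.symm (fun v => if v ∈ G then k else 0)

lemma ind_apply (G : Finset (Fin n)) (k : ℕ) (v : Fin n) : ind G k v = if v ∈ G then k else 0 := rfl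

lemma ind_mul (G : Finset (Fin n)) (k l : ℕ) :
    monomial (ind G k) (1:K) * monomial (ind G l) 1 = monomial (ind G (k + l)) 1 := by
  rw [monomial_mul, one_mul]
  have e : ind G k + ind G l = ind G (k + l) := by
    ext v
    rw [Finsupp.add_apply, ind_apply, ind_apply, ind_apply]
    split_ifs <;> rfl
  rw [e]

def LU (m : ℕ) (C : Set (Finset (Fin n))) (D : Finset (Fin n)) (T : ℕ) : Set (Fin n →₀ ℕ) :=
  {b | (∃ v ∈ D, T ≤ b v) ∨ ∀ F ∈ C, m ≤ ∑ i ∈ Fᶜ, b i}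

lemma upper_LU (m : ℕ) (C : Set (Finset (Fin n))) (D : Finset (Fin n)) (T : ℕ) :
    IsUpperSet (LU m C D T) := by
  rintro b c hbc (⟨v, hv, h⟩ | h)
  · exact Or.inl ⟨v, hv, h.trans (hbc v)⟩
  · exact Or.inr fun F hF => upper_sum _ _ hbc (h F hF)

/-- facets containing G -/
def FC (Δ : SimComplex n) (G : Finset (Fin n)) : Set (Finset (Fin n)) := {F | Δ.IsFacet F ∧ G ⊆ F}

lemma kill1 (Δ : SimComplex n) (m d : ℕ) (H : ∀ i < d, FDK (R := MvPolynomial (Fin n) K) K (MH K i (SU Δ m)))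
    (G : Finset (Fin n)) (hG : G.Nonempty) :
    ∃ t, ∀ i < d, ∀ z : MH K i (SU Δ m), monomial (ind G t) (1:K) • z = 0 := by
  have h1 : ∀ i : ℕ, ∃ t, i < d → ∀ r ∈ maxIdeal K n ^ t, ∀ z : MH K i (SU Δ m), r • z = 0 := by
    intro i
    by_cases hi : i < d
    · obtain ⟨t, ht⟩ := FDK_kill i _ (H i hi)
      exact ⟨t, fun _ => ht⟩
    · exact ⟨0, fun h => absurd h hi⟩
  choose t ht using h1
  refine ⟨∑ i ∈ Finset.range d, t i, fun i hi z => ht i hi _ ?_ z⟩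
  rw [max_pow, mon_mem_MI (upper_sum _ _)]
  obtain ⟨v, hv⟩ := hG
  have h2 : t i ≤ ∑ i ∈ Finset.range d, t i := Finset.single_le_sum (f := t) (fun _ _ => Nat.zero_le _) (Finset.mem_range.2 hi)
  refine h2.trans ?_
  have h3 := Finset.single_le_sum (f := fun j => ind G (∑ i ∈ Finset.range d, t i) j) (fun _ _ => Nat.zero_le _) (Finset.mem_univ v)
  simp only [ind_apply, hv, if_true] at h3
  exact h3

lemma kill2 (Δ : SimComplex n) (m d : ℕ) (H : ∀ i < d, FDK (R := MvPolynomial (Fin n) K) K (MH K i (SU Δ m)))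
    (G : Finset (Fin n)) (hG : G.Nonempty) :
    ∃ t, ∀ T, ∀ i < d, ∀ z : MH K i (LU m (FC Δ G) ∅ T), monomial (ind G t) (1:K) • z = 0 := by
  obtain ⟨t, ht⟩ := kill1 Δ m d H G hG
  refine ⟨t + m, fun T i hi z => ?_⟩
  rw [← ind_mul]
  refine lh_kill_colon _ _ (MI K (SU Δ m)) _ ?_ ?_ i (ht i hi) z
  · intro f hf
    rw [← MI_colon (upper_SU Δ m)]
    refine MI_mono ?_ hf
    rintro b (⟨v, hv, _⟩ | hb) F hF
    · exact absurd hv (Finset.notMem_empty _)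
    · by_cases hGF : G ⊆ F
      · refine (hb F ⟨hF, hGF⟩).trans (Finset.sum_le_sum fun j _ => ?_)
        simp
      · rw [Finset.not_subset] at hGF
        obtain ⟨v, hv, hvF⟩ := hGF
        have h3 := Finset.single_le_sum (f := fun j => (ind G m + b) j) (fun _ _ => Nat.zero_le _) (Finset.mem_compl.2 hvF)
        refine le_trans ?_ h3
        simp [ind_apply, hv]
  · apply MI_mono
    intro b hb
    exact Or.inr fun F hF => hb F hF.1

lemma kill3 (Δ : SimComplex n) (m d : ℕ) (H : ∀ i < d, FDK (R := MvPolynomial (Fin n) K) K (MH K i (SU Δ m)))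
    (G : Finset (Fin n)) (hG : G.Nonempty) (D : Finset (Fin n)) : D ⊆ G →
    ∃ t, ∀ T, ∀ i, i + D.card < d → ∀ z : MH K i (LU m (FC Δ G) D T), monomial (ind G t) (1:K) • z = 0 := by
  classical
  induction D using Finset.induction_on with
  | empty =>
    intro _
    exact kill2 Δ m d H G hG
  | insert v D hvD ih =>
    intro hs
    obtain ⟨t, ht⟩ := ih (fun x hx => hs (Finset.mem_insert_of_mem hx))
    refine ⟨t + t, fun T i hi z => ?_⟩
    rw [Finset.card_insert_of_notMem hvD] at hi
    rw [← ind_mul]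
    refine lh_kill_reg (monomial (Finsupp.single v T) (1:K)) _ (MI K (LU m (FC Δ G) D T)) _ ?_ ?_ i
      (ht T i (by omega)) (ht T (i+1) (by omega)) z
    · intro f
      have e : LU m (FC Δ G) D T = {b | Finsupp.single v T + b ∈ LU m (FC Δ G) D T} := by
        ext b
        unfold LU
        simp only [Set.mem_ofPred_eq]
        apply or_congr
        · refine exists_congr fun w => and_congr_right fun hw => ?_
          have : v ≠ w := fun e => hvD (e ▸ hw)
          simp [this]
        · refine forall_congr' fun F => imp_congr_right fun hF => ?_
          have : ∑ i ∈ Fᶜ, (Finsupp.single v T + b) i = ∑ i ∈ Fᶜ, b i := by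
            refine Finset.sum_congr rfl fun j hj => ?_
            have : v ≠ j := by
              rintro rfl
              exact (Finset.mem_compl.1 hj) (hF.2 (hs (Finset.mem_insert_self _ _)))
            simp [this]
          rw [this]
      rw [← MI_colon (upper_LU _ _ _ _), ← e]
    · apply MI_add
      intro b
      rw [single_le_iff']
      constructor
      · rintro (⟨w, hw, h⟩ | h)
        · rw [Finset.mem_insert] at hw
          rcases hw with rfl | hw
          · exact Or.inr h
          · exact Or.inl (Or.inl ⟨w, hw, h⟩)
        · exact Or.inl (Or.inr h)
      · rintro ((⟨w, hw, h⟩ | h) | h)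
        · exact Or.inl ⟨w, Finset.mem_insert_of_mem hw, h⟩
        · exact Or.inr h
        · exact Or.inl ⟨v, Finset.mem_insert_self _ _, h⟩

lemma sum_G_le (G : Finset (Fin n)) (s : ℕ) (c : Fin n →₀ ℕ) (h : ∀ v ∈ G, c v ≤ s) : ∑ i ∈ G, c i ≤ G.card * s := by
  simpa using Finset.sum_le_card_nsmul G (fun i => c i) s h

lemma purity (Δ : SimComplex n) (m d : ℕ) (hm : 1 ≤ m) (H : ∀ i < d, FDK (R := MvPolynomial (Fin n) K) K (MH K i (SU Δ m)))
    (G : Finset (Fin n)) (hG : G.Nonempty) (hGf : Δ.IsFacet G) : d ≤ G.card := by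
  by_contra hlt
  obtain ⟨s, hs⟩ := kill3 Δ m d H G hG G subset_rfl
  have := mh0_mem (upper_LU m (FC Δ G) G (s+1)) 0 (ind G s) (G.card * s + m) (by
    intro c hc
    rw [add_zero]
    by_contra hcon
    unfold LU at hcon
    rw [Set.mem_ofPred_eq, not_or] at hcon
    obtain ⟨h1, h2⟩ := hcon
    push Not at h1 h2
    obtain ⟨F, hF, hFm⟩ := h2
    have : G = F := hGf.2 F hF.1.1 hF.2
    subst this
    have h3 := sum_G_le G s c (fun v hv => by have := h1 v hv; omega)
    have h4 := Finset.sum_compl_add_sum G (fun i => c i)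
    omega) (hs (s+1) 0 (by omega))
  rw [add_zero] at this
  rcases this with ⟨v, hv, h⟩ | h
  · rw [ind_apply, if_pos hv] at h
    omega
  · have h1 := h G ⟨hGf, subset_rfl⟩
    rw [Finset.sum_eq_zero] at h1
    · omega
    · intro j hj
      rw [ind_apply, if_neg (Finset.mem_compl.1 hj)]

lemma mh0_LU (m : ℕ) (C : Set (Finset (Fin n))) (G : Finset (Fin n)) (T : ℕ)
    (hC : ∀ F ∈ C, ∃ w ∈ F, w ∉ G) (z : MH K 0 (LU m C G T)) : z = 0 := by
  refine mh0_zero (upper_LU _ _ _ _) ?_ z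
  intro b hb k
  unfold LU at hb ⊢
  rw [Set.mem_ofPred_eq, not_or] at hb
  obtain ⟨h1, h2⟩ := hb
  push Not at h1 h2
  obtain ⟨F, hF, hFm⟩ := h2
  obtain ⟨w, hwF, hwG⟩ := hC F hF
  refine ⟨Finsupp.single w k, ?_, ?_⟩
  · have := Finset.single_le_sum (f := fun j => Finsupp.single w k j) (fun _ _ => Nat.zero_le _) (Finset.mem_univ w)
    simpa using this
  · rw [Set.mem_ofPred_eq, not_or]
    push Not
    refine ⟨fun v hv => ?_, F, hF, ?_⟩
    · have hne : w ≠ v := fun e => hwG (e ▸ hv)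
      have := h1 v hv
      rw [Finsupp.add_apply, Finsupp.single_apply, if_neg hne]
      omega
    · refine lt_of_eq_of_lt (Finset.sum_congr rfl fun j hj => ?_) hFm
      have hne : w ≠ j := fun e => (Finset.mem_compl.1 hj) (e ▸ hwF)
      rw [Finsupp.add_apply, Finsupp.single_apply, if_neg hne, zero_add]

lemma partition (Δ : SimComplex n) (m d : ℕ) (H : ∀ i < d, FDK (R := MvPolynomial (Fin n) K) K (MH K i (SU Δ m)))
    (G : Finset (Fin n)) (hG : G.Nonempty) (hGd : G.card + 2 ≤ d) (hpure : ∀ F, Δ.IsFacet F → G.card < F.card)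
    (a : Fin n →₀ ℕ) (ha : ∀ v ∈ G, a v = 0) (P : Finset (Fin n) → Prop)
    (F : Finset (Fin n)) (hF : Δ.IsFacet F) (hGF : G ⊆ F) (hPF : P F) (hFm : ∑ i ∈ Fᶜ, a i < m)
    (F' : Finset (Fin n)) (hF' : Δ.IsFacet F') (hGF' : G ⊆ F') (hPF' : ¬ P F') (hFm' : ∑ i ∈ F'ᶜ, a i < m) :
    ∃ F1 F2, Δ.IsFacet F1 ∧ Δ.IsFacet F2 ∧ G ⊆ F1 ∧ G ⊆ F2 ∧ P F1 ∧ ¬ P F2 ∧ ∑ i ∈ F1ᶜ, a i < m ∧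
      ∑ i ∈ F2ᶜ, a i < m ∧ ∃ x ∈ F1, x ∈ F2 ∧ x ∉ G := by
  by_contra hcon
  push Not at hcon
  obtain ⟨s, hs⟩ := kill3 Δ m d H G hG G subset_rfl
  set A := LU m {F | F ∈ FC Δ G ∧ P F} G (s+1) with hA
  set B := LU m {F | F ∈ FC Δ G ∧ ¬ P F} G (s+1) with hB
  have hAB : LU m (FC Δ G) G (s+1) = A ∩ B := by
    ext b
    constructor
    · rintro (h | h)
      · exact ⟨Or.inl h, Or.inl h⟩
      · exact ⟨Or.inr fun F hF => h F hF.1, Or.inr fun F hF => h F hF.1⟩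
    · rintro ⟨h | h, h' | h'⟩
      · exact Or.inl h
      · exact Or.inl h
      · exact Or.inl h'
      · refine Or.inr fun F hF => ?_
        by_cases hP : P F
        · exact h F ⟨hF, hP⟩
        · exact h' F ⟨hF, hP⟩
  have hne : ∀ F ∈ FC Δ G, ∃ w ∈ F, w ∉ G := fun F hF =>
    Finset.exists_mem_notMem_of_card_lt_card (hpure F hF.1)
  have hk1 := hs (s+1) 1 (by omega)
  rw [hAB] at hk1
  have hk : ∀ z : MH K 0 (A ∪ B), monomial (ind G s) (1:K) • z = 0 := by
    unfold MH
    rw [MI_sup]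
    refine mv_kill _ _ _ (mh0_LU _ _ _ _ fun F hF => hne F hF.1) (mh0_LU _ _ _ _ fun F hF => hne F hF.1) ?_
    rw [← MI_inf (upper_LU _ _ _ _) (upper_LU _ _ _ _)]
    exact hk1
  have hmem := mh0_mem ((upper_LU _ _ _ _).union (upper_LU _ _ _ _)) a (ind G s) (G.card * s + 2 * m) (by
    intro c hc
    by_contra hcon2
    rw [Set.mem_union, not_or] at hcon2
    unfold LU at hcon2
    rw [Set.mem_ofPred_eq, Set.mem_ofPred_eq, not_or, not_or] at hcon2
    obtain ⟨⟨h1, h2⟩, ⟨_, h3⟩⟩ := hcon2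
    push Not at h1 h2 h3
    obtain ⟨F1, hF1, hF1m⟩ := h2
    obtain ⟨F2, hF2, hF2m⟩ := h3
    have e1 : ∀ X : Finset (Fin n), ∑ i ∈ X, (c + a) i = ∑ i ∈ X, c i + ∑ i ∈ X, a i := by
      intro X
      rw [← Finset.sum_add_distrib]; rfl
    rw [e1] at hF1m hF2m
    have key := hcon F1 F2 hF1.1.1 hF2.1.1 hF1.1.2 hF2.1.2 hF1.2 hF2.2 (by omega) (by omega)
    have h4 := sum_G_le G s c (fun v hv => by
      have := h1 v hv
      rw [Finsupp.add_apply] at this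
      omega)
    have h5 : ∑ i, c i ≤ ∑ i ∈ G, c i + (∑ i ∈ F1ᶜ, c i + ∑ i ∈ F2ᶜ, c i) := by
      have hsub : (Finset.univ : Finset (Fin n)) ⊆ G ∪ (F1ᶜ ∪ F2ᶜ) := by
        intro x _
        by_cases hx1 : x ∈ F1
        · by_cases hx2 : x ∈ F2
          · exact Finset.mem_union_left _ (key x hx1 hx2)
          · exact Finset.mem_union_right _ (Finset.mem_union_right _ (Finset.mem_compl.2 hx2))
        · exact Finset.mem_union_right _ (Finset.mem_union_left _ (Finset.mem_compl.2 hx1))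
      have u1 := Finset.sum_le_sum_of_subset (f := fun i => c i) hsub
      have u2 := Finset.sum_union_inter (s₁ := G) (s₂ := F1ᶜ ∪ F2ᶜ) (f := fun i => c i)
      have u3 := Finset.sum_union_inter (s₁ := F1ᶜ) (s₂ := F2ᶜ) (f := fun i => c i)
      omega
    omega) hk
  have hsm : ∀ X, G ⊆ X → ∑ i ∈ Xᶜ, (ind G s + a) i = ∑ i ∈ Xᶜ, a i := by
    intro X hX
    refine Finset.sum_congr rfl fun j hj => ?_
    rw [Finsupp.add_apply, ind_apply, if_neg fun h => (Finset.mem_compl.1 hj) (hX h), zero_add]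
  have hnq : ¬ ∃ v ∈ G, s + 1 ≤ (ind G s + a) v := by
    rintro ⟨v, hv, h⟩
    rw [Finsupp.add_apply, ind_apply, if_pos hv, ha v hv] at h
    omega
  rcases hmem with (h | h) | (h | h)
  · exact hnq h
  · have := h F ⟨⟨hF, hGF⟩, hPF⟩
    rw [hsm F hGF] at this
    omega
  · exact hnq h
  · have := h F' ⟨⟨hF', hGF'⟩, hPF'⟩
    rw [hsm F' hGF'] at this
    omega

end KillLayer


section Comb
variable {n : ℕ}
namespace SimComplex

/-- exchange among faces containing `G` -/
def MG (Γ : SimComplex n) (G : Finset (Fin n)) : Prop :=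
  ∀ F F', F ∈ Γ.faces → F' ∈ Γ.faces → G ⊆ F → G ⊆ F' → F'.card < F.card →
    ∃ i ∈ F, i ∉ F' ∧ insert i F' ∈ Γ.faces

lemma tri (Γ : SimComplex n) {t a b c : Fin n} (h : Γ.MG {t}) (hta : t ≠ a) (htb : t ≠ b) (hab : a ≠ b)
    (h1 : ({t, a, b} : Finset (Fin n)) ∈ Γ.faces) (h2 : ({t, c} : Finset (Fin n)) ∈ Γ.faces) :
    (a ≠ c ∧ ({a, t, c} : Finset (Fin n)) ∈ Γ.faces) ∨ (b ≠ c ∧ ({b, t, c} : Finset (Fin n)) ∈ Γ.faces) := by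
  have c1 : ({t, a, b} : Finset (Fin n)).card = 3 := Finset.card_eq_three.2 ⟨t, a, b, hta, htb, hab, rfl⟩
  have c2 : ({t, c} : Finset (Fin n)).card ≤ 2 := Finset.card_le_two
  obtain ⟨i, hi, hi2, h3⟩ := h _ _ h1 h2 (by simp) (by simp) (by omega)
  simp only [Finset.mem_insert, Finset.mem_singleton, not_or] at hi hi2
  rcases hi with rfl | rfl | rfl
  · exact absurd rfl hi2.1
  · exact Or.inl ⟨hi2.2, h3⟩
  · exact Or.inr ⟨hi2.2, h3⟩

lemma adj_of_face (Γ : SimComplex n) {a b c : Fin n} (hac : a ≠ c) (h : ({a, b, c} : Finset (Fin n)) ∈ Γ.faces) : Γ.Adj c a :=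
  ⟨hac.symm, Γ.down_closed h (by intro x; simp; tauto)⟩

lemma near_step (Γ : SimComplex n) (hst : ∀ v, Γ.MG {v})
    (h3 : ∀ u v, Γ.Adj u v → ∃ w, w ≠ u ∧ w ≠ v ∧ ({u, v, w} : Finset (Fin n)) ∈ Γ.faces)
    {v w t u : Fin n} (hvw : Γ.Adj v w) (htv : Γ.Adj t v) (hut : Γ.Adj u t) : u = v ∨ u = w ∨ Γ.Adj u v ∨ Γ.Adj u w := by
  by_cases hwt : w = t
  · subst hwt; exact Or.inr (Or.inr (Or.inr hut))
  by_cases hf : ({t, v, w} : Finset (Fin n)) ∈ Γ.faces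
  · rcases Γ.tri (hst t) htv.1 (Ne.symm hwt) hvw.1 hf (Γ.adj_symm' hut).2 with ⟨h1, h2⟩ | ⟨h1, h2⟩
    · exact Or.inr (Or.inr (Or.inl (Γ.adj_of_face h1 h2)))
    · exact Or.inr (Or.inr (Or.inr (Γ.adj_of_face h1 h2)))
  · obtain ⟨z, hzt, hzv, hz⟩ := h3 t v htv
    have hz' : ({v, t, z} : Finset (Fin n)) ∈ Γ.faces := by rw [Finset.insert_comm]; exact hz
    rcases Γ.tri (hst v) htv.1.symm hzv.symm hzt.symm hz' hvw.2 with ⟨_, h2⟩ | ⟨hzw, hvwz⟩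
    · exact absurd h2 hf
    · rcases Γ.tri (hst t) htv.1 hzt.symm hzv.symm hz (Γ.adj_symm' hut).2 with ⟨h1, h2⟩ | ⟨h1, h2⟩
      · exact Or.inr (Or.inr (Or.inl (Γ.adj_of_face h1 h2)))
      · have hzu := Γ.adj_symm' (Γ.adj_of_face h1 h2)
        rcases Γ.tri (hst z) hzv hzw hvw.1 hvwz hzu.2 with ⟨h1, h2⟩ | ⟨h1, h2⟩
        · exact Or.inr (Or.inr (Or.inl (Γ.adj_of_face h1 h2)))
        · exact Or.inr (Or.inr (Or.inr (Γ.adj_of_face h1 h2)))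

lemma near (Γ : SimComplex n) (hst : ∀ v, Γ.MG {v})
    (h3 : ∀ u v, Γ.Adj u v → ∃ w, w ≠ u ∧ w ≠ v ∧ ({u, v, w} : Finset (Fin n)) ∈ Γ.faces)
    {v w u : Fin n} (hvw : Γ.Adj v w) (hr : Γ.Reach v u) : u = v ∨ u = w ∨ Γ.Adj u v ∨ Γ.Adj u w := by
  induction hr with
  | refl => exact Or.inl rfl
  | @tail t u _ htu ih =>
    have hut := Γ.adj_symm' htu
    rcases ih with rfl | rfl | h | h
    · exact Or.inr (Or.inr (Or.inl hut))
    · exact Or.inr (Or.inr (Or.inr hut))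
    · exact Γ.near_step hst h3 hvw h hut
    · have := Γ.near_step hst h3 (Γ.adj_symm' hvw) h hut
      tauto

lemma augm (Γ : SimComplex n) (G : Finset (Fin n)) (hG : Γ.MG G) (F : Finset (Fin n)) (hF : F ∈ Γ.faces) (hGF : G ⊆ F) (k : ℕ) :
    ∀ H, H ∈ Γ.faces → G ⊆ H → H.card + k = F.card → ∃ H', H' ∈ Γ.faces ∧ H ⊆ H' ∧ H' ⊆ H ∪ F ∧ H'.card = F.card := by
  induction k with
  | zero => intro H hH _ hc; exact ⟨H, hH, subset_rfl, Finset.subset_union_left, by omega⟩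
  | succ k ih =>
    intro H hH hGH hc
    obtain ⟨i, hi, hiH, h⟩ := hG F H hF hH hGF hGH (by omega)
    obtain ⟨H', h1, h2, h3, h4⟩ := ih (insert i H) h (hGH.trans (Finset.subset_insert _ _)) (by
      rw [Finset.card_insert_of_notMem hiH]; omega)
    refine ⟨H', h1, (Finset.subset_insert _ _).trans h2, h3.trans ?_, h4⟩
    intro x hx
    simp only [Finset.mem_union, Finset.mem_insert] at hx ⊢
    rcases hx with (rfl | hx) | hx
    · exact Or.inr hi
    · exact Or.inl hx
    · exact Or.inr hx

lemma comb_main (Γ : SimComplex n) (hst : ∀ v, Γ.MG {v})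
    (h3 : ∀ u v, Γ.Adj u v → ∃ w, w ≠ u ∧ w ≠ v ∧ ({u, v, w} : Finset (Fin n)) ∈ Γ.faces)
    (hc : Γ.Connected) : Γ.IsMatroid := by
  intro F F' hF hF' hlt
  by_cases h0 : ∃ v, v ∈ F ∧ v ∈ F'
  · obtain ⟨v, hv, hv'⟩ := h0
    exact hst v F F' hF hF' (by simpa using hv) (by simpa using hv') hlt
  push Not at h0
  rcases F'.eq_empty_or_nonempty with rfl | ⟨g, hg⟩
  · obtain ⟨i, hi⟩ := Finset.card_pos.1 (by simpa using hlt)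
    exact ⟨i, hi, by simp, Γ.down_closed hF (by simpa using hi)⟩
  have hgF : g ∉ F := fun h => h0 g h hg
  have hcg := Finset.card_pos.2 ⟨g, hg⟩
  obtain ⟨f1, hf1, f2, hf2, hne⟩ := Finset.one_lt_card.1 (show 1 < F.card by omega)
  have hadj : Γ.Adj f1 f2 := ⟨hne, Γ.down_closed hF (by intro x; simp; rintro (rfl | rfl) <;> assumption)⟩
  have hr : Γ.Reach f1 g := hc f1 (Γ.down_closed hF (by simpa using hf1)) g (Γ.down_closed hF' (by simpa using hg))
  obtain ⟨f, hf, hgf⟩ : ∃ f ∈ F, Γ.Adj g f := by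
    rcases Γ.near hst h3 hadj hr with rfl | rfl | h | h
    · exact absurd hf1 hgF
    · exact absurd hf2 hgF
    · exact ⟨f1, hf1, h⟩
    · exact ⟨f2, hf2, h⟩
  have c2 : ({g, f} : Finset (Fin n)).card ≤ 2 := Finset.card_le_two
  obtain ⟨k, hk⟩ := Nat.exists_eq_add_of_le (show ({g, f} : Finset (Fin n)).card ≤ F.card by omega)
  obtain ⟨H, h1, h2, h4, h5⟩ := Γ.augm {f} (hst f) F hF (by simpa using hf) k {g, f} hgf.2 (by simp) hk.symm
  have hgH : g ∈ H := h2 (by simp)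
  obtain ⟨i, hi, hi', h⟩ := hst g H F' h1 hF' (by simpa using hgH) (by simpa using hg) (by omega)
  refine ⟨i, ?_, hi', h⟩
  have := h4 hi
  simp only [Finset.mem_union, Finset.mem_insert, Finset.mem_singleton] at this
  rcases this with (rfl | rfl) | h
  · exact absurd hg hi'
  · exact hf
  · exact h

lemma MG_of_link (Δ : SimComplex n) (G : Finset (Fin n)) (h : (Δ.link G).IsMatroid) : Δ.MG G := by
  intro F F' hF hF' hGF hGF' hlt
  have c1 := Finset.card_sdiff_add_card_eq_card hGF
  have c2 := Finset.card_sdiff_add_card_eq_card hGF'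
  obtain ⟨i, hi, hi', h2⟩ := h (F \ G) (F' \ G) ⟨Finset.sdiff_disjoint, by rwa [Finset.sdiff_union_of_subset hGF]⟩
    ⟨Finset.sdiff_disjoint, by rwa [Finset.sdiff_union_of_subset hGF']⟩ (by omega)
  rw [Finset.mem_sdiff] at hi
  refine ⟨i, hi.1, fun h => hi' (Finset.mem_sdiff.2 ⟨h, hi.2⟩), ?_⟩
  have := h2.2
  rwa [Finset.insert_union, Finset.sdiff_union_of_subset hGF'] at this

lemma link_MG (Δ : SimComplex n) (G : Finset (Fin n)) (v : Fin n) (h : Δ.MG (insert v G)) : (Δ.link G).MG {v} := by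
  intro F F' hF hF' hvF hvF' hlt
  have c1 := Finset.card_union_of_disjoint hF.1
  have c2 := Finset.card_union_of_disjoint hF'.1
  have hs : ∀ X : Finset (Fin n), {v} ⊆ X → insert v G ⊆ X ∪ G := by
    intro X hX x hx
    rw [Finset.mem_insert] at hx
    rw [Finset.mem_union]
    rcases hx with rfl | hx
    · exact Or.inl (hX (by simp))
    · exact Or.inr hx
  obtain ⟨i, hi, hi', h2⟩ := h _ _ hF.2 hF'.2 (hs F hvF) (hs F' hvF') (by omega)
  simp only [Finset.mem_union, not_or] at hi hi'
  have hiF : i ∈ F := hi.resolve_right hi'.2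
  refine ⟨i, hiF, hi'.1, ?_, ?_⟩
  · rw [Finset.disjoint_insert_left]; exact ⟨hi'.2, hF'.1⟩
  · rw [Finset.insert_union]; exact h2

lemma third (Δ : SimComplex n) (d : ℕ) (hp : ∀ F, Δ.IsFacet F → F.card = d) (X : Finset (Fin n)) (hX : X ∈ Δ.faces)
    (hXd : X.card < d) : ∃ w, w ∉ X ∧ insert w X ∈ Δ.faces := by
  obtain ⟨F, hF, hs⟩ := Δ.exists_facet hX
  obtain ⟨w, hw, hwX⟩ := Finset.exists_mem_notMem_of_card_lt_card (show X.card < F.card by rw [hp F hF]; exact hXd)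
  refine ⟨w, hwX, Δ.down_closed hF.1 ?_⟩
  rw [Finset.insert_subset_iff]
  exact ⟨hw, hs⟩

lemma link_desc (Δ : SimComplex n) (d : ℕ) (hp : ∀ F, Δ.IsFacet F → F.card = d)
    (hconn : ∀ G ∈ Δ.faces, G.Nonempty → G.card + 2 ≤ d → (Δ.link G).Connected)
    (hbase : ∀ G ∈ Δ.faces, G.Nonempty → G.card + 2 = d → (Δ.link G).IsMatroid) (k : ℕ) :
    ∀ G ∈ Δ.faces, G.Nonempty → G.card + 2 + k = d → (Δ.link G).IsMatroid := by
  induction k with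
  | zero => exact hbase
  | succ k ih =>
    intro G hG hne hc
    apply comb_main
    · intro v
      by_cases hv : v ∉ G ∧ insert v G ∈ Δ.faces
      · exact Δ.link_MG G v (Δ.MG_of_link _ (ih _ hv.2 (Finset.insert_nonempty _ _) (by
          rw [Finset.card_insert_of_notMem hv.1]; omega)))
      · intro F F' hF hF' hvF
        have hvF : v ∈ F := hvF (by simp)
        refine absurd ⟨Finset.disjoint_left.1 hF.1 hvF, Δ.down_closed hF.2 ?_⟩ hv
        rw [Finset.insert_subset_iff]
        exact ⟨Finset.mem_union_left _ hvF, Finset.subset_union_right⟩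
    · intro u v huv
      have c1 := Finset.card_union_of_disjoint huv.2.1
      have c2 : ({u, v} : Finset (Fin n)).card ≤ 2 := Finset.card_le_two
      obtain ⟨w, hw, h⟩ := Δ.third d hp _ huv.2.2 (by omega)
      simp only [Finset.mem_union, Finset.mem_insert, Finset.mem_singleton, not_or] at hw
      have e : ({u, v, w} : Finset (Fin n)) = insert w {u, v} := by
        ext x; simp; tauto
      refine ⟨w, hw.1.1, hw.1.2, ?_⟩
      rw [e]
      refine ⟨?_, ?_⟩
      · rw [Finset.disjoint_insert_left]; exact ⟨hw.2, huv.2.1⟩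
      · rw [Finset.insert_union]; exact h
    · exact hconn G hG hne (by omega)

lemma comp_reach (Δ : SimComplex n) (v u : Fin n) (h : Δ.Reach v u) : (Δ.component v).Reach v u := by
  induction h with
  | refl => exact Relation.ReflTransGen.refl
  | @tail t u hvt htu ih =>
    refine Relation.ReflTransGen.tail ih ⟨htu.1, htu.2, ?_⟩
    intro x hx
    have hx : x = t ∨ x = u := by simpa using hx
    rcases hx with rfl | rfl
    · exact hvt
    · exact Relation.ReflTransGen.tail hvt htu

lemma comp_matroid (Δ : SimComplex n) (hV : ∀ i : Fin n, ({i} : Finset (Fin n)) ∈ Δ.faces)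
    (d : ℕ) (hd : 3 ≤ d) (hp : ∀ F, Δ.IsFacet F → F.card = d)
    (hconn : ∀ G ∈ Δ.faces, G.Nonempty → G.card + 2 ≤ d → (Δ.link G).Connected)
    (hbase : ∀ G ∈ Δ.faces, G.Nonempty → G.card + 2 = d → (Δ.link G).IsMatroid) (v : Fin n) :
    (Δ.component v).IsMatroid ∧ (Δ.component v).mc = d := by
  constructor
  · apply comb_main
    · intro u F F' hF hF' huF huF' hlt
      obtain ⟨k, hk⟩ := Nat.exists_eq_add_of_le hd
      obtain ⟨i, hi, hi', h⟩ := Δ.MG_of_link {u} (Δ.link_desc d hp hconn hbase k {u} (hV u) (Finset.singleton_nonempty u)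
        (by simp; omega)) F F' hF.1 hF'.1 huF huF' hlt
      refine ⟨i, hi, hi', h, ?_⟩
      rw [Finset.coe_insert, Set.insert_subset_iff]
      exact ⟨hF.2 hi, hF'.2⟩
    · intro a b hab
      have c2 : ({a, b} : Finset (Fin n)).card ≤ 2 := Finset.card_le_two
      obtain ⟨w, hw, h⟩ := Δ.third d hp _ hab.2.1 (by omega)
      have e : ({a, b, w} : Finset (Fin n)) = insert w {a, b} := by
        ext x; simp; tauto
      simp only [Finset.mem_insert, Finset.mem_singleton, not_or] at hw
      refine ⟨w, hw.1, hw.2, ?_⟩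
      rw [e]
      refine ⟨h, ?_⟩
      intro x hx
      exact Δ.reach_trans' (hab.2.2 (show a ∈ (({a, b} : Finset (Fin n)) : Set (Fin n)) by simp)) (Δ.reach_face h (by simp) hx)
    · intro a ha b hb
      exact reach_trans' _ (reach_symm' _ (Δ.comp_reach v a (ha.2 (by simp)))) (Δ.comp_reach v b (hb.2 (by simp)))
  · obtain ⟨F, hF, hs⟩ := Δ.exists_facet (hV v)
    have hvF : v ∈ F := hs (by simp)
    have h1 : F ∈ (Δ.component v).faces := ⟨hF.1, fun x hx => Δ.reach_face hF.1 hvF hx⟩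
    apply le_antisymm
    · obtain ⟨F', hF', hc⟩ := (Δ.component v).exists_mc h1
      obtain ⟨F2, hF2, hs2⟩ := Δ.exists_facet hF'.1
      rw [← hc, ← hp F2 hF2]
      exact Finset.card_le_card hs2
    · rw [← hp F hF]
      exact (Δ.component v).card_le_mc h1

end SimComplex
end Comb


noncomputable section Fin12
open MvPolynomial
variable {K : Type} [Field K] {n : ℕ}

lemma link_connected (Δ : SimComplex n) (m d : ℕ) (hm : 1 ≤ m)
    (H : ∀ i < d, FDK (R := MvPolynomial (Fin n) K) K (MH K i (SU Δ m))) (hp : ∀ F, Δ.IsFacet F → F.card = d)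
    (G : Finset (Fin n)) (hne : G.Nonempty) (hGd : G.card + 2 ≤ d) : (Δ.link G).Connected := by
  intro u0 hu0 v0 hv0
  by_contra hcon
  obtain ⟨F, hF, hs⟩ := Δ.exists_facet hu0.2
  obtain ⟨F', hF', hs'⟩ := Δ.exists_facet hv0.2
  have hur : ∀ X, Δ.IsFacet X → G ⊆ X → ∀ x ∈ X, ∀ y ∈ X, x ∉ G → y ∉ G → (Δ.link G).Reach x y := by
    intro X hX hGX x hx y hy hxG hyG
    refine SimComplex.reach_face (Δ.link G) (F := X \ G) ⟨Finset.sdiff_disjoint, ?_⟩ (Finset.mem_sdiff.2 ⟨hx, hxG⟩) (Finset.mem_sdiff.2 ⟨hy, hyG⟩)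
    rw [Finset.sdiff_union_of_subset hGX]
    exact hX.1
  have hu0G : u0 ∉ G := Finset.disjoint_singleton_left.1 hu0.1
  have hv0G : v0 ∉ G := Finset.disjoint_singleton_left.1 hv0.1
  have hGF : G ⊆ F := Finset.subset_union_right.trans hs
  have hGF' : G ⊆ F' := Finset.subset_union_right.trans hs'
  have hz : ∀ X : Finset (Fin n), ∑ i ∈ X, (0 : Fin n →₀ ℕ) i < m := by
    intro X
    simp only [Finsupp.coe_zero, Pi.zero_apply, Finset.sum_const_zero]
    omega
  obtain ⟨F1, F2, h1, h2, hG1, hG2, ⟨y, hy, hyG, hyr⟩, hP2, _, _, x, hx1, hx2, hxG⟩ :=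
    partition Δ m d H G hne hGd (fun F hF => by rw [hp F hF]; omega) 0 (fun _ _ => rfl)
    (fun X => ∃ y ∈ X, y ∉ G ∧ (Δ.link G).Reach u0 y) F hF hGF
    ⟨u0, hs (by simp), hu0G, Relation.ReflTransGen.refl⟩ (hz _) F' hF' hGF' (by
      rintro ⟨y, hy, hyG, hr⟩
      exact hcon (SimComplex.reach_trans' _ hr (hur F' hF' hGF' y hy v0 (hs' (by simp)) hyG hv0G))) (hz _)
  exact hP2 ⟨x, hx2, hxG, SimComplex.reach_trans' _ hyr (hur F1 h1 hG1 y hy x hx1 hyG hxG)⟩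

lemma link_base (Δ : SimComplex n) (m d : ℕ) (hm : 3 ≤ m)
    (H : ∀ i < d, FDK (R := MvPolynomial (Fin n) K) K (MH K i (SU Δ m))) (hp : ∀ F, Δ.IsFacet F → F.card = d)
    (G : Finset (Fin n)) (hne : G.Nonempty) (hGd : G.card + 2 = d) : (Δ.link G).IsMatroid := by
  intro F F' hF hF' hlt
  have cF := Finset.card_union_of_disjoint hF.1
  have cd : (F ∪ G).card ≤ d := by
    obtain ⟨X, hX, hs⟩ := Δ.exists_facet hF.2
    rw [← hp X hX]
    exact Finset.card_le_card hs
  rcases F'.eq_empty_or_nonempty with rfl | hne'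
  · obtain ⟨i, hi⟩ := Finset.card_pos.1 (by simpa using hlt)
    exact ⟨i, hi, by simp, (Δ.link G).down_closed hF (by simpa using hi)⟩
  have cp := Finset.card_pos.2 hne'
  have c2 : F.card = 2 := by omega
  have c1 : F'.card = 1 := by omega
  obtain ⟨p, q, hpq, rfl⟩ := Finset.card_eq_two.1 c2
  obtain ⟨o, rfl⟩ := Finset.card_eq_one.1 c1
  by_cases hop : o = p
  · subst hop
    exact ⟨q, by simp, by simpa using hpq.symm, by rw [Finset.pair_comm]; exact hF⟩
  by_cases hoq : o = q
  · subst hoq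
    exact ⟨p, by simp, by simpa using hpq, hF⟩
  have hoG : o ∉ G := Finset.disjoint_singleton_left.1 hF'.1
  have hpG : p ∉ G := Finset.disjoint_left.1 hF.1 (by simp)
  have hqG : q ∉ G := Finset.disjoint_left.1 hF.1 (by simp)
  obtain ⟨X, hX, hsX⟩ := Δ.exists_facet hF'.2
  obtain ⟨Y, hY, hsY⟩ := Δ.exists_facet hF.2
  have hYe : ∀ Y, Δ.IsFacet Y → {p, q} ∪ G ⊆ Y → Y = {p, q} ∪ G := fun Y hY hs =>
    (Finset.eq_of_subset_of_card_le hs (by rw [hp Y hY]; omega)).symm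
  have hoE : o ∉ ({p, q} : Finset (Fin n)) ∪ G := by simp [hop, hoq, hoG]
  let a : Fin n →₀ ℕ := Finsupp.single o (m - 1) + (Finsupp.single p 1 + Finsupp.single q 1)
  have hsum : ∀ Z : Finset (Fin n), ∑ i ∈ Z, a i = (if o ∈ Z then m - 1 else 0) + ((if p ∈ Z then 1 else 0) + (if q ∈ Z then 1 else 0)) := by
    intro Z
    simp only [a, Finsupp.add_apply, Finset.sum_add_distrib, Finsupp.single_apply, Finset.sum_ite_eq]
  have hoX : o ∈ X := hsX (by simp)
  obtain ⟨F1, F2, h1, h2, hG1, hG2, hP1, hP2, _, hw, x, hx1, hx2, hxG⟩ :=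
    partition Δ m d H G hne (by omega) (fun F hF => by rw [hp F hF]; omega) a (by
      intro v hv
      have e1 : o ≠ v := fun e => hoG (e ▸ hv)
      have e2 : p ≠ v := fun e => hpG (e ▸ hv)
      have e3 : q ≠ v := fun e => hqG (e ▸ hv)
      simp [a, Finsupp.single_apply, e1, e2, e3])
    (fun X => o ∈ X) X hX (Finset.subset_union_right.trans hsX) hoX (by
      rw [hsum, if_neg (by simpa using hoX)]
      split_ifs <;> omega) Y hY (Finset.subset_union_right.trans hsY) (by rw [hYe Y hY hsY]; exact hoE) (by
      have hpY : p ∈ Y := hsY (by simp)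
      have hqY : q ∈ Y := hsY (by simp)
      rw [hsum, if_neg (show p ∉ Yᶜ by simpa using hpY), if_neg (show q ∉ Yᶜ by simpa using hqY)]
      split_ifs <;> omega)
  rw [hsum, if_pos (Finset.mem_compl.2 hP2)] at hw
  have hp2 : p ∈ F2 := by
    by_contra hh
    rw [if_pos (Finset.mem_compl.2 hh)] at hw
    omega
  have hq2 : q ∈ F2 := by
    by_contra hh
    rw [if_pos (Finset.mem_compl.2 hh)] at hw
    omega
  have hF2 := hYe F2 h2 (by
    intro y hy
    simp only [Finset.mem_union, Finset.mem_insert, Finset.mem_singleton] at hy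
    rcases hy with (rfl | rfl) | hy
    · exact hp2
    · exact hq2
    · exact hG2 hy)
  rw [hF2, Finset.mem_union] at hx2
  have hxF := hx2.resolve_right hxG
  have hxo : x ≠ o := by
    rintro rfl
    exact hoE (Finset.mem_union_left _ hxF)
  refine ⟨x, hxF, by simpa using hxo, ?_, Δ.down_closed h1.1 ?_⟩
  · rw [Finset.disjoint_insert_left, Finset.disjoint_singleton_left]
    exact ⟨hxG, hoG⟩
  · intro y hy
    simp only [Finset.mem_union, Finset.mem_insert, Finset.mem_singleton] at hy
    rcases hy with (rfl | rfl) | hy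
    · exact hx1
    · exact hP1
    · exact hG1 hy

lemma ii_iii (Δ : SimComplex n) (hV : ∀ i : Fin n, ({i} : Finset (Fin n)) ∈ Δ.faces) (h3 : 3 ≤ Δ.mc)
    (hne : ∃ G, G ∈ Δ.faces) (m : ℕ) (hm : 3 ≤ m) (h : IsGeneralizedCM K (SRSymbPow K Δ m)) (v : Fin n) :
    (Δ.component v).IsMatroid ∧ (Δ.component v).mc = Δ.mc := by
  obtain ⟨G0, hG0⟩ := hne
  obtain ⟨F0, hF0, hc0⟩ := Δ.exists_mc hG0
  have hkd := kd_ge (K := K) Δ m (by omega) F0 (Δ.facet_of_card hF0 hc0)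
  have H : ∀ i < Δ.mc, FDK (R := MvPolynomial (Fin n) K) K (MH K i (SU Δ m)) := by
    intro i hi
    have := h i (lt_of_lt_of_le (by rw [hc0]; exact_mod_cast hi) hkd)
    rw [SR_eq] at this
    exact this
  have hp : ∀ F, Δ.IsFacet F → F.card = Δ.mc := by
    intro F hF
    refine le_antisymm (Δ.card_le_mc hF.1) (purity Δ m _ (by omega) H F ?_ hF)
    rw [Finset.nonempty_iff_ne_empty]
    rintro rfl
    have := hF.2 F0 hF0 (Finset.empty_subset _)
    subst this
    simp at hc0
    omega
  exact Δ.comp_matroid hV _ h3 hp (fun G _ hne hd => link_connected Δ m _ (by omega) H hp G hne hd)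
    (fun G _ hne hd => link_base Δ m _ hm H hp G hne hd) v

end Fin12

theorem symbolic_powers_genCM_iff_union_of_matroids (K : Type) [Field K] {n : ℕ}
    (Δ : SimComplex n)
    (hV : ∀ i : Fin n, ({i} : Finset (Fin n)) ∈ Δ.faces) (hdim : 2 ≤ Δ.dim) :
    List.TFAE
      [∀ m : ℕ, 1 ≤ m → IsGeneralizedCM K (SRSymbPow K Δ m),
       ∃ m : ℕ, 3 ≤ m ∧ IsGeneralizedCM K (SRSymbPow K Δ m),
       (∀ v ∈ Δ.vertexSet, (Δ.component v).IsMatroid) ∧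
         (∀ u ∈ Δ.vertexSet, ∀ v ∈ Δ.vertexSet, (Δ.component u).dim = (Δ.component v).dim)] := by
  have h3 : 3 ≤ Δ.mc := by
    rw [SimComplex.dim_eq] at hdim
    omega
  have hne : ∃ G, G ∈ Δ.faces := by
    by_contra hcon
    push Not at hcon
    have : Δ.mc = 0 := by
      unfold SimComplex.mc
      have : Finset.card '' Δ.faces = ∅ := by
        rw [Set.image_eq_empty]
        exact Set.eq_empty_of_forall_notMem hcon
      rw [this]
      simp
    omega
  tfae_have 1 → 2 := fun h => ⟨3, le_rfl, h 3 (by omega)⟩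
  tfae_have 2 → 3 := by
    rintro ⟨m, hm, h⟩
    have key := ii_iii Δ hV h3 hne m hm h
    refine ⟨fun v _ => (key v).1, fun u _ v _ => ?_⟩
    rw [SimComplex.dim_eq, SimComplex.dim_eq, (key u).2, (key v).2]
  tfae_have 3 → 1 := by
    rintro ⟨h1, h2⟩ m _
    refine iii_i Δ hV h3 (fun v => h1 v (hV v)) (fun u v => ?_) m
    have := h2 u (hV u) v (hV v)
    rw [SimComplex.dim_eq, SimComplex.dim_eq] at this
    omega
  tfae_finish
end

section
/- Let Δ be a simplicial complex on [n] with dim Δ ≥ 1. If the symbolic power I_Δ^{(m)} is quasi-Buchsbaum for some m ≥ 2, then Δ is connected. -/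
open CategoryTheory Opposite

noncomputable section
namespace QB
open Limits
variable {R : Type} [CommRing R]

abbrev Fn (M : ModuleCat.{0} R) : ModuleCat.{0} R ⥤ (ModuleCat.{0} R)ᵒᵖ :=
  ((linearYoneda R (ModuleCat.{0} R)).obj M).rightOp

abbrev Kc {X : ModuleCat.{0} R} (P : ProjectiveResolution X) (M : ModuleCat.{0} R) :
    ChainComplex (ModuleCat.{0} R)ᵒᵖ ℕ :=
  ((Fn M).mapHomologicalComplex _).obj P.complex

def kk {X : ModuleCat.{0} R} (P : ProjectiveResolution X) (M : ModuleCat.{0} R)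
    (z : P.complex.X 1 ⟶ M) : (Kc P M).X 1 ⟶ op (ModuleCat.of R R) :=
  (ModuleCat.ofHom (LinearMap.toSpanSingleton R (P.complex.X 1 ⟶ M) z)).op

lemma kk_eq {X : ModuleCat.{0} R} (P : ProjectiveResolution X) (M : ModuleCat.{0} R)
    (z : P.complex.X 1 ⟶ M) (hz : P.complex.d 2 1 ≫ z = 0) :
    (Kc P M).d 2 1 ≫ kk P M z = 0 := by
  apply Quiver.Hom.unop_inj
  apply ModuleCat.hom_ext
  apply LinearMap.ext_ring
  change P.complex.d 2 1 ≫ ((1 : R) • z) = 0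
  rw [one_smul, hz]

def isoK {X : ModuleCat.{0} R} (P : ProjectiveResolution X) (M : ModuleCat.{0} R) :
    ((Fn M).leftDerived 1).obj X ≅ (Kc P M).homology 1 := P.isoLeftDerivedObj (Fn M) 1

lemma isoK_nat {X Y : ModuleCat.{0} R} (f : X ⟶ Y) (P : ProjectiveResolution X)
    (Q : ProjectiveResolution Y) (φ : P.complex ⟶ Q.complex)
    (comm : φ.f 0 ≫ Q.π.f 0 = P.π.f 0 ≫ f) (M : ModuleCat.{0} R) :
    ((Fn M).leftDerived 1).map f ≫ (isoK Q M).hom = (isoK P M).hom ≫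
      HomologicalComplex.homologyMap (((Fn M).mapHomologicalComplex _).map φ) 1 :=
  ProjectiveResolution.isoLeftDerivedObj_hom_naturality f P Q φ comm (Fn M) 1

def cls {X : ModuleCat.{0} R} (P : ProjectiveResolution X) (M : ModuleCat.{0} R)
    (z : P.complex.X 1 ⟶ M) (hz : P.complex.d 2 1 ≫ z = 0) :
    ModuleCat.of R R ⟶ ((Ext R (ModuleCat.{0} R) 1).obj (op X)).obj M :=
  ((isoK P M).hom ≫ (Kc P M).homologyι 1 ≫
    (Kc P M).descOpcycles (kk P M z) 2 (by simp) (kk_eq P M z hz)).unop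

lemma cls_nat {X Y : ModuleCat.{0} R} (f : X ⟶ Y) (P : ProjectiveResolution X)
    (Q : ProjectiveResolution Y) (φ : P.complex ⟶ Q.complex)
    (comm : φ.f 0 ≫ Q.π.f 0 = P.π.f 0 ≫ f) (M : ModuleCat.{0} R)
    (z : Q.complex.X 1 ⟶ M) (hz : Q.complex.d 2 1 ≫ z = 0) :
    cls Q M z hz ≫ ((Ext R (ModuleCat.{0} R) 1).map f.op).app M =
      cls P M (φ.f 1 ≫ z) (by rw [← φ.comm_assoc, hz, comp_zero]) := by
  apply Quiver.Hom.op_inj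
  have e := isoK_nat f P Q φ comm M
  change ((Fn M).leftDerived 1).map f ≫ ((isoK Q M).hom ≫ (Kc Q M).homologyι 1 ≫
    (Kc Q M).descOpcycles (kk Q M z) 2 _ _) = (isoK P M).hom ≫ (Kc P M).homologyι 1 ≫
    (Kc P M).descOpcycles (kk P M (φ.f 1 ≫ z)) 2 _ _
  rw [reassoc_of% e]
  congr 1
  rw [HomologicalComplex.homologyι_naturality_assoc]
  congr 1
  rw [HomologicalComplex.opcyclesMap_comp_descOpcycles]
  congr 1

lemma cls_smul {X : ModuleCat.{0} R} (P : ProjectiveResolution X) (M : ModuleCat.{0} R)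
    (z : P.complex.X 1 ⟶ M) (hz : P.complex.d 2 1 ≫ z = 0) (r : R) :
    ModuleCat.ofHom (LinearMap.toSpanSingleton R R r) ≫ cls P M z hz =
      cls P M (r • z) (by simp [hz]) := by
  apply Quiver.Hom.op_inj
  change ((isoK P M).hom ≫ (Kc P M).homologyι 1 ≫
    (Kc P M).descOpcycles (kk P M z) 2 _ _) ≫ (ModuleCat.ofHom (LinearMap.toSpanSingleton R R r)).op
     = (isoK P M).hom ≫ (Kc P M).homologyι 1 ≫
    (Kc P M).descOpcycles (kk P M (r • z)) 2 _ _
  simp only [Category.assoc]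
  congr 1
  refine congrArg (fun q => _ ≫ q) ?_
  rw [HomologicalComplex.descOpcycles_comp]
  congr 1
  apply Quiver.Hom.unop_inj
  apply ModuleCat.hom_ext
  apply LinearMap.ext_ring
  change ((1 : R) • r) • z = (1 : R) • (r • z)
  simp

lemma cls_zero {X : ModuleCat.{0} R} (P : ProjectiveResolution X) (M : ModuleCat.{0} R)
    (z : P.complex.X 1 ⟶ M) (hz : P.complex.d 2 1 ≫ z = 0) (h : cls P M z hz = 0) :
    ∃ g : P.complex.X 0 ⟶ M, P.complex.d 1 0 ≫ g = z := by
  have h1 : (isoK P M).hom ≫ (Kc P M).homologyι 1 ≫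
    (Kc P M).descOpcycles (kk P M z) 2 (by simp) (kk_eq P M z hz) = 0 := congrArg Quiver.Hom.op h
  have h2 : (Kc P M).homologyι 1 ≫
      (Kc P M).descOpcycles (kk P M z) 2 (by simp) (kk_eq P M z hz) = 0 := by
    rw [← cancel_epi (isoK P M).hom, comp_zero]; exact h1
  let S : ShortComplex (ModuleCat.{0} R)ᵒᵖ := ShortComplex.mk ((Kc P M).homologyι 1)
    ((Kc P M).fromOpcycles 1 0) (by simp)
  have hS : S.Exact := S.exact_of_f_is_kernel ((Kc P M).homologyIsKernel 1 0 (by simp))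
  have : Injective (op (ModuleCat.of R R)) := by
    have : Projective (ModuleCat.of R R) := inferInstance
    infer_instance
  let k := hS.descToInjective ((Kc P M).descOpcycles (kk P M z) 2 (by simp) (kk_eq P M z hz)) h2
  have hk : (Kc P M).fromOpcycles 1 0 ≫ k = _ := hS.comp_descToInjective _ h2
  have hk2 : (Kc P M).d 1 0 ≫ k = kk P M z := by
    rw [← HomologicalComplex.p_fromOpcycles, Category.assoc, hk, HomologicalComplex.p_descOpcycles]
  refine ⟨k.unop.hom (1 : R), ?_⟩
  have := congrArg (fun q => q.unop.hom (1 : R)) hk2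
  change P.complex.d 1 0 ≫ (k.unop.hom (1 : R)) = (1 : R) • z at this
  rw [this, one_smul]


lemma coh_key (J : Ideal R) (M : Type) [AddCommGroup M] [Module R M] (x : R)
    (hann : ∀ y : (localCohomology J 1).obj (ModuleCat.of R M), x • y = 0)
    (t : ℕ) (φ : ↥(J ^ t) →ₗ[R] M) :
    ∃ s, ∃ hst : t ≤ s, ∃ c : M, ∀ f (hf : f ∈ J ^ s),
      x • φ ⟨f, Ideal.pow_le_pow_right hst hf⟩ = f • c := by
  let D := localCohomology.idealPowersDiagram J
  let XX (t : ℕ) : ModuleCat.{0} R := ModuleCat.of R (R ⧸ J ^ t)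
  let mk (t : ℕ) : ModuleCat.of R R ⟶ XX t := ModuleCat.ofHom (Submodule.mkQ (J ^ t))
  have hmk (t : ℕ) : Epi (mk t) := (ModuleCat.epi_iff_surjective _).2 (Submodule.mkQ_surjective _)
  let P (t : ℕ) : ProjectiveResolution (XX t) := projectiveResolution (XX t)
  let pp (t : ℕ) : (P t).complex.X 0 ⟶ XX t := (P t).π.f 0
  have hpe (t : ℕ) : Epi (pp t) := inferInstanceAs (Epi ((P t).π.f 0))
  have hd (t : ℕ) : (P t).complex.d 1 0 ≫ pp t = 0 := (P t).complex_d_comp_π_f_zero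
  have : Projective ((P t).complex.X 0) := (P t).projective 0
  let u : (P t).complex.X 0 ⟶ ModuleCat.of R R := Projective.factorThru (pp t) (mk t)
  have hu : u ≫ mk t = pp t := Projective.factorThru_comp _ _
  have hdu (a : (P t).complex.X 1) : u.hom (((P t).complex.d 1 0).hom a) ∈ J ^ t := by
    have h1 : (P t).complex.d 1 0 ≫ u ≫ mk t = 0 := by rw [hu, hd]
    have h2 := congrArg (fun q => q.hom a) h1
    exact (Submodule.Quotient.mk_eq_zero _).1 h2
  let z : (P t).complex.X 1 ⟶ ModuleCat.of R M :=
    ModuleCat.ofHom (φ ∘ₗ LinearMap.codRestrict (J ^ t) (u.hom ∘ₗ ((P t).complex.d 1 0).hom) hdu)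
  have hz : (P t).complex.d 2 1 ≫ z = 0 := by
    apply ModuleCat.hom_ext
    ext b
    change φ ⟨u.hom (((P t).complex.d 1 0).hom (((P t).complex.d 2 1).hom b)), _⟩ = 0
    have h2 := congrArg (fun q => q.hom b) ((P t).complex.d_comp_d 2 1 0)
    change ((P t).complex.d 1 0).hom (((P t).complex.d 2 1).hom b) = 0 at h2
    convert φ.map_zero
    rw [h2, map_zero]; rfl
  let e := (cls (P t) (ModuleCat.of R M) z hz).hom (1 : R)
  have := localCohomology.hasColimitDiagram D 1
  let ev := (evaluation (ModuleCat.{0} R) (ModuleCat.{0} R)).obj (ModuleCat.of R M)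
  let hc := isColimitOfPreserves ev (colimit.isColimit (localCohomology.diagram D 1))
  have h0 : ((colimit.ι (localCohomology.diagram D 1) (op (op t))).app (ModuleCat.of R M)).hom (x • e) = 0 :=
    (LinearMap.map_smul _ _ _).trans
      (hann (((colimit.ι (localCohomology.diagram D 1) (op (op t))).app (ModuleCat.of R M)).hom e))
  obtain ⟨k, f, g, hfg⟩ := Concrete.isColimit_exists_of_rep_eq (localCohomology.diagram D 1 ⋙ ev) hc
    (i := op (op t)) (j := op (op t)) (x • e) (0 : _) (h0.trans (map_zero _).symm)
  have hfg0 := hfg.trans (map_zero _)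
  obtain ⟨⟨s⟩⟩ := k
  have hst : t ≤ s := leOfHom f.unop.unop
  let w : XX s ⟶ XX t := (localCohomology.ringModIdeals D).map f.unop
  have hw : mk s ≫ w = mk t := rfl
  let ψ := ProjectiveResolution.lift w (P s) (P t)
  have hψ : ψ.f 0 ≫ (P t).π.f 0 = (P s).π.f 0 ≫ w := ProjectiveResolution.lift_commutes_zero w _ _
  have hnat := cls_nat w (P s) (P t) ψ hψ (ModuleCat.of R M) (x • z) (by simp [hz])
  have hz0 : cls (P s) (ModuleCat.of R M) (ψ.f 1 ≫ (x • z))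
      (by rw [← ψ.comm_assoc]; simp [hz]) = 0 := by
    rw [← hnat, ← cls_smul _ _ _ hz]
    apply ModuleCat.hom_ext
    apply LinearMap.ext_ring
    refine Eq.trans ?_ hfg0
    change (((Ext R (ModuleCat.{0} R) 1).map w.op).app (ModuleCat.of R M)).hom
      ((cls (P t) (ModuleCat.of R M) z hz).hom ((1 : R) • x)) =
      (((Ext R (ModuleCat.{0} R) 1).map w.op).app (ModuleCat.of R M)).hom (x • e)
    congr 1
    change _ = x • (cls (P t) (ModuleCat.of R M) z hz).hom (1 : R)
    rw [← map_smul]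
    simp
  obtain ⟨h, hh⟩ := cls_zero _ _ _ _ hz0
  have hv0 : Projective (ModuleCat.of R R) := inferInstance
  let v : ModuleCat.of R R ⟶ (P s).complex.X 0 := Projective.factorThru (mk s) (pp s)
  have hv : v ≫ pp s = mk s := Projective.factorThru_comp _ _
  have huv : (v ≫ ψ.f 0 ≫ u) ≫ mk t = mk t := by
    simp only [Category.assoc, hu]
    change v ≫ (ψ.f 0 ≫ (P t).π.f 0) = _
    rw [hψ, ← hw, ← hv]
    exact (Category.assoc v (pp s) w).symm
  let q : R := u.hom ((ψ.f 0).hom (v.hom (1 : R)))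
  have hq : q - 1 ∈ J ^ t := by
    have h2 := congrArg (fun q => q.hom (1 : R)) huv
    exact (Submodule.Quotient.eq _).1 h2
  refine ⟨s, hst, h.hom (v.hom (1 : R)) - x • φ ⟨q - 1, hq⟩, fun f hf => ?_⟩
  have hvf : (pp s).hom (v.hom f) = 0 := by
    have h2 := congrArg (fun q => q.hom f) hv
    exact h2.trans ((Submodule.Quotient.mk_eq_zero _).2 hf)
  obtain ⟨a, ha⟩ : ∃ a, ((P s).complex.d 1 0).hom a = v.hom f := by
    have hex := (P s).exact₀
    exact (ShortComplex.moduleCat_exact_iff _).1 hex (v.hom f) hvf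
  have hvf1 : v.hom f = f • v.hom (1 : R) := by
    rw [← map_smul]; simp
  have h3 : h.hom (v.hom f) = x • φ ⟨f * q, Ideal.mul_mem_right _ _ (Ideal.pow_le_pow_right hst hf)⟩ := by
    have h2 := congrArg (fun q => q.hom a) hh
    change h.hom (((P s).complex.d 1 0).hom a) =
      x • φ ⟨u.hom (((P t).complex.d 1 0).hom ((ψ.f 1).hom a)), _⟩ at h2
    rw [ha] at h2
    rw [h2]
    congr 2
    apply Subtype.ext
    have h4 := congrArg (fun q => q.hom a) (ψ.comm 1 0)
    change ((P t).complex.d 1 0).hom ((ψ.f 1).hom a) = (ψ.f 0).hom (((P s).complex.d 1 0).hom a) at h4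
    change u.hom _ = f * q
    rw [h4, ha, hvf1]
    simp [q]
  have hf' := Ideal.pow_le_pow_right hst hf
  have h5 : φ ⟨f * q, Ideal.mul_mem_right _ _ hf'⟩ = φ ⟨f, hf'⟩ + f • φ ⟨q - 1, hq⟩ := by
    rw [← map_smul, ← map_add]
    congr 1
    apply Subtype.ext
    change f * q = f + f * (q - 1)
    ring
  rw [hvf1, map_smul, h5] at h3
  rw [smul_sub, h3, smul_comm f x, smul_add]
  abel


lemma exists_phi (I₁ I₂ L : Ideal R) (hL : L ≤ I₁ ⊔ I₂) :
    ∃ φ : ↥L →ₗ[R] (R ⧸ (I₁ ⊓ I₂)), ∀ (f : L) (c : R), φ f = Submodule.Quotient.mk c →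
      c ∈ I₁ ∧ (f : R) - c ∈ I₂ := by
  let j : (R ⧸ (I₁ ⊓ I₂)) →ₗ[R] (R ⧸ I₁) × (R ⧸ I₂) :=
    Submodule.liftQ (I₁ ⊓ I₂) ((Submodule.mkQ I₁).prod (Submodule.mkQ I₂)) (by
      intro a ha
      simp only [LinearMap.mem_ker, LinearMap.prod_apply, Function.prod_apply, Prod.mk_eq_zero]
      exact ⟨(Submodule.Quotient.mk_eq_zero _).2 ha.1, (Submodule.Quotient.mk_eq_zero _).2 ha.2⟩)
  have hj (c : R) : j (Submodule.Quotient.mk c) =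
    (Submodule.Quotient.mk c, Submodule.Quotient.mk c) := rfl
  have hinj : Function.Injective j := by
    rw [← LinearMap.ker_eq_bot, LinearMap.ker_eq_bot']
    intro a ha
    obtain ⟨c, rfl⟩ := Submodule.Quotient.mk_surjective _ a
    rw [hj, Prod.mk_eq_zero, Submodule.Quotient.mk_eq_zero, Submodule.Quotient.mk_eq_zero] at ha
    exact (Submodule.Quotient.mk_eq_zero _).2 ha
  let g : ↥L →ₗ[R] (R ⧸ I₁) × (R ⧸ I₂) := (LinearMap.inr R _ _) ∘ₗ (Submodule.mkQ I₂) ∘ₗ L.subtype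
  have hg (f : L) : g f ∈ LinearMap.range j := by
    obtain ⟨a, ha, b, hb, hab⟩ := Submodule.mem_sup.1 (hL f.2)
    refine ⟨Submodule.Quotient.mk a, ?_⟩
    rw [hj]
    refine Prod.ext ((Submodule.Quotient.mk_eq_zero _).2 ha) ?_
    refine (Submodule.Quotient.eq _).2 ?_
    change a - (f : R) ∈ I₂
    rw [← hab]
    simpa using hb
  refine ⟨(LinearEquiv.ofInjective j hinj).symm.toLinearMap ∘ₗ g.codRestrict _ hg, ?_⟩
  intro f c hc
  have h1 : (⟨g f, hg f⟩ : LinearMap.range j) = LinearEquiv.ofInjective j hinj (Submodule.Quotient.mk c) :=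
    (LinearEquiv.symm_apply_eq _).1 hc
  have h2 : g f = j (Submodule.Quotient.mk c) := congrArg Subtype.val h1
  rw [hj] at h2
  refine ⟨(Submodule.Quotient.mk_eq_zero _).1 (congrArg Prod.fst h2).symm, ?_⟩
  exact (Submodule.Quotient.eq _).1 (congrArg Prod.snd h2)

lemma alg_key (J I₁ I₂ : Ideal R) (x : R)
    (hann : ∀ y : (localCohomology J 1).obj (ModuleCat.of R (R ⧸ (I₁ ⊓ I₂))), x • y = 0)
    (t : ℕ) (ht : J ^ t ≤ I₁ ⊔ I₂)
    (s₁ : ∀ s c, (∀ f ∈ J ^ s, c * f ∈ I₁) → c ∈ I₁)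
    (s₂ : ∀ s c, (∀ f ∈ J ^ s, c * f ∈ I₂) → c ∈ I₂) : x ∈ I₁ ⊔ I₂ := by
  obtain ⟨φ, hφ⟩ := exists_phi I₁ I₂ (J ^ t) ht
  obtain ⟨s, hst, c, hc⟩ := coh_key J _ x hann t φ
  obtain ⟨c, rfl⟩ := Submodule.Quotient.mk_surjective _ c
  have key (f : R) (hf : f ∈ J ^ s) : c * f ∈ I₁ ∧ (x - c) * f ∈ I₂ := by
    have hf' := Ideal.pow_le_pow_right hst hf
    obtain ⟨d, hd⟩ := Submodule.Quotient.mk_surjective _ (φ ⟨f, hf'⟩)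
    obtain ⟨h1, h2⟩ := hφ _ _ hd.symm
    have h3 := hc f hf
    rw [← hd] at h3
    have h4 : x * d - f * c ∈ I₁ ⊓ I₂ := (Submodule.Quotient.eq _).1 h3
    constructor
    · have : c * f = x * d - (x * d - f * c) := by ring
      rw [this]
      exact I₁.sub_mem (I₁.mul_mem_left _ h1) h4.1
    · have : (x - c) * f = x * (f - d) + (x * d - f * c) := by ring
      rw [this]
      exact I₂.add_mem (I₂.mul_mem_left _ h2) h4.2
  have := Submodule.add_mem_sup (s₁ s c fun f hf => (key f hf).1) (s₂ s (x - c) fun f hf => (key f hf).2)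
  simpa using this

section poly
open MvPolynomial
variable {K : Type} [Field K] {n : ℕ}

lemma X_mem_PF {G : Finset (Fin n)} {i : Fin n} (hi : i ∈ G) :
    (X i : MvPolynomial (Fin n) K) ∈ PF K G :=
  Ideal.subset_span (Set.mem_image_of_mem _ hi)

lemma X_mem_max (i : Fin n) : (X i : MvPolynomial (Fin n) K) ∈ maxIdeal K n :=
  Ideal.subset_span (Set.mem_range_self i)

lemma mem_PF_pow (G : Finset (Fin n)) (m : ℕ) (p : MvPolynomial (Fin n) K) :
    p ∈ (PF K G) ^ m ↔ ∀ d ∈ p.support, m ≤ ∑ i ∈ G, d i := by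
  constructor
  · induction m generalizing p with
    | zero => simp
    | succ m ih =>
      intro hp
      rw [pow_succ] at hp
      refine Submodule.mul_induction_on hp ?_ ?_
      · intro a ha b hb d hd
        obtain ⟨d1, h1, d2, h2, rfl⟩ := Finset.mem_add.1 (support_mul a b hd)
        obtain ⟨i, hi, hdi⟩ := (mem_ideal_span_X_image.1 hb) d2 h2
        have h3 := ih a ha d1 h1
        have h4 : d2 i ≤ ∑ i ∈ G, d2 i := Finset.single_le_sum (fun _ _ => Nat.zero_le _) hi
        simp only [Finsupp.add_apply, Finset.sum_add_distrib]
        omega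
      · intro a b ha hb d hd
        rcases Finset.mem_union.1 (support_add hd) with h | h
        · exact ha d h
        · exact hb d h
  · intro h
    rw [p.as_sum]
    refine Ideal.sum_mem _ fun d hd => ?_
    rw [monomial_eq, Finsupp.prod_fintype _ _ (by simp), ← Finset.prod_mul_prod_compl G]
    refine Ideal.mul_mem_left _ _ (Ideal.mul_mem_right _ _ ?_)
    refine Ideal.pow_le_pow_right (h d hd) ?_
    rw [← Finset.prod_pow_eq_pow_sum]
    refine Ideal.prod_mem_prod fun i hi => Ideal.pow_mem_pow (X_mem_PF hi) _

lemma maxIdeal_eq : maxIdeal K n = PF K (Finset.univ : Finset (Fin n)) := by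
  simp [maxIdeal, PF]

lemma PF_sat (G : Finset (Fin n)) (m s : ℕ) (i : Fin n) (hi : i ∉ G) (c : MvPolynomial (Fin n) K)
    (h : c * X i ^ s ∈ (PF K G) ^ m) : c ∈ (PF K G) ^ m := by
  rw [mem_PF_pow] at h ⊢
  intro d hd
  have h1 := h (d + Finsupp.single i s) (by
    rw [X_pow_eq_monomial, mem_support_iff, coeff_mul_monomial, mul_one]
    exact mem_support_iff.1 hd)
  refine h1.trans (Finset.sum_le_sum fun j hj => ?_)
  have : i ≠ j := fun e => hi (e ▸ hj)
  simp [this]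

lemma PF_mono {G H : Finset (Fin n)} (h : G ⊆ H) : PF K G ≤ PF K H :=
  Ideal.span_mono (Set.image_mono (Finset.coe_subset.2 h))

def IW (K : Type) [Field K] (Δ : SimComplex n) (m : ℕ) (W : Set (Fin n)) :
    Ideal (MvPolynomial (Fin n) K) :=
  ⨅ (F : Finset (Fin n)) (_ : Δ.IsFacet F ∧ (F : Set (Fin n)) ⊆ W), (PF K Fᶜ) ^ m

lemma mem_IW {Δ : SimComplex n} {m : ℕ} {W : Set (Fin n)} {p : MvPolynomial (Fin n) K} :
    p ∈ IW K Δ m W ↔ ∀ F, Δ.IsFacet F → (F : Set (Fin n)) ⊆ W → p ∈ (PF K Fᶜ) ^ m := by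
  simp [IW, Submodule.mem_iInf]

lemma exists_facet (Δ : SimComplex n) (G : Finset (Fin n)) (hG : G ∈ Δ.faces) :
    ∃ F, Δ.IsFacet F ∧ G ⊆ F := by
  obtain ⟨F, hGF, hF⟩ := (Set.toFinite Δ.faces).exists_le_maximal hG
  exact ⟨F, ⟨hF.1, fun H hH hFH => le_antisymm hFH (hF.2 hH hFH)⟩, hGF⟩

lemma facet_nonempty {Δ : SimComplex n} (hV : ∀ i : Fin n, ({i} : Finset (Fin n)) ∈ Δ.faces)
    (i : Fin n) {F : Finset (Fin n)} (hF : Δ.IsFacet F) : F.Nonempty := by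
  by_contra h
  rw [Finset.not_nonempty_iff_eq_empty] at h
  have := hF.2 _ (hV i) (by simp [h])
  simp [h] at this

lemma IW_sat {Δ : SimComplex n} (hV : ∀ i : Fin n, ({i} : Finset (Fin n)) ∈ Δ.faces)
    (i : Fin n) (m : ℕ) (W : Set (Fin n)) (s : ℕ) (c : MvPolynomial (Fin n) K)
    (h : ∀ f ∈ (maxIdeal K n) ^ s, c * f ∈ IW K Δ m W) : c ∈ IW K Δ m W := by
  rw [mem_IW]
  intro F hF hFW
  obtain ⟨j, hj⟩ := facet_nonempty hV i hF
  refine PF_sat _ m s j (by simpa using hj) c ?_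
  exact mem_IW.1 (h _ (Ideal.pow_mem_pow (X_mem_max j) _)) F hF hFW

lemma IW_le {Δ : SimComplex n} (hV : ∀ i : Fin n, ({i} : Finset (Fin n)) ∈ Δ.faces)
    {m : ℕ} (hm : 2 ≤ m) {W : Set (Fin n)} (i : Fin n)
    (hW : ∀ F, Δ.IsFacet F → i ∈ F → (F : Set (Fin n)) ⊆ W) : IW K Δ m W ≤ (maxIdeal K n) ^ 2 := by
  intro p hp
  obtain ⟨F, hF, hiF⟩ := exists_facet Δ _ (hV i)
  have := mem_IW.1 hp F hF (hW F hF (by simpa using hiF))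
  rw [maxIdeal_eq]
  exact Ideal.pow_right_mono (PF_mono (Finset.subset_univ _)) _ (Ideal.pow_le_pow_right hm this)

lemma X_pow_mem_IW {Δ : SimComplex n} (m : ℕ) {W : Set (Fin n)} (i : Fin n) (hi : i ∉ W) :
    (X i : MvPolynomial (Fin n) K) ^ m ∈ IW K Δ m W := by
  rw [mem_IW]
  intro F hF hFW
  refine Ideal.pow_mem_pow (X_mem_PF ?_) _
  simpa using fun h => hi (hFW h)

lemma dim_lt (Δ : SimComplex n) (hdim : 1 ≤ Δ.dim) (m : ℕ) (hm : 2 ≤ m) :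
    ((1 : ℕ) : WithBot ℕ∞) < ringKrullDim (MvPolynomial (Fin n) K ⧸ SRSymbPow K Δ m) := by
  have h2 : 2 ≤ sSup (Finset.card '' Δ.faces) := by
    simp only [SimComplex.dim, Int.ofNat_eq_natCast] at hdim
    omega
  have hne : (Finset.card '' Δ.faces).Nonempty := by
    by_contra h
    rw [Set.not_nonempty_iff_eq_empty] at h
    simp [h] at h2
  obtain ⟨G, hG, hGc⟩ := Nat.sSup_mem hne ((Set.toFinite Δ.faces).image _).bddAbove
  obtain ⟨F, hF, hGF⟩ := exists_facet Δ G hG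
  have hFc : 2 ≤ F.card := (h2.trans hGc.symm.le).trans (Finset.card_le_card hGF)
  classical
  let g : MvPolynomial (Fin n) K →ₐ[K] MvPolynomial F K :=
    aeval fun i => if h : i ∈ F then X ⟨i, h⟩ else 0
  have hker : SRSymbPow K Δ m ≤ RingHom.ker g.toRingHom := by
    have h1 : SRSymbPow K Δ m ≤ (PF K Fᶜ) ^ m := iInf₂_le F hF
    refine (h1.trans (Ideal.pow_le_self (by omega))).trans ?_
    refine Ideal.span_le.2 ?_
    rintro _ ⟨i, hi, rfl⟩
    have : i ∉ F := by simpa using hi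
    change g (X i) = 0
    simp [g, this]
  have hsurj : Function.Surjective (Ideal.Quotient.lift (SRSymbPow K Δ m) g.toRingHom hker) := by
    refine Ideal.Quotient.lift_surjective_of_surjective _ _ ?_
    intro p
    refine ⟨rename Subtype.val p, ?_⟩
    change g (rename Subtype.val p) = p
    simp only [g, aeval_rename]
    have he : ((fun i => if h : i ∈ F then (X ⟨i, h⟩ : MvPolynomial F K) else 0) ∘ Subtype.val) =
        (X : F → MvPolynomial F K) := by
      funext i
      simp
    rw [he]
    exact aeval_X_left_apply p
  have h3 := ringKrullDim_le_of_surjective _ hsurj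
  rw [MvPolynomial.ringKrullDim_of_isNoetherianRing, ringKrullDim_eq_zero_of_field] at h3
  refine lt_of_lt_of_le ?_ h3
  simp only [Nat.card_eq_fintype_card, Fintype.card_coe, zero_add]
  exact_mod_cast hFc

end poly
end QB
end

/-- **Lemma.** If `dim Δ ≥ 1` and the symbolic power `I_Δ^{(m)}` is quasi-Buchsbaum for
some `m ≥ 2`, then `Δ` is connected. -/
theorem connected_of_quasiBuchsbaum_symbolic_power (K : Type) [Field K] {n : ℕ}
    (Δ : SimComplex n)
    (hV : ∀ i : Fin n, ({i} : Finset (Fin n)) ∈ Δ.faces) (hdim : 1 ≤ Δ.dim)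
    (m : ℕ) (hm : 2 ≤ m) (h : IsQuasiBuchsbaum K (SRSymbPow K Δ m)) :
    Δ.Connected := by
  intro u _ v _
  by_contra huv
  have hF (F : Finset (Fin n)) (hF : Δ.IsFacet F) (w : Fin n) (hw : w ∈ F) (r : Δ.Reach u w) :
      (F : Set (Fin n)) ⊆ {w | Δ.Reach u w} := by
    intro w' hw'
    by_cases e : w = w'
    · exact e ▸ r
    · exact Relation.ReflTransGen.tail r ⟨e, Δ.down_closed hF.1 (by
        intro a ha
        rcases Finset.mem_insert.1 ha with rfl | ha
        · exact hw
        · rw [Finset.mem_singleton.1 ha]; exact hw')⟩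
  have hF' (F : Finset (Fin n)) (hFf : Δ.IsFacet F) (w : Fin n) (hw : w ∈ F) (r : ¬ Δ.Reach u w) :
      (F : Set (Fin n)) ⊆ {w | Δ.Reach u w}ᶜ :=
    fun w' hw' r' => r (hF F hFf w' hw' r' hw)
  set W : Set (Fin n) := {w | Δ.Reach u w} with hW
  have huW : u ∈ W := Relation.ReflTransGen.refl
  have hI : SRSymbPow K Δ m = QB.IW K Δ m W ⊓ QB.IW K Δ m Wᶜ := by
    ext p
    rw [Submodule.mem_inf, QB.mem_IW, QB.mem_IW]
    simp only [SRSymbPow, Submodule.mem_iInf]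
    refine ⟨fun h => ⟨fun F hF _ => h F hF, fun F hF _ => h F hF⟩, fun h F hFf => ?_⟩
    obtain ⟨w, hw⟩ := QB.facet_nonempty hV u hFf
    by_cases r : Δ.Reach u w
    · exact h.1 F hFf (hF F hFf w hw r)
    · exact h.2 F hFf (hF' F hFf w hw r)
  have h1 := h 1 (QB.dim_lt Δ hdim m hm) (MvPolynomial.X u) (Ideal.subset_span ⟨u, rfl⟩)
  unfold locCoh at h1
  rw [hI] at h1
  have hrad : maxIdeal K n ≤ (QB.IW K Δ m W ⊔ QB.IW K Δ m Wᶜ).radical := by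
    refine Ideal.span_le.2 ?_
    rintro _ ⟨i, rfl⟩
    refine ⟨m, ?_⟩
    by_cases hi : i ∈ W
    · exact Ideal.mem_sup_right (QB.X_pow_mem_IW m i (by simpa using hi))
    · exact Ideal.mem_sup_left (QB.X_pow_mem_IW m i hi)
  obtain ⟨t, ht⟩ := Ideal.exists_pow_le_of_le_radical_of_fg hrad (IsNoetherian.noetherian _)
  have h2 := QB.alg_key _ _ _ _ h1 t ht (QB.IW_sat hV u m W) (QB.IW_sat hV u m Wᶜ)
  have h3 := sup_le (QB.IW_le (K := K) hV hm u (fun F hFf hu => hF F hFf u hu huW))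
    (QB.IW_le (K := K) hV hm v (fun F hFf hv => hF' F hFf v hv huv)) h2
  rw [QB.maxIdeal_eq, QB.mem_PF_pow] at h3
  have h4 := h3 (Finsupp.single u 1) (by simp [MvPolynomial.X, MvPolynomial.mem_support_iff])
  simp [Finsupp.single_apply] at h4
end
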